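/- arXiv:1810.09392 — 2 statements merged into one kernel-verified Lean document; each statement's English description precedes it below -/
import Mathlib

section
/- The Fourier coefficients of E_{4,2} and of E_{4,1}² are congruent modulo 12: writing E_{4,2}(τ,z) = Σ_{n≥0,l∈ℤ} a(n,l)q^nζ^l and E_{4,1}(τ,z)² = Σ_{n≥0,l∈ℤ} b(n,l)q^nζ^l, one has a(n,l), b(n,l) ∈ ℤ and a(n,l) ≡ b(n,l) (mod 12) for all n ∈ ℕ, l ∈ ℤ. -/
noncomputable section

open Complex

namespace JacobiPaper

/-- `e2 w = e^{2 π i w}`. -/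
def e2 (w : ℂ) : ℂ := Complex.exp (2 * (Real.pi : ℂ) * Complex.I * w)

/-- `q = e^{2 π i τ}`. -/
def qC (τ : ℂ) : ℂ := e2 τ

/-- `ζ = e^{2 π i z}`. -/
def zetaC (z : ℂ) : ℂ := e2 z

/-- The Dedekind eta function `η(τ) = q^{1/24} ∏_{n ≥ 1} (1 - qⁿ)`. -/
def eta (τ : ℂ) : ℂ :=
  Complex.exp ((Real.pi : ℂ) * Complex.I * τ / 12) * ∏' n : ℕ, (1 - qC τ ^ (n + 1))

/-- The odd Jacobi theta function
`ϑ(τ,z) = q^{1/8} (ζ^{1/2} - ζ^{-1/2}) ∏_{n ≥ 1} (1 - qⁿζ)(1 - qⁿζ⁻¹)(1 - qⁿ)`. -/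
def theta (τ z : ℂ) : ℂ :=
  Complex.exp ((Real.pi : ℂ) * Complex.I * τ / 4) *
    (Complex.exp ((Real.pi : ℂ) * Complex.I * z) - Complex.exp (-((Real.pi : ℂ) * Complex.I * z))) *
    ∏' n : ℕ,
      ((1 - qC τ ^ (n + 1) * zetaC z) * (1 - qC τ ^ (n + 1) * (zetaC z)⁻¹) * (1 - qC τ ^ (n + 1)))

/-- `ϑ₀₀(τ,z) = Σ_{n ∈ ℤ} q^{n²/2} ζⁿ`. -/
def theta00 (τ z : ℂ) : ℂ :=
  ∑' n : ℤ, Complex.exp ((Real.pi : ℂ) * Complex.I * (n : ℂ) ^ 2 * τ +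
    2 * (Real.pi : ℂ) * Complex.I * (n : ℂ) * z)

/-- `ϑ₀₁(τ,z) = Σ_{n ∈ ℤ} (-1)ⁿ q^{n²/2} ζⁿ`. -/
def theta01 (τ z : ℂ) : ℂ :=
  ∑' n : ℤ, (-1 : ℂ) ^ n * Complex.exp ((Real.pi : ℂ) * Complex.I * (n : ℂ) ^ 2 * τ +
    2 * (Real.pi : ℂ) * Complex.I * (n : ℂ) * z)

/-- `ϑ₁₀(τ,z) = q^{1/8} ζ^{1/2} Σ_{n ∈ ℤ} q^{n(n+1)/2} ζⁿ`. -/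
def theta10 (τ z : ℂ) : ℂ :=
  Complex.exp ((Real.pi : ℂ) * Complex.I * τ / 4) * Complex.exp ((Real.pi : ℂ) * Complex.I * z) *
    ∑' n : ℤ, Complex.exp ((Real.pi : ℂ) * Complex.I * (n : ℂ) * ((n : ℂ) + 1) * τ +
      2 * (Real.pi : ℂ) * Complex.I * (n : ℂ) * z)

/-- `ξ₀₀(τ,z) = ϑ₀₀(τ,z)/ϑ₀₀(τ,0)`. -/
def xi00 (τ z : ℂ) : ℂ := theta00 τ z / theta00 τ 0

/-- `ξ₀₁(τ,z) = ϑ₀₁(τ,z)/ϑ₀₁(τ,0)`. -/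
def xi01 (τ z : ℂ) : ℂ := theta01 τ z / theta01 τ 0

/-- `ξ₁₀(τ,z) = ϑ₁₀(τ,z)/ϑ₁₀(τ,0)`. -/
def xi10 (τ z : ℂ) : ℂ := theta10 τ z / theta10 τ 0

/-- The weak Jacobi form `φ_{0,1} = 4(ξ₀₀² + ξ₀₁² + ξ₁₀²)`. -/
def phi01 (τ z : ℂ) : ℂ := 4 * (xi00 τ z ^ 2 + xi01 τ z ^ 2 + xi10 τ z ^ 2)

/-- The weak Jacobi form `φ_{0,2}(τ,z) = 2(ξ₀₀ + ξ₀₁ + ξ₁₀)(τ,2z)`. -/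
def phi02 (τ z : ℂ) : ℂ := 2 * (xi00 τ (2 * z) + xi01 τ (2 * z) + xi10 τ (2 * z))

/-- The weak Jacobi form `φ_{0,3}(τ,z) = ϑ(τ,2z)²/ϑ(τ,z)²`. -/
def phi03 (τ z : ℂ) : ℂ := theta τ (2 * z) ^ 2 / theta τ z ^ 2

/-- The weak Jacobi form `φ_{0,4}(τ,z) = ϑ(τ,3z)/ϑ(τ,z)`. -/
def phi04 (τ z : ℂ) : ℂ := theta τ (3 * z) / theta τ z

/-- The weak Jacobi form `φ_{-2,1}(τ,z) = ϑ(τ,z)²/η(τ)⁶`. -/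
def phiM21 (τ z : ℂ) : ℂ := theta τ z ^ 2 / eta τ ^ 6

/-- The divisor power sum `σ_k(n)`. -/
def sigma' (k n : ℕ) : ℕ := ∑ d ∈ n.divisors, d ^ k

/-- The normalized Eisenstein series `E_k(τ) = 1 - (2k/B_k) Σ_{n ≥ 1} σ_{k-1}(n) qⁿ`. -/
def Eis (k : ℕ) (τ : ℂ) : ℂ :=
  1 - (2 * (k : ℂ) / ((bernoulli k : ℚ) : ℂ)) *
    ∑' n : ℕ, (sigma' (k - 1) (n + 1) : ℂ) * qC τ ^ (n + 1)

/-- The discriminant cusp form `Δ = η²⁴`. -/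
def Delta (τ : ℂ) : ℂ := eta τ ^ 24

/-- The modular invariant `j = E₄³/Δ`. -/
def jInv (τ : ℂ) : ℂ := Eis 4 τ ^ 3 / Delta τ

/-- A choice of `(a, b)` with `a d - b c = 1` completing a coprime pair `(c, d)` to a matrix
`(a b; c d) ∈ SL₂(ℤ)`. -/
def bezout (c d : ℤ) : ℤ × ℤ :=
  haveI : Decidable (∃ ab : ℤ × ℤ, ab.1 * d - ab.2 * c = 1) := Classical.propDecidable _
  if h : ∃ ab : ℤ × ℤ, ab.1 * d - ab.2 * c = 1 then h.choose else 0

/-- The summand `(cτ+d)^{-k} Σ_{l ∈ ℤ} e^{2πim(l²(aτ+b)/(cτ+d) + 2lz/(cτ+d) - cz²/(cτ+d))}`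
of the Jacobi–Eisenstein series attached to a coprime pair `(c,d)`; it does not depend on the
choice of `(a,b)` completing `(c,d)` to an element of `SL₂(ℤ)`. -/
def EisJSummand (k m : ℕ) (τ z : ℂ) (c d : ℤ) : ℂ :=
  ((c : ℂ) * τ + (d : ℂ)) ^ (-(k : ℤ)) *
    ∑' l : ℤ, e2 ((m : ℂ) * ((l : ℂ) ^ 2 * (((bezout c d).1 : ℂ) * τ + ((bezout c d).2 : ℂ)) /
        ((c : ℂ) * τ + (d : ℂ)) +
      2 * (l : ℂ) * z / ((c : ℂ) * τ + (d : ℂ)) - (c : ℂ) * z ^ 2 / ((c : ℂ) * τ + (d : ℂ))))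

/-- The Jacobi–Eisenstein series `E_{k,m}` of weight `k` and index `m`. -/
def EisJ (k m : ℕ) (τ z : ℂ) : ℂ :=
  (1 / 2) * ∑' p : {p : ℤ × ℤ // IsCoprime p.1 p.2}, EisJSummand k m τ z p.1.1 p.1.2

/-- `F_{6,3} = (1/2)(E_{6,1} φ_{0,2} - E₆ φ_{0,3})`. -/
def F63 (τ z : ℂ) : ℂ := (1 / 2) * (EisJ 6 1 τ z * phi02 τ z - Eis 6 τ * phi03 τ z)

/-- A weak Jacobi form of weight `k ∈ ℤ` and index `m ∈ ℕ`: a holomorphic function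
`φ : ℍ × ℂ → ℂ` satisfying the two Jacobi transformation laws and having a Fourier expansion
`φ(τ,z) = Σ_{n ≥ 0, l ∈ ℤ} f(n,l) qⁿ ζˡ`. -/
def IsWeakJacobiForm (k : ℤ) (m : ℕ) (φ : ℂ → ℂ → ℂ) (f : ℕ → ℤ → ℂ) : Prop :=
  DifferentiableOn ℂ (fun p : ℂ × ℂ => φ p.1 p.2) {p : ℂ × ℂ | 0 < p.1.im} ∧
  (∀ a b c d : ℤ, a * d - b * c = 1 → ∀ τ z : ℂ, 0 < τ.im →
    φ (((a : ℂ) * τ + (b : ℂ)) / ((c : ℂ) * τ + (d : ℂ))) (z / ((c : ℂ) * τ + (d : ℂ))) =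
      ((c : ℂ) * τ + (d : ℂ)) ^ k *
        e2 ((m : ℂ) * ((c : ℂ) * z ^ 2 / ((c : ℂ) * τ + (d : ℂ)))) * φ τ z) ∧
  (∀ x y : ℤ, ∀ τ z : ℂ, 0 < τ.im →
    φ τ (z + (x : ℂ) * τ + (y : ℂ)) =
      e2 (-(m : ℂ) * ((x : ℂ) ^ 2 * τ + 2 * (x : ℂ) * z)) * φ τ z) ∧
  (∀ τ z : ℂ, 0 < τ.im →
    HasSum (fun p : ℕ × ℤ => f p.1 p.2 * e2 ((p.1 : ℂ) * τ + (p.2 : ℂ) * z)) (φ τ z))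

/-- A weakly holomorphic Jacobi form of weight `0` and index `m ∈ ℕ`: as a weak Jacobi form,
but the Fourier expansion `φ(τ,z) = Σ_{n ≥ n₀, l ∈ ℤ} f(n,l) qⁿ ζˡ` may contain finitely many
negative powers of `q`. -/
def IsWeaklyHolomorphicJacobiForm0 (m : ℕ) (φ : ℂ → ℂ → ℂ) (f : ℤ → ℤ → ℂ) : Prop :=
  DifferentiableOn ℂ (fun p : ℂ × ℂ => φ p.1 p.2) {p : ℂ × ℂ | 0 < p.1.im} ∧
  (∀ a b c d : ℤ, a * d - b * c = 1 → ∀ τ z : ℂ, 0 < τ.im →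
    φ (((a : ℂ) * τ + (b : ℂ)) / ((c : ℂ) * τ + (d : ℂ))) (z / ((c : ℂ) * τ + (d : ℂ))) =
      e2 ((m : ℂ) * ((c : ℂ) * z ^ 2 / ((c : ℂ) * τ + (d : ℂ)))) * φ τ z) ∧
  (∀ x y : ℤ, ∀ τ z : ℂ, 0 < τ.im →
    φ τ (z + (x : ℂ) * τ + (y : ℂ)) =
      e2 (-(m : ℂ) * ((x : ℂ) ^ 2 * τ + 2 * (x : ℂ) * z)) * φ τ z) ∧
  (∃ n₀ : ℤ, ∀ n : ℤ, n < n₀ → ∀ l : ℤ, f n l = 0) ∧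
  (∀ τ z : ℂ, 0 < τ.im →
    HasSum (fun p : ℤ × ℤ => f p.1 p.2 * e2 ((p.1 : ℂ) * τ + (p.2 : ℂ) * z)) (φ τ z))

/-- A function `φ` on `ℍ × ℂ` has integral Fourier coefficients if it is the sum of a Fourier
series `Σ_{n ≥ 0, l ∈ ℤ} f(n,l) qⁿ ζˡ` with all `f(n,l) ∈ ℤ`. -/
def HasIntegralFourierExpansion (φ : ℂ → ℂ → ℂ) : Prop :=
  ∃ f : ℕ → ℤ → ℤ, ∀ τ z : ℂ, 0 < τ.im →
    HasSum (fun p : ℕ × ℤ => (f p.1 p.2 : ℂ) * e2 ((p.1 : ℂ) * τ + (p.2 : ℂ) * z)) (φ τ z)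

lemma e2_add (a b : ℂ) : e2 (a + b) = e2 a * e2 b := by
  simp [e2, mul_add, Complex.exp_add]

lemma e2_zero : e2 0 = 1 := by simp [e2]

lemma e2_ne_zero (a : ℂ) : e2 a ≠ 0 := Complex.exp_ne_zero _

lemma e2_int (n : ℤ) : e2 n = 1 := by
  rw [e2, mul_comm, Complex.exp_int_mul_two_pi_mul_I]

lemma e2_add_int (a : ℂ) (n : ℤ) : e2 (a + n) = e2 a := by
  rw [e2_add, e2_int, mul_one]

lemma e2_eq_of_sub_int {a b : ℂ} (n : ℤ) (h : a = b + n) : e2 a = e2 b := by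
  rw [h, e2_add_int]

lemma e2_half : e2 (1 / 2) = -1 := by
  rw [e2, show 2 * (Real.pi : ℂ) * I * (1 / 2) = Real.pi * I by ring, Complex.exp_pi_mul_I]

lemma e2_quarter : e2 (1 / 4) = I := by
  rw [e2, show 2 * (Real.pi : ℂ) * I * (1 / 4) = Real.pi / 2 * I by ring,
    Complex.exp_pi_div_two_mul_I]

lemma norm_e2 (a : ℂ) : ‖e2 a‖ = Real.exp (-2 * Real.pi * a.im) := by
  rw [e2, Complex.norm_exp]
  congr 1
  simp [mul_assoc]

lemma e2_nsmul (n : ℕ) (a : ℂ) : e2 (n * a) = e2 a ^ n := by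
  rw [e2, e2, ← Complex.exp_nat_mul]
  ring_nf

lemma differentiable_e2 : Differentiable ℂ e2 := by
  unfold e2
  fun_prop

/-- The theta series `Σ q^{l²} ζ^{2l}`. -/
def thU (τ z : ℂ) : ℂ := jacobiTheta₂ (2 * z) (2 * τ)

/-- The theta series `Σ q^{(l+1/2)²} ζ^{2l+1}`. -/
def thV (τ z : ℂ) : ℂ := jacobiTheta₂ z (τ / 2) - thU τ z

/-- The theta constant `Σ q^{l²}`. -/
def thA (τ : ℂ) : ℂ := thU τ 0

/-- The theta constant `Σ q^{(l+1/2)²}`. -/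
def thB (τ : ℂ) : ℂ := thV τ 0

lemma jacobiTheta₂_term_eq_e2 (n : ℤ) (z τ : ℂ) :
    jacobiTheta₂_term n z τ = e2 (n ^ 2 / 2 * τ + n * z) := by
  rw [jacobiTheta₂_term, e2]
  ring_nf

lemma hasSum_jacobiTheta₂_e2 {τ : ℂ} (hτ : 0 < τ.im) (z : ℂ) :
    HasSum (fun n : ℤ => e2 (n ^ 2 / 2 * τ + n * z)) (jacobiTheta₂ z τ) := by
  simpa only [jacobiTheta₂_term_eq_e2] using hasSum_jacobiTheta₂_term z hτ

lemma tsum_eq_add_of_isCompl_range {β γ : Type*} {f : β → ℂ} (hf : Summable f) {g₁ g₂ : γ → β}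
    (h₁ : Function.Injective g₁) (h₂ : Function.Injective g₂)
    (h : IsCompl (Set.range g₁) (Set.range g₂)) :
    ∑' b, f b = ∑' c, f (g₁ c) + ∑' c, f (g₂ c) := by
  refine HasSum.tsum_eq (HasSum.add_isCompl h ?_ ?_)
  · exact h₁.hasSum_range_iff.2 (hf.comp_injective h₁).hasSum
  · exact h₂.hasSum_range_iff.2 (hf.comp_injective h₂).hasSum

lemma hasSum_thU {τ : ℂ} (hτ : 0 < τ.im) (z : ℂ) :
    HasSum (fun l : ℤ => e2 (l ^ 2 * τ + 2 * l * z)) (thU τ z) := by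
  have h := hasSum_jacobiTheta₂_e2 (τ := 2 * τ) (by simpa using hτ) (2 * z)
  refine h.congr_fun ?_
  intro l
  ring_nf

lemma two_im_pos {τ : ℂ} (hτ : 0 < τ.im) : 0 < (2 * τ).im := by simpa using hτ

lemma half_im_pos {τ : ℂ} (hτ : 0 < τ.im) : 0 < (τ / 2).im := by simpa using hτ

lemma isCompl_range_two_mul :
    IsCompl (Set.range fun l : ℤ => 2 * l) (Set.range fun l : ℤ => 2 * l + 1) := by
  rw [isCompl_iff, disjoint_iff, codisjoint_iff]
  constructor
  · ext n
    simp only [Set.inf_eq_inter, Set.mem_inter_iff, Set.mem_range, Set.bot_eq_empty,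
      Set.mem_empty_iff_false, iff_false]
    rintro ⟨⟨a, ha⟩, b, hb⟩
    omega
  · ext n
    simp only [Set.sup_eq_union, Set.mem_union, Set.mem_range, Set.top_eq_univ, Set.mem_univ,
      iff_true]
    rcases Int.even_or_odd' n with ⟨k, h | h⟩
    · exact Or.inl ⟨k, h.symm⟩
    · exact Or.inr ⟨k, h.symm⟩

lemma hasSum_thV {τ : ℂ} (hτ : 0 < τ.im) (z : ℂ) :
    HasSum (fun l : ℤ => e2 ((l + 1 / 2) ^ 2 * τ + (2 * l + 1) * z)) (thV τ z) := by
  have h := hasSum_jacobiTheta₂_e2 (half_im_pos hτ) z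
  have hi : Function.Injective fun l : ℤ => 2 * l + 1 := fun a b hab => by
    simp only at hab; omega
  have hs := h.summable.comp_injective hi
  have hsplit := tsum_eq_add_of_isCompl_range h.summable (g₁ := fun l : ℤ => 2 * l)
    (fun a b hab => by simp only at hab; omega) hi isCompl_range_two_mul
  rw [h.tsum_eq] at hsplit
  have hU : ∑' l : ℤ, e2 (((2 * l : ℤ) : ℂ) ^ 2 / 2 * (τ / 2) + ((2 * l : ℤ) : ℂ) * z)
      = thU τ z := by
    rw [← (hasSum_thU hτ z).tsum_eq]
    refine tsum_congr fun l => ?_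
    push_cast
    ring_nf
  rw [hU] at hsplit
  have : thV τ z = ∑' l : ℤ, e2 (((2 * l + 1 : ℤ) : ℂ) ^ 2 / 2 * (τ / 2)
      + ((2 * l + 1 : ℤ) : ℂ) * z) := by
    rw [thV, hsplit]; ring
  rw [this]
  refine hs.hasSum.congr_fun ?_
  intro l
  simp only [Function.comp]
  push_cast
  ring_nf

/-- Translation of the first theta series by a half period produces the second one. -/
lemma thV_eq {τ : ℂ} (hτ : 0 < τ.im) (z : ℂ) :
    thV τ z = e2 (τ / 4 + z) * thU τ (z + τ / 2) := by
  rw [← (hasSum_thV hτ z).tsum_eq, ← (hasSum_thU hτ _).tsum_eq, ← tsum_mul_left]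
  refine tsum_congr fun l => ?_
  rw [← e2_add]
  ring_nf

lemma thU_add_thV (τ z : ℂ) : thU τ z + thV τ z = jacobiTheta₂ z (τ / 2) := by
  rw [thV]; ring

lemma thU_T (τ z : ℂ) : thU (τ + 1) z = thU τ z := by
  rw [thU, show 2 * (τ + 1) = 2 * τ + 2 by ring, jacobiTheta₂_add_right, thU]

lemma thV_T {τ : ℂ} (hτ : 0 < τ.im) (z : ℂ) : thV (τ + 1) z = I * thV τ z := by
  rw [← (hasSum_thV hτ z).tsum_eq, ← (hasSum_thV (τ := τ + 1) (by simpa using hτ) z).tsum_eq,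
    ← tsum_mul_left]
  refine tsum_congr fun l => ?_
  rw [← e2_quarter, ← e2_add]
  refine e2_eq_of_sub_int (l ^ 2 + l) ?_
  push_cast
  ring

/-- The automorphy factor of the inversion. -/
def thS (τ : ℂ) : ℂ := (-I * (τ / 2)) ^ (1 / 2 : ℂ)

lemma thS_sq (τ : ℂ) : thS τ ^ 2 = -I * (τ / 2) := by
  rw [thS, ← Complex.cpow_nat_mul]
  norm_num

lemma thS_ne_zero {τ : ℂ} (hτ : τ ≠ 0) : thS τ ≠ 0 := by
  intro h
  have := thS_sq τ
  rw [h] at this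
  simp [hτ] at this

lemma ne_zero_of_im_pos {τ : ℂ} (hτ : 0 < τ.im) : τ ≠ 0 := by
  rintro rfl
  simp at hτ

lemma im_inv_pos {τ : ℂ} (hτ : 0 < τ.im) : 0 < (-1 / τ).im := by
  have h : 0 < normSq τ := normSq_pos.2 (ne_zero_of_im_pos hτ)
  rw [neg_div, one_div, neg_im, inv_im]
  field_simp
  linarith

lemma cpow_two_thS {τ : ℂ} (hτ : τ ≠ 0) : (-I * (2 * τ)) ^ (1 / 2 : ℂ) = 2 * thS τ := by
  have hx : -I * (τ / 2) ≠ 0 := by simp [hτ]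
  have h4 : (4 : ℂ) * (-I * (τ / 2)) = ((4 : ℝ) : ℂ) * (-I * (τ / 2)) := by norm_num
  rw [thS, show -I * (2 * τ) = 4 * (-I * (τ / 2)) by ring, Complex.cpow_def_of_ne_zero hx,
    Complex.cpow_def_of_ne_zero (by simp [hτ]), h4, Complex.log_ofReal_mul (by norm_num) hx,
    add_mul, Complex.exp_add]
  congr 1
  rw [show (1 / 2 : ℂ) = ((1 / 2 : ℝ) : ℂ) by norm_num, ← Complex.ofReal_mul, ← Complex.ofReal_exp,
    ← Real.rpow_def_of_pos (by norm_num), ← Real.sqrt_eq_rpow,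
    show (4 : ℝ) = 2 ^ 2 by norm_num, Real.sqrt_sq (by norm_num)]
  norm_num

lemma thU_S {τ : ℂ} (hτ : 0 < τ.im) (z : ℂ) :
    thU (-1 / τ) (z / τ) = thS τ * e2 (z ^ 2 / τ) * (thU τ z + thV τ z) := by
  have h0 := ne_zero_of_im_pos hτ
  rw [thU_add_thV, jacobiTheta₂_functional_equation z (τ / 2), ← thS]
  have hs := thS_ne_zero h0
  have he : cexp (-Real.pi * I * z ^ 2 / (τ / 2)) = (e2 (z ^ 2 / τ))⁻¹ := by
    rw [e2, ← Complex.exp_neg]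
    congr 1
    field_simp
  have he0 := e2_ne_zero (z ^ 2 / τ)
  rw [he, thU]
  field_simp

lemma thU_add_thV_S {τ : ℂ} (hτ : 0 < τ.im) (z : ℂ) :
    thU (-1 / τ) (z / τ) + thV (-1 / τ) (z / τ) = 2 * thS τ * e2 (z ^ 2 / τ) * thU τ z := by
  have h0 := ne_zero_of_im_pos hτ
  rw [thU_add_thV, thU, jacobiTheta₂_functional_equation (2 * z) (2 * τ), cpow_two_thS h0]
  have hs := thS_ne_zero h0
  have he : cexp (-Real.pi * I * (2 * z) ^ 2 / (2 * τ)) = (e2 (z ^ 2 / τ))⁻¹ := by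
    rw [e2, ← Complex.exp_neg]
    congr 1
    field_simp
  have he0 := e2_ne_zero (z ^ 2 / τ)
  rw [he]
  field_simp

lemma thV_S {τ : ℂ} (hτ : 0 < τ.im) (z : ℂ) :
    thV (-1 / τ) (z / τ) = thS τ * e2 (z ^ 2 / τ) * (thU τ z - thV τ z) := by
  have h1 := thU_S hτ z
  have h2 := thU_add_thV_S hτ z
  linear_combination h2 - h1

lemma thU_add_half (τ z : ℂ) : thU τ (z + 1 / 2) = thU τ z := by
  rw [thU, show 2 * (z + 1 / 2) = 2 * z + 1 by ring, jacobiTheta₂_add_left, thU]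

lemma thV_add_half {τ : ℂ} (hτ : 0 < τ.im) (z : ℂ) : thV τ (z + 1 / 2) = -thV τ z := by
  rw [thV_eq hτ, thV_eq hτ, show z + 1 / 2 + τ / 2 = z + τ / 2 + 1 / 2 by ring, thU_add_half,
    show τ / 4 + (z + 1 / 2) = τ / 4 + z + 1 / 2 by ring, e2_add, e2_half]
  ring

lemma thU_half (τ : ℂ) : thU τ (1 / 2) = thA τ := by
  simpa [thA] using thU_add_half τ 0

lemma thV_half {τ : ℂ} (hτ : 0 < τ.im) : thV τ (1 / 2) = -thB τ := by
  simpa [thB] using thV_add_half hτ 0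

lemma e2_mul_thU_tau {τ : ℂ} (hτ : 0 < τ.im) : e2 (τ / 4) * thU τ (τ / 2) = thB τ := by
  simpa [thB] using (thV_eq hτ 0).symm

lemma e2_mul_thV_tau {τ : ℂ} (hτ : 0 < τ.im) : e2 (τ / 4) * thV τ (τ / 2) = thA τ := by
  have h : cexp (-Real.pi * I * (2 * τ + 2 * 0)) = e2 (-τ) := by rw [e2]; ring_nf
  rw [thV_eq hτ, thA, thU, thU, show 2 * (τ / 2 + τ / 2) = 0 + 2 * τ by ring,
    jacobiTheta₂_add_left', h, mul_zero, ← mul_assoc, ← mul_assoc, ← e2_add, ← e2_add,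
    show τ / 4 + (τ / 4 + τ / 2) + -τ = 0 by ring, e2_zero, one_mul]

/-- The addition formula for theta functions. -/
lemma jacobiTheta₂_mul_jacobiTheta₂ {τ : ℂ} (hτ : 0 < τ.im) (x y : ℂ) :
    jacobiTheta₂ (x + y) τ * jacobiTheta₂ (x - y) τ
      = thU τ x * thU τ y + thV τ x * thV τ y := by
  have h₁ := hasSum_jacobiTheta₂_e2 hτ (x + y)
  have h₂ := hasSum_jacobiTheta₂_e2 hτ (x - y)
  have hux := hasSum_thU hτ x
  have huy := hasSum_thU hτ y
  have hvx := hasSum_thV hτ x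
  have hvy := hasSum_thV hτ y
  rw [← h₁.tsum_eq, ← h₂.tsum_eq, ← hux.tsum_eq, ← huy.tsum_eq, ← hvx.tsum_eq, ← hvy.tsum_eq,
    tsum_mul_tsum_of_summable_norm h₁.summable.norm h₂.summable.norm,
    tsum_mul_tsum_of_summable_norm hux.summable.norm huy.summable.norm,
    tsum_mul_tsum_of_summable_norm hvx.summable.norm hvy.summable.norm,
    tsum_eq_add_of_isCompl_range
      (summable_mul_of_summable_norm h₁.summable.norm h₂.summable.norm)
      (g₁ := fun p : ℤ × ℤ => (p.1 + p.2, p.1 - p.2))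
      (g₂ := fun p : ℤ × ℤ => (p.1 + p.2 + 1, p.1 - p.2))]
  · congr 1 <;>
    · refine tsum_congr fun p => ?_
      rw [← e2_add, ← e2_add]
      push_cast
      ring_nf
  · rintro ⟨a, b⟩ ⟨c, d⟩ h
    simp only [Prod.mk.injEq] at h ⊢
    omega
  · rintro ⟨a, b⟩ ⟨c, d⟩ h
    simp only [Prod.mk.injEq] at h ⊢
    omega
  · rw [isCompl_iff, Set.disjoint_iff, codisjoint_iff]
    constructor
    · rintro ⟨m, n⟩ ⟨⟨p, hp⟩, q, hq⟩
      simp only [Prod.mk.injEq] at hp hq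
      omega
    · ext ⟨m, n⟩
      simp only [Set.sup_eq_union, Set.mem_union, Set.mem_range, Set.top_eq_univ, Set.mem_univ,
        iff_true, Prod.mk.injEq, Prod.exists]
      rcases Int.even_or_odd' (m + n) with ⟨k, h | h⟩
      · exact Or.inl ⟨k, m - k, by omega, by omega⟩
      · exact Or.inr ⟨k, m - k - 1, by omega, by omega⟩

lemma thA_eq (τ : ℂ) : thA τ = jacobiTheta (2 * τ) := by
  rw [thA, thU, jacobiTheta_eq_jacobiTheta₂, mul_zero]

lemma thA_T (τ : ℂ) : thA (τ + 1) = thA τ := thU_T τ 0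

lemma thB_T {τ : ℂ} (hτ : 0 < τ.im) : thB (τ + 1) = I * thB τ := thV_T hτ 0

lemma thA_S {τ : ℂ} (hτ : 0 < τ.im) : thA (-1 / τ) = thS τ * (thA τ + thB τ) := by
  simpa [e2_zero, thA, thB] using thU_S hτ 0

lemma thB_S {τ : ℂ} (hτ : 0 < τ.im) : thB (-1 / τ) = thS τ * (thA τ - thB τ) := by
  simpa [e2_zero, thA, thB] using thV_S hτ 0

lemma add_one_im_pos {τ : ℂ} (hτ : 0 < τ.im) : 0 < (τ + 1).im := by simpa using hτ

lemma thA_add_thB (τ : ℂ) : thA τ + thB τ = jacobiTheta (τ / 2) := by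
  rw [jacobiTheta_eq_jacobiTheta₂, thA, thB, thU_add_thV]

lemma thA_sub_thB {τ : ℂ} (hτ : 0 < τ.im) : thA τ - thB τ = jacobiTheta (τ / 2 + 1) := by
  have h := thA_add_thB (τ + 1 + 1)
  rw [thA_T, thA_T, thB_T (add_one_im_pos hτ), thB_T hτ,
    show (τ + 1 + 1) / 2 = τ / 2 + 1 by ring] at h
  rw [← h]
  linear_combination (-thB τ) * I_mul_I

lemma jacobiTheta_sq {τ : ℂ} (hτ : 0 < τ.im) :
    jacobiTheta τ ^ 2 = thA τ ^ 2 + thB τ ^ 2 := by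
  have h := jacobiTheta₂_mul_jacobiTheta₂ hτ 0 0
  rw [add_zero, sub_zero, ← jacobiTheta_eq_jacobiTheta₂] at h
  rw [sq, h, thA, thB]
  ring

lemma jacobiTheta_add_one_sq {τ : ℂ} (hτ : 0 < τ.im) :
    jacobiTheta (τ + 1) ^ 2 = thA τ ^ 2 - thB τ ^ 2 := by
  rw [jacobiTheta_sq (add_one_im_pos hτ), thA_T, thB_T hτ]
  linear_combination (thB τ) ^ 2 * I_mul_I

lemma jacobiTheta_mul_jacobiTheta_add_one {τ : ℂ} (hτ : 0 < τ.im) :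
    jacobiTheta τ * jacobiTheta (τ + 1) = jacobiTheta (2 * τ + 1) ^ 2 := by
  have h1 := thA_add_thB (2 * τ)
  have h2 := thA_sub_thB (two_im_pos hτ)
  rw [mul_div_cancel_left₀ τ two_ne_zero] at h1 h2
  rw [jacobiTheta_add_one_sq (two_im_pos hτ), ← h1, ← h2]
  ring

lemma jacobiTheta_ne_zero_of_one_le_im {τ : ℂ} (hτ : 1 ≤ τ.im) : jacobiTheta τ ≠ 0 := by
  intro h
  have hb := norm_jacobiTheta_sub_one_le (by linarith : 0 < τ.im)
  rw [h, zero_sub, norm_neg, norm_one] at hb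
  have he : Real.exp (-Real.pi * τ.im) < 1 / 3 := by
    have h1 : Real.exp (-Real.pi * τ.im) ≤ Real.exp (-3) := by
      apply Real.exp_le_exp.2
      nlinarith [Real.pi_gt_three]
    have h2 : (3 : ℝ) + 1 ≤ Real.exp 3 := Real.add_one_le_exp 3
    have h3 : Real.exp (-3) ≤ 1 / 4 := by
      rw [Real.exp_neg, one_div]
      exact inv_anti₀ (by norm_num) (by linarith)
    linarith
  rw [div_mul_eq_mul_div, le_div_iff₀ (by linarith)] at hb
  linarith

lemma jacobiTheta_ne_zero {τ : ℂ} (hτ : 0 < τ.im) : jacobiTheta τ ≠ 0 := by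
  have key : ∀ n : ℕ, ∀ τ : ℂ, 0 < τ.im → 1 ≤ 2 ^ n * τ.im → jacobiTheta τ ≠ 0 := by
    intro n
    induction n with
    | zero => exact fun τ _ h => jacobiTheta_ne_zero_of_one_le_im (by simpa using h)
    | succ n ih =>
      intro τ hτ h h0
      have h1 := jacobiTheta_mul_jacobiTheta_add_one hτ
      rw [h0, zero_mul] at h1
      refine ih (2 * τ + 1) (by simpa using hτ) ?_ (pow_eq_zero_iff two_ne_zero |>.1 h1.symm)
      have : (2 * τ + 1).im = 2 * τ.im := by simp
      rw [this]
      calc 1 ≤ 2 ^ (n + 1) * τ.im := h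
        _ = 2 ^ n * (2 * τ.im) := by ring
  obtain ⟨n, hn⟩ := pow_unbounded_of_one_lt (1 / τ.im) (one_lt_two : (1 : ℝ) < 2)
  exact key n τ hτ ((div_lt_iff₀ hτ).1 hn).le

lemma thA_ne_zero {τ : ℂ} (hτ : 0 < τ.im) : thA τ ≠ 0 := by
  rw [thA_eq]
  exact jacobiTheta_ne_zero (two_im_pos hτ)

lemma neg_one_div_neg_one_div (τ : ℂ) : -1 / (-1 / τ) = τ := by
  rw [neg_div, neg_div, div_neg, neg_neg, one_div_one_div]

lemma thB_ne_zero {τ : ℂ} (hτ : 0 < τ.im) : thB τ ≠ 0 := by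
  have h := thB_S (im_inv_pos hτ)
  rw [neg_one_div_neg_one_div, thA_sub_thB (im_inv_pos hτ)] at h
  rw [h]
  exact mul_ne_zero (thS_ne_zero (ne_zero_of_im_pos (im_inv_pos hτ)))
    (jacobiTheta_ne_zero (add_one_im_pos (half_im_pos (im_inv_pos hτ))))

lemma thA_sq_add_thB_sq_ne_zero {τ : ℂ} (hτ : 0 < τ.im) : thA τ ^ 2 + thB τ ^ 2 ≠ 0 := by
  rw [← jacobiTheta_sq hτ]
  exact pow_ne_zero 2 (jacobiTheta_ne_zero hτ)

lemma thA_sq_sub_thB_sq_ne_zero {τ : ℂ} (hτ : 0 < τ.im) : thA τ ^ 2 - thB τ ^ 2 ≠ 0 := by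
  rw [← jacobiTheta_add_one_sq hτ]
  exact pow_ne_zero 2 (jacobiTheta_ne_zero (add_one_im_pos hτ))

/-- The quadratic theta seed of index two as a combination of products of index one thetas. -/
lemma jacobiTheta₂_four_mul {τ : ℂ} (hτ : 0 < τ.im) (z : ℂ) :
    jacobiTheta₂ (4 * z) (4 * τ)
      = ((thU τ z ^ 2 + thV τ z ^ 2) / jacobiTheta τ
        + (thU τ z ^ 2 - thV τ z ^ 2) / jacobiTheta (τ + 1)) / 2 := by
  have h1 := jacobiTheta₂_mul_jacobiTheta₂ hτ z z
  have h2 := jacobiTheta₂_mul_jacobiTheta₂ (add_one_im_pos hτ) z z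
  rw [sub_self, ← jacobiTheta_eq_jacobiTheta₂] at h1 h2
  rw [thU_T, thV_T hτ] at h2
  have ha := jacobiTheta_ne_zero hτ
  have hb := jacobiTheta_ne_zero (add_one_im_pos hτ)
  have h3 : jacobiTheta₂ (2 * z) τ + jacobiTheta₂ (2 * z) (τ + 1)
      = 2 * jacobiTheta₂ (4 * z) (4 * τ) := by
    have h4 := thU_add_thV (2 * τ) (2 * z)
    have h5 := thU_add_thV (2 * τ + 1 + 1) (2 * z)
    rw [thU_T, thU_T, thV_T (add_one_im_pos (two_im_pos hτ)), thV_T (two_im_pos hτ),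
      show (2 * τ + 1 + 1) / 2 = τ + 1 by ring] at h5
    rw [mul_div_cancel_left₀ τ two_ne_zero] at h4
    rw [← h4, ← h5, thU, show 2 * (2 * z) = 4 * z by ring, show 2 * (2 * τ) = 4 * τ by ring]
    linear_combination (thV (2 * τ) (2 * z)) * I_mul_I
  have h6 : jacobiTheta₂ (2 * z) τ = (thU τ z ^ 2 + thV τ z ^ 2) / jacobiTheta τ := by
    rw [eq_div_iff ha, two_mul, h1]; ring
  have h7 : jacobiTheta₂ (2 * z) (τ + 1) = (thU τ z ^ 2 - thV τ z ^ 2) / jacobiTheta (τ + 1) := by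
    rw [eq_div_iff hb, two_mul, h2]; linear_combination (thV τ z ^ 2) * I_mul_I
  rw [← h6, ← h7, h3]
  ring

lemma jacobiTheta₂_add_two_mul_int (z τ : ℂ) (n : ℤ) :
    jacobiTheta₂ z (τ + 2 * n) = jacobiTheta₂ z τ := by
  refine tsum_congr fun l => ?_
  rw [jacobiTheta₂_term_eq_e2, jacobiTheta₂_term_eq_e2]
  refine e2_eq_of_sub_int (l ^ 2 * n) ?_
  push_cast
  ring

/-- The weight four summand of the Jacobi-Eisenstein series for an explicit matrix. -/
def eisTerm (m : ℕ) (τ z : ℂ) (a b c d : ℤ) : ℂ :=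
  (c * τ + d) ^ (-4 : ℤ) * (e2 (-(m * (c * z ^ 2 / (c * τ + d)))) *
    jacobiTheta₂ (2 * m * z / (c * τ + d)) (2 * m * ((a * τ + b) / (c * τ + d))))

lemma EisJSummand_eq_eisTerm_bezout (m : ℕ) (τ z : ℂ) (c d : ℤ) :
    EisJSummand 4 m τ z c d = eisTerm m τ z (bezout c d).1 (bezout c d).2 c d := by
  rw [EisJSummand, eisTerm, jacobiTheta₂]
  conv_rhs => rw [← tsum_mul_left]
  refine congrArg (fun w => ((c : ℂ) * τ + d) ^ (-4 : ℤ) * w) (tsum_congr fun l => ?_)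
  rw [jacobiTheta₂_term_eq_e2, ← e2_add]
  ring_nf

lemma bezout_spec {a b c d : ℤ} (h : a * d - b * c = 1) :
    (bezout c d).1 * d - (bezout c d).2 * c = 1 := by
  have h' : ∃ ab : ℤ × ℤ, ab.1 * d - ab.2 * c = 1 := ⟨(a, b), h⟩
  rw [bezout, dif_pos h']
  exact h'.choose_spec

lemma exists_of_isCoprime {c d : ℤ} (h : IsCoprime c d) : ∃ a b : ℤ, a * d - b * c = 1 := by
  obtain ⟨u, v, h⟩ := h
  exact ⟨v, -u, by linarith⟩

lemma isCoprime_of_det {a b c d : ℤ} (h : a * d - b * c = 1) : IsCoprime c d :=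
  ⟨-b, a, by linarith⟩

lemma denom_ne_zero {τ : ℂ} (hτ : 0 < τ.im) {c d : ℤ} (h : IsCoprime c d) :
    (c : ℂ) * τ + d ≠ 0 := by
  intro h0
  have him := congrArg Complex.im h0
  have hre := congrArg Complex.re h0
  have hc : c = 0 := by simpa [hτ.ne'] using him
  subst hc
  have hd : d = 0 := by simpa using hre
  subst hd
  exact not_isCoprime_zero_zero h

lemma eisTerm_congr (m : ℕ) {τ : ℂ} (hτ : 0 < τ.im) (z : ℂ) {a b a' b' c d : ℤ}
    (h : a * d - b * c = 1) (h' : a' * d - b' * c = 1) :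
    eisTerm m τ z a b c d = eisTerm m τ z a' b' c d := by
  have h0 := denom_ne_zero hτ (isCoprime_of_det h)
  obtain ⟨n, ha, hb⟩ : ∃ n : ℤ, a' = a + n * c ∧ b' = b + n * d := by
    refine ⟨a * (b' - b) - b * (a' - a), ?_, ?_⟩
    · linear_combination a * h' - a' * h
    · linear_combination b * h' - b' * h
  have : 2 * (m : ℂ) * ((a' * τ + b') / (c * τ + d))
      = 2 * m * ((a * τ + b) / (c * τ + d)) + 2 * ((m * n : ℤ) : ℂ) := by
    rw [ha, hb]
    push_cast
    field_simp
    ring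
  rw [eisTerm, eisTerm, this, jacobiTheta₂_add_two_mul_int]

lemma EisJSummand_eq_eisTerm (m : ℕ) {τ : ℂ} (hτ : 0 < τ.im) (z : ℂ) {a b c d : ℤ}
    (h : a * d - b * c = 1) : EisJSummand 4 m τ z c d = eisTerm m τ z a b c d := by
  rw [EisJSummand_eq_eisTerm_bezout]
  exact eisTerm_congr m hτ z (bezout_spec h) h

lemma EisJSummand_T (m : ℕ) {τ : ℂ} (hτ : 0 < τ.im) (z : ℂ) {c d : ℤ} (h : IsCoprime c d) :
    EisJSummand 4 m (τ + 1) z c d = EisJSummand 4 m τ z c (c + d) := by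
  obtain ⟨a, b, h⟩ := exists_of_isCoprime h
  rw [EisJSummand_eq_eisTerm m (add_one_im_pos hτ) z h,
    EisJSummand_eq_eisTerm m hτ z (show a * (c + d) - (a + b) * c = 1 by linarith)]
  simp only [eisTerm]
  push_cast
  ring_nf

lemma EisJSummand_S (m : ℕ) {τ : ℂ} (hτ : 0 < τ.im) (z : ℂ) {c d : ℤ} (h : IsCoprime c d) :
    EisJSummand 4 m (-1 / τ) (z / τ) c d
      = τ ^ 4 * e2 (m * (z ^ 2 / τ)) * EisJSummand 4 m τ z d (-c) := by
  obtain ⟨a, b, h⟩ := exists_of_isCoprime h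
  have h' : b * -c - -a * d = 1 := by linarith
  rw [EisJSummand_eq_eisTerm m (im_inv_pos hτ) _ h, EisJSummand_eq_eisTerm m hτ z h']
  have h0 := ne_zero_of_im_pos hτ
  have h1 := denom_ne_zero hτ (isCoprime_of_det h')
  have h2 : (c : ℂ) * (-1 / τ) + d = (d * τ + (-c : ℤ)) / τ := by
    push_cast
    field_simp
    ring
  rw [eisTerm, eisTerm, h2]
  have e1 : e2 (-(m * (c * (z / τ) ^ 2 / ((d * τ + (-c : ℤ)) / τ))))
      = e2 (m * (z ^ 2 / τ)) * e2 (-(m * (d * z ^ 2 / (d * τ + (-c : ℤ))))) := by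
    rw [← e2_add]
    congr 1
    have hw : (d : ℂ) * τ + (-c : ℤ) = d * τ - c := by push_cast; ring
    generalize (d : ℂ) * τ + (-c : ℤ) = w at *
    field_simp
    linear_combination (-(m : ℂ) * z ^ 2) * hw
  have e3 : 2 * m * (z / τ) / ((d * τ + (-c : ℤ)) / τ) = 2 * m * z / (d * τ + (-c : ℤ)) := by
    field_simp
  have e4 : (a * (-1 / τ) + b) / ((d * τ + (-c : ℤ)) / τ)
      = (b * τ + (-a : ℤ)) / (d * τ + (-c : ℤ)) := by
    push_cast
    field_simp
    ring
  rw [e1, e3, e4, div_zpow]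
  have e5 : τ ^ (-4 : ℤ) = (τ ^ 4)⁻¹ := by rw [zpow_neg]; norm_cast
  rw [e5]
  field_simp

/-- Primitive integer vectors. -/
abbrev CoprimePair : Type := {p : ℤ × ℤ // IsCoprime p.1 p.2}

/-- The shear `(c, d) ↦ (c, c + d)` on primitive vectors. -/
def shearEquiv : CoprimePair ≃ CoprimePair where
  toFun p := ⟨(p.1.1, p.1.1 + p.1.2), by
    have := p.2; simpa [add_comm] using this.add_mul_left_right 1⟩
  invFun p := ⟨(p.1.1, p.1.2 - p.1.1), by
    have := p.2; simpa [sub_eq_add_neg] using this.add_mul_left_right (-1)⟩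
  left_inv p := by ext <;> simp
  right_inv p := by ext <;> simp

/-- The rotation `(c, d) ↦ (d, -c)` on primitive vectors. -/
def rotateEquiv : CoprimePair ≃ CoprimePair where
  toFun p := ⟨(p.1.2, -p.1.1), p.2.symm.neg_right⟩
  invFun p := ⟨(-p.1.2, p.1.1), p.2.symm.neg_left⟩
  left_inv p := by ext <;> simp
  right_inv p := by ext <;> simp

lemma EisJ_T (m : ℕ) {τ : ℂ} (hτ : 0 < τ.im) (z : ℂ) : EisJ 4 m (τ + 1) z = EisJ 4 m τ z := by
  rw [EisJ, EisJ, ← shearEquiv.tsum_eq fun p => EisJSummand 4 m τ z p.1.1 p.1.2]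
  congr 1
  exact tsum_congr fun p => EisJSummand_T m hτ z p.2

lemma EisJ_S (m : ℕ) {τ : ℂ} (hτ : 0 < τ.im) (z : ℂ) :
    EisJ 4 m (-1 / τ) (z / τ) = τ ^ 4 * e2 (m * (z ^ 2 / τ)) * EisJ 4 m τ z := by
  have h : ∑' p : CoprimePair, EisJSummand 4 m (-1 / τ) (z / τ) p.1.1 p.1.2
      = τ ^ 4 * e2 (m * (z ^ 2 / τ)) * ∑' p : CoprimePair, EisJSummand 4 m τ z p.1.1 p.1.2 := by
    rw [← rotateEquiv.tsum_eq fun p => EisJSummand 4 m τ z p.1.1 p.1.2, ← tsum_mul_left]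
    exact tsum_congr fun p => EisJSummand_S m hτ z p.2
  rw [EisJ, EisJ, h]
  ring

/-- A family of function spaces compatible with the modular generators which contains the
seed of the Jacobi-Eisenstein series contains all of its summands. -/
lemma EisJSummand_mem (m : ℕ) (P : ℂ → (ℂ → ℂ) → Prop)
    (hT : ∀ τ : ℂ, 0 < τ.im → ∀ φ, P (τ + 1) φ ↔ P τ φ)
    (hS : ∀ τ : ℂ, 0 < τ.im → ∀ φ, P (-1 / τ) φ →
      P τ fun z => (τ ^ 4)⁻¹ * e2 (-(m * (z ^ 2 / τ))) * φ (z / τ))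
    (h0 : ∀ τ : ℂ, 0 < τ.im → P τ fun z => jacobiTheta₂ (2 * m * z) (2 * m * τ))
    {c d : ℤ} (hcd : IsCoprime c d) {τ : ℂ} (hτ : 0 < τ.im) :
    P τ fun z => EisJSummand 4 m τ z c d := by
  have hTn : ∀ (n : ℕ) (τ : ℂ), 0 < τ.im → ∀ φ, P (τ + n) φ ↔ P τ φ := by
    intro n
    induction n with
    | zero => simp
    | succ n ih =>
      intro τ hτ φ
      rw [← ih τ hτ, ← hT (τ + n) (by simpa using hτ)]
      push_cast
      rw [add_assoc]
  have hTz : ∀ (n : ℤ) (τ : ℂ), 0 < τ.im → ∀ φ, P (τ + n) φ → P τ φ := by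
    intro n τ hτ φ h
    obtain ⟨k, rfl | rfl⟩ := n.eq_nat_or_neg
    · exact (hTn k τ hτ φ).1 (by simpa using h)
    · have := (hTn k (τ + ((-k : ℤ) : ℂ)) (by simpa using hτ) φ).2 h
      simpa using this
  have hsT : ∀ (n : ℕ) (τ : ℂ), 0 < τ.im → ∀ (z : ℂ) (c d : ℤ), IsCoprime c d →
      EisJSummand 4 m (τ + n) z c d = EisJSummand 4 m τ z c (n * c + d) := by
    intro n
    induction n with
    | zero => simp
    | succ n ih =>
      intro τ hτ z c d h
      have := EisJSummand_T m (τ := τ + n) (by simpa using hτ) z h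
      push_cast
      rw [← add_assoc, this, ih τ hτ z c (c + d) (by
        simpa [add_comm] using h.add_mul_left_right 1)]
      ring_nf
  have hsTz : ∀ (n : ℤ) (τ : ℂ), 0 < τ.im → ∀ (z : ℂ) (c d : ℤ), IsCoprime c d →
      EisJSummand 4 m (τ + n) z c d = EisJSummand 4 m τ z c (n * c + d) := by
    intro n τ hτ z c d h
    obtain ⟨k, rfl | rfl⟩ := n.eq_nat_or_neg
    · simpa using hsT k τ hτ z c d h
    · have := hsT k (τ + ((-k : ℤ) : ℂ)) (by simpa using hτ) z c (-k * c + d) (by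
        have := h.add_mul_right_right (-k : ℤ)
        rwa [add_comm] at this)
      rw [show (k : ℤ) * c + (-k * c + d) = d by ring] at this
      rw [← this]
      simp
  have key : ∀ (n : ℕ) (c d : ℤ), c.natAbs = n → IsCoprime c d → ∀ τ : ℂ, 0 < τ.im →
      P τ fun z => EisJSummand 4 m τ z c d := by
    intro n
    induction n using Nat.strong_induction_on with
    | _ n ih =>
      intro c d hn hcd τ hτ
      by_cases hc : c = 0
      · subst hc
        have hd : d = 1 ∨ d = -1 := by
          have : IsUnit d := isCoprime_zero_left.1 hcd
          exact Int.isUnit_iff.1 this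
        convert h0 τ hτ using 2 with z
        rcases hd with rfl | rfl
        · rw [EisJSummand_eq_eisTerm m hτ z (show (1 : ℤ) * 1 - 0 * 0 = 1 by norm_num)]
          simp [eisTerm, e2_zero]
        · rw [EisJSummand_eq_eisTerm m hτ z (show (-1 : ℤ) * -1 - 0 * 0 = 1 by norm_num)]
          simp [eisTerm, e2_zero, div_neg, jacobiTheta₂_neg_left]
          norm_num
      · have hr : IsCoprime c (d % c) := by
          have := hcd.add_mul_left_right (-(d / c))
          rwa [mul_neg, ← sub_eq_add_neg, ← Int.emod_def] at this
        have hlt : (-(d % c)).natAbs < n := by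
          have := Int.emod_nonneg d hc
          have := Int.emod_lt_abs d hc
          rw [Int.abs_eq_natAbs] at this
          omega
        refine hTz (d / c) τ hτ _ ?_
        have hτ' : 0 < (τ + (d / c : ℤ)).im := by simpa using hτ
        have hmain := hS _ hτ' _ (ih _ hlt (-(d % c)) c rfl hr.symm.neg_left _ (im_inv_pos hτ'))
        convert hmain using 2 with z
        rw [EisJSummand_S m hτ' z hr.symm.neg_left, neg_neg, hsTz _ τ hτ z c _ hr,
          Int.ediv_mul_add_emod d c]
        have h4 : (τ + (d / c : ℤ)) ^ 4 ≠ 0 := pow_ne_zero 4 (ne_zero_of_im_pos hτ')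
        have he : e2 (-(m * (z ^ 2 / (τ + (d / c : ℤ)))))
            * e2 (m * (z ^ 2 / (τ + (d / c : ℤ)))) = 1 := by
          rw [← e2_add, neg_add_cancel, e2_zero]
        rw [← mul_assoc, mul_mul_mul_comm, he, inv_mul_cancel₀ h4, one_mul, one_mul]
  exact key _ c d rfl hcd τ hτ

lemma exp_neg_le_rpow {u : ℝ} (hu : 0 < u) : Real.exp (-u) ≤ u ^ (-(3 / 4) : ℝ) := by
  rw [Real.exp_neg, Real.rpow_neg hu.le]
  refine inv_anti₀ (by positivity) ?_
  have h1 : u ^ (3 / 4 : ℝ) ≤ u + 1 := by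
    rcases le_total u 1 with h | h
    · have := Real.rpow_le_one hu.le h (by norm_num : (0 : ℝ) ≤ 3 / 4)
      linarith
    · have := Real.rpow_le_rpow_of_exponent_le h (by norm_num : (3 / 4 : ℝ) ≤ 1)
      rw [Real.rpow_one] at this
      linarith
  exact h1.trans (Real.add_one_le_exp u)

lemma exp_sq_le {Y μ : ℝ} (hY : 0 < Y) (hμ : |μ| ≤ 1 / 2) (l : ℤ) :
    Real.exp (-(4 * Y * (l + μ) ^ 2))
      ≤ (if l = 0 then 1 else 0) + Y ^ (-(3 / 4) : ℝ) * |(l : ℝ)| ^ (-(3 / 2) : ℝ) := by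
  split_ifs with h
  · subst h
    have : Real.exp (-(4 * Y * (((0 : ℤ) : ℝ) + μ) ^ 2)) ≤ 1 :=
      Real.exp_le_one_iff.2 (by nlinarith [mul_nonneg hY.le (sq_nonneg (((0 : ℤ) : ℝ) + μ))])
    have h2 : 0 ≤ Y ^ (-(3 / 4) : ℝ) * |((0 : ℤ) : ℝ)| ^ (-(3 / 2) : ℝ) := by positivity
    exact le_add_of_le_of_nonneg this h2
  · have hl : 1 ≤ |(l : ℝ)| := by exact_mod_cast Int.one_le_abs h
    have hl0 : (0 : ℝ) < |(l : ℝ)| := by linarith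
    have h1 : |(l : ℝ)| / 2 ≤ |l + μ| := by
      have : |(l : ℝ)| ≤ |l + μ| + |μ| := by
        simpa using abs_sub (l + μ) μ
      linarith
    have h2 : |(l : ℝ)| ^ 2 ≤ 4 * (l + μ) ^ 2 := by
      rw [← sq_abs ((l : ℝ) + μ)]
      nlinarith
    have hpos : 0 < Y * |(l : ℝ)| ^ 2 := by positivity
    calc Real.exp (-(4 * Y * (l + μ) ^ 2)) ≤ Real.exp (-(Y * |(l : ℝ)| ^ 2)) :=
          Real.exp_le_exp.2 (by nlinarith)
      _ ≤ (Y * |(l : ℝ)| ^ 2) ^ (-(3 / 4) : ℝ) := exp_neg_le_rpow hpos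
      _ = Y ^ (-(3 / 4) : ℝ) * |(l : ℝ)| ^ (-(3 / 2) : ℝ) := by
          rw [Real.mul_rpow hY.le (by positivity), ← Real.rpow_natCast, ← Real.rpow_mul (abs_nonneg _)]
          norm_num
      _ ≤ _ := by rw [zero_add]

/-- The constant `Σ_{l ≠ 0} |l|^{-3/2}`. -/
def latticeConst : ℝ := ∑' l : ℤ, |(l : ℝ)| ^ (-(3 / 2) : ℝ)

lemma latticeConst_nonneg : 0 ≤ latticeConst := tsum_nonneg fun _ => by positivity

lemma summable_exp_sq_and_tsum_le {Y : ℝ} (hY : 0 < Y) (x : ℝ) :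
    Summable (fun l : ℤ => Real.exp (-(4 * Y * (l + x) ^ 2))) ∧
      ∑' l : ℤ, Real.exp (-(4 * Y * (l + x) ^ 2)) ≤ 1 + Y ^ (-(3 / 4) : ℝ) * latticeConst := by
  have hμ : |x - round x| ≤ 1 / 2 := abs_sub_round x
  have hs1 : Summable fun l : ℤ => (if l = 0 then 1 else 0 : ℝ) :=
    (hasSum_ite_eq (0 : ℤ) (1 : ℝ)).summable
  have hs2 : Summable fun l : ℤ => Y ^ (-(3 / 4) : ℝ) * |(l : ℝ)| ^ (-(3 / 2) : ℝ) :=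
    (Real.summable_abs_int_rpow (by norm_num)).mul_left _
  have hs : Summable fun l : ℤ => Real.exp (-(4 * Y * (l + (x - round x)) ^ 2)) :=
    Summable.of_nonneg_of_le (fun _ => (Real.exp_pos _).le) (exp_sq_le hY hμ) (hs1.add hs2)
  have heq : (fun l : ℤ => Real.exp (-(4 * Y * (l + x) ^ 2)))
      = (fun l : ℤ => Real.exp (-(4 * Y * (l + (x - round x)) ^ 2)))
        ∘ (Equiv.addRight (round x)) := by
    funext l
    simp only [Function.comp, Equiv.coe_addRight]
    push_cast
    ring_nf
  constructor
  · rw [heq]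
    exact (Equiv.summable_iff _).2 hs
  · rw [heq]
    calc _ = ∑' l : ℤ, Real.exp (-(4 * Y * (l + (x - round x)) ^ 2)) :=
          (Equiv.addRight (round x)).tsum_eq
            fun l : ℤ => Real.exp (-(4 * Y * (l + (x - round x)) ^ 2))
      _ ≤ ∑' l : ℤ, ((if l = 0 then 1 else 0)
            + Y ^ (-(3 / 4) : ℝ) * |(l : ℝ)| ^ (-(3 / 2) : ℝ)) :=
          hs.tsum_le_tsum (exp_sq_le hY hμ) (hs1.add hs2)
      _ = _ := by rw [hs1.tsum_add hs2, tsum_ite_eq, tsum_mul_left, latticeConst]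

lemma im_mobius {a b c d : ℤ} (h : a * d - b * c = 1) (τ : ℂ) :
    ((a * τ + b) / (c * τ + d)).im = τ.im / ‖c * τ + d‖ ^ 2 := by
  have hdet : (a : ℝ) * d - b * c = 1 := by exact_mod_cast h
  rw [div_im, ← normSq_eq_norm_sq]
  simp only [add_im, mul_im, intCast_re, intCast_im, zero_mul, add_zero, add_re, mul_re, sub_zero]
  rw [← sub_div]
  congr 1
  linear_combination τ.im * hdet

/-- Summands of the Jacobi-Eisenstein series at a torsion point, normalized to be
modular in `τ`. -/
lemma norm_e2_mul_eisTerm_le {m : ℕ} (hm : 1 ≤ m) (x y : ℝ) {τ : ℂ} (hτ : 0 < τ.im)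
    {a b c d : ℤ} (h : a * d - b * c = 1) :
    ‖e2 (m * x ^ 2 * τ) * eisTerm m τ (x * τ + y) a b c d‖ ≤ ‖(c : ℂ) * τ + d‖ ^ (-4 : ℝ) +
      latticeConst * (τ.im ^ (-(3 / 4) : ℝ) * ‖(c : ℂ) * τ + d‖ ^ (-(5 / 2) : ℝ)) := by
  have hw := denom_ne_zero hτ (isCoprime_of_det h)
  have him := im_mobius h τ
  set w : ℂ := c * τ + d with hwdef
  have hwn : 0 < ‖w‖ := norm_pos_iff.2 hw
  have hY : 0 < τ.im / ‖w‖ ^ 2 := by positivity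
  have hC : (a : ℂ) * d - b * c = 1 := by exact_mod_cast h
  set x' : ℝ := x * d - y * c with hx'
  set y' : ℝ := -(x * b) + y * a with hy'
  have hterm : ∀ l : ℤ, ‖e2 (m * x ^ 2 * τ) * (e2 (-(m * (c * (x * τ + y) ^ 2 / w))) *
      jacobiTheta₂_term l (2 * m * (x * τ + y) / w) (2 * m * ((a * τ + b) / w)))‖
      ≤ Real.exp (-(4 * (τ.im / ‖w‖ ^ 2) * (l + x') ^ 2)) := by
    intro l
    rw [jacobiTheta₂_term_eq_e2, ← e2_add, ← e2_add]
    have harg : (m : ℂ) * x ^ 2 * τ + (-(m * (c * (x * τ + y) ^ 2 / w)) +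
        (l ^ 2 / 2 * (2 * m * ((a * τ + b) / w)) + l * (2 * m * (x * τ + y) / w)))
        = ((m * (l + x') ^ 2 : ℝ) : ℂ) * ((a * τ + b) / w)
          + ((m * (2 * l * y' + x' * y' - x * y) : ℝ) : ℂ) := by
      rw [hx', hy']
      push_cast
      have e1 : (x * τ + y) / w = (x * d - y * c) * ((a * τ + b) / w) + (-(x * b) + y * a) := by
        field_simp
        rw [hwdef]
        linear_combination (-(x * τ + y : ℂ)) * hC
      have e2' : c * (x * τ + y) ^ 2 / w
          = x * (x * τ + y) - (x * d - y * c) * ((x * τ + y) / w) := by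
        field_simp
        rw [hwdef]
        ring
      have e3 : 2 * m * (x * τ + y) / w = 2 * m * ((x * τ + y) / w) := by ring
      rw [e2', e3, e1]
      ring
    rw [harg, norm_e2]
    apply Real.exp_le_exp.2
    rw [add_im, ofReal_im, add_zero, im_ofReal_mul, him]
    have h1 : 0 ≤ (τ.im / ‖w‖ ^ 2) * (l + x') ^ 2 := by positivity
    have hm' : (1 : ℝ) ≤ m := by exact_mod_cast hm
    have h2 : 4 ≤ 2 * Real.pi * m := by nlinarith [Real.pi_gt_three]
    nlinarith [mul_le_mul_of_nonneg_right h2 h1]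
  obtain ⟨hs, hle⟩ := summable_exp_sq_and_tsum_le hY x'
  have hbound : ‖e2 (m * x ^ 2 * τ) * (e2 (-(m * (c * (x * τ + y) ^ 2 / w))) *
      jacobiTheta₂ (2 * m * (x * τ + y) / w) (2 * m * ((a * τ + b) / w)))‖
      ≤ 1 + (τ.im / ‖w‖ ^ 2) ^ (-(3 / 4) : ℝ) * latticeConst := by
    rw [jacobiTheta₂, ← tsum_mul_left, ← tsum_mul_left]
    exact (tsum_of_norm_bounded hs.hasSum hterm).trans hle
  have hpow : ‖w ^ (-4 : ℤ)‖ = ‖w‖ ^ (-4 : ℝ) := by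
    rw [norm_zpow, ← Real.rpow_intCast]
    norm_num
  have hsplit : (τ.im / ‖w‖ ^ 2) ^ (-(3 / 4) : ℝ)
      = τ.im ^ (-(3 / 4) : ℝ) * ‖w‖ ^ (3 / 2 : ℝ) := by
    rw [Real.div_rpow hτ.le (by positivity), ← Real.rpow_natCast, ← Real.rpow_mul hwn.le,
      div_eq_mul_inv, ← Real.rpow_neg hwn.le]
    norm_num
  have hcomb : ‖w‖ ^ (-4 : ℝ) * ‖w‖ ^ (3 / 2 : ℝ) = ‖w‖ ^ (-(5 / 2) : ℝ) := by
    rw [← Real.rpow_add hwn]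
    norm_num
  rw [eisTerm, ← hwdef, mul_left_comm, norm_mul, hpow]
  calc _ ≤ ‖w‖ ^ (-4 : ℝ) * (1 + (τ.im / ‖w‖ ^ 2) ^ (-(3 / 4) : ℝ) * latticeConst) := by gcongr
    _ = _ := by rw [hsplit, ← hcomb]; ring

lemma norm_e2_mul_EisJSummand_le {m : ℕ} (hm : 1 ≤ m) (x y : ℝ) {τ : ℂ} (hτ : 0 < τ.im)
    {c d : ℤ} (h : IsCoprime c d) :
    ‖e2 (m * x ^ 2 * τ) * EisJSummand 4 m τ (x * τ + y) c d‖ ≤ ‖(c : ℂ) * τ + d‖ ^ (-4 : ℝ) +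
      latticeConst * (τ.im ^ (-(3 / 4) : ℝ) * ‖(c : ℂ) * τ + d‖ ^ (-(5 / 2) : ℝ)) := by
  obtain ⟨a, b, h⟩ := exists_of_isCoprime h
  rw [EisJSummand_eq_eisTerm m hτ _ h]
  exact norm_e2_mul_eisTerm_le hm x y hτ h

lemma exists_summable_bound {m : ℕ} (hm : 1 ≤ m) (x y A : ℝ) {B : ℝ} (hB : 0 < B) :
    ∃ u : CoprimePair → ℝ, Summable u ∧ ∀ τ : ℂ, |τ.re| ≤ A → B ≤ τ.im → ∀ p : CoprimePair,
      ‖e2 (m * x ^ 2 * τ) * EisJSummand 4 m τ (x * τ + y) p.1.1 p.1.2‖ ≤ u p := by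
  set r := EisensteinSeries.r ⟨⟨A, B⟩, hB⟩ with hr
  have hr0 : 0 < r := EisensteinSeries.r_pos _
  refine ⟨fun p => (r ^ (-4 : ℝ) + latticeConst * (B ^ (-(3 / 4) : ℝ) * r ^ (-(5 / 2) : ℝ)))
    * ‖![p.1.1, p.1.2]‖ ^ (-(5 / 2) : ℝ), ?_, ?_⟩
  · refine Summable.mul_left _ ?_
    have h := EisensteinSeries.summable_one_div_norm_rpow (k := 5 / 2) (by norm_num)
    refine h.comp_injective (i := fun p : CoprimePair => ![p.1.1, p.1.2]) ?_
    rintro ⟨⟨a, b⟩, _⟩ ⟨⟨c, d⟩, _⟩ hpq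
    have h0 := congrFun hpq 0
    have h1 := congrFun hpq 1
    simp only [Matrix.cons_val_zero, Matrix.cons_val_one] at h0 h1
    simp [h0, h1]
  · intro τ hA hB' p
    have hτ : 0 < τ.im := hB.trans_le hB'
    have hN : 1 ≤ ‖![p.1.1, p.1.2]‖ := by
      rw [EisensteinSeries.norm_eq_max_natAbs]
      have : p.1.1 ≠ 0 ∨ p.1.2 ≠ 0 := by
        by_contra! hc
        have := p.2
        rw [hc.1, hc.2] at this
        exact not_isCoprime_zero_zero this
      simp only [Matrix.cons_val_zero, Matrix.cons_val_one]
      have : 1 ≤ max p.1.1.natAbs p.1.2.natAbs := by omega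
      exact_mod_cast this
    have hstrip : (⟨τ, hτ⟩ : UpperHalfPlane) ∈ UpperHalfPlane.verticalStrip A B := ⟨hA, hB'⟩
    have b1 := EisensteinSeries.summand_bound_of_mem_verticalStrip (k := 4) (by norm_num)
      ![p.1.1, p.1.2] hB hstrip
    have b2 := EisensteinSeries.summand_bound_of_mem_verticalStrip (k := 5 / 2) (by norm_num)
      ![p.1.1, p.1.2] hB hstrip
    simp only [Matrix.cons_val_zero, Matrix.cons_val_one, ← hr] at b1 b2
    have b3 : ‖![p.1.1, p.1.2]‖ ^ (-4 : ℝ) ≤ ‖![p.1.1, p.1.2]‖ ^ (-(5 / 2) : ℝ) :=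
      Real.rpow_le_rpow_of_exponent_le hN (by norm_num)
    have b4 : τ.im ^ (-(3 / 4) : ℝ) ≤ B ^ (-(3 / 4) : ℝ) :=
      Real.rpow_le_rpow_of_nonpos hB hB' (by norm_num)
    have hL := latticeConst_nonneg
    refine (norm_e2_mul_EisJSummand_le hm x y hτ p.2).trans ?_
    calc _ ≤ r ^ (-4 : ℝ) * ‖![p.1.1, p.1.2]‖ ^ (-(5 / 2) : ℝ) + latticeConst *
          (B ^ (-(3 / 4) : ℝ) * (r ^ (-(5 / 2) : ℝ) * ‖![p.1.1, p.1.2]‖ ^ (-(5 / 2) : ℝ))) := by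
          gcongr
          exact b1.trans (by gcongr)
      _ = _ := by ring

section CuspLimits

open Filter Topology

/-- The neighbourhood filter of the cusp `i∞` within a vertical strip. -/
def cuspFilter : Filter ℂ := comap Complex.im atTop ⊓ 𝓟 {τ | |τ.re| ≤ 1}

lemma tendsto_im_cuspFilter : Tendsto Complex.im cuspFilter atTop :=
  tendsto_comap.mono_left inf_le_left

lemma eventually_im_cuspFilter (B : ℝ) : ∀ᶠ τ in cuspFilter, B ≤ τ.im :=
  tendsto_im_cuspFilter.eventually_ge_atTop B

lemma eventually_re_cuspFilter : ∀ᶠ τ : ℂ in cuspFilter, |τ.re| ≤ 1 :=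
  mem_inf_of_right (mem_principal_self _)

/-- The Jacobi-Eisenstein series of weight four restricted to a torsion section. -/
def eisTorsion (m : ℕ) (x y : ℝ) (τ : ℂ) : ℂ := e2 (m * x ^ 2 * τ) * EisJ 4 m τ (x * τ + y)

lemma summable_EisJSummand {m : ℕ} (hm : 1 ≤ m) {τ : ℂ} (hτ : 0 < τ.im) (z : ℂ) :
    Summable fun p : CoprimePair => EisJSummand 4 m τ z p.1.1 p.1.2 := by
  have hz : z = ((z.im / τ.im : ℝ) : ℂ) * τ + ((z.re - z.im / τ.im * τ.re : ℝ) : ℂ) := by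
    apply Complex.ext
    · simp
    · simp
      field_simp
  obtain ⟨u, hu, hle⟩ := exists_summable_bound hm (z.im / τ.im) (z.re - z.im / τ.im * τ.re)
    |τ.re| hτ
  rw [hz]
  have h := Summable.of_norm_bounded hu (hle τ le_rfl le_rfl)
  exact (summable_mul_left_iff (e2_ne_zero _)).1 h

lemma two_mul_mobius_im_pos {m : ℕ} (hm : 1 ≤ m) {τ : ℂ} (hτ : 0 < τ.im) {a b c d : ℤ}
    (h : a * d - b * c = 1) : 0 < (2 * m * ((a * τ + b) / (c * τ + d))).im := by
  have hw := norm_pos_iff.2 (denom_ne_zero hτ (isCoprime_of_det h))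
  have hm' : (0 : ℝ) < m := by exact_mod_cast hm
  rw [show (2 * m : ℂ) = ((2 * m : ℝ) : ℂ) by push_cast; rfl, im_ofReal_mul, im_mobius h]
  positivity

lemma differentiableAt_e2_mul_EisJSummand {m : ℕ} (hm : 1 ≤ m) (x y : ℝ) {τ : ℂ} (hτ : 0 < τ.im)
    {c d : ℤ} (hcd : IsCoprime c d) :
    DifferentiableAt ℂ (fun τ => e2 (m * x ^ 2 * τ) * EisJSummand 4 m τ (x * τ + y) c d) τ := by
  obtain ⟨a, b, h⟩ := exists_of_isCoprime hcd
  have heq : (fun τ => e2 (m * x ^ 2 * τ) * EisJSummand 4 m τ (x * τ + y) c d) =ᶠ[𝓝 τ]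
      fun τ => e2 (m * x ^ 2 * τ) * eisTerm m τ (x * τ + y) a b c d := by
    filter_upwards [(isOpen_lt continuous_const Complex.continuous_im).mem_nhds hτ] with t ht
    rw [EisJSummand_eq_eisTerm m ht _ h]
  refine DifferentiableAt.congr_of_eventuallyEq ?_ heq
  have hw := denom_ne_zero hτ hcd
  have he := differentiable_e2
  have hθ : DifferentiableAt ℂ (fun t : ℂ => jacobiTheta₂ (2 * m * (x * t + y) / (c * t + d))
      (2 * m * ((a * t + b) / (c * t + d)))) τ := by
    refine DifferentiableAt.comp (g := fun p : ℂ × ℂ => jacobiTheta₂ p.1 p.2)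
      (f := fun t : ℂ => (2 * m * (x * t + y) / (c * t + d),
        2 * m * ((a * t + b) / (c * t + d)))) τ
      (hasFDerivAt_jacobiTheta₂ _ (two_mul_mobius_im_pos hm hτ h)).differentiableAt ?_
    fun_prop (disch := assumption)
  unfold eisTerm
  have hz : DifferentiableAt ℂ (fun t : ℂ => ((c : ℂ) * t + d) ^ (-4 : ℤ)) τ :=
    DifferentiableAt.zpow (by fun_prop) (Or.inl hw)
  have h1 : DifferentiableAt ℂ (fun t : ℂ => e2 (m * x ^ 2 * t)) τ := by fun_prop
  have h2 : DifferentiableAt ℂ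
      (fun t : ℂ => e2 (-(m * (c * (x * t + y) ^ 2 / (c * t + d))))) τ :=
    he.differentiableAt.comp τ (by fun_prop (disch := assumption))
  exact h1.mul (hz.mul (h2.mul hθ))

lemma eisTorsion_eq (m : ℕ) (x y : ℝ) (τ : ℂ) : eisTorsion m x y τ = (1 / 2) *
    ∑' p : CoprimePair, e2 (m * x ^ 2 * τ) * EisJSummand 4 m τ (x * τ + y) p.1.1 p.1.2 := by
  rw [eisTorsion, EisJ, tsum_mul_left]
  ring

lemma differentiableAt_eisTorsion {m : ℕ} (hm : 1 ≤ m) (x y : ℝ) {τ : ℂ} (hτ : 0 < τ.im) :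
    DifferentiableAt ℂ (eisTorsion m x y) τ := by
  set U : Set ℂ := {t | |t.re| < |τ.re| + 1} ∩ {t | τ.im / 2 < t.im} with hU
  have hUo : IsOpen U := (isOpen_lt (by fun_prop) continuous_const).inter
    (isOpen_lt continuous_const Complex.continuous_im)
  have hτU : τ ∈ U := ⟨by simp, half_lt_self hτ⟩
  obtain ⟨u, hu, hle⟩ := exists_summable_bound hm x y (|τ.re| + 1) (half_pos hτ)
  have hd := Complex.differentiableOn_tsum_of_summable_norm (U := U) hu
    (F := fun (p : CoprimePair) τ =>
      e2 (m * x ^ 2 * τ) * EisJSummand 4 m τ (x * τ + y) p.1.1 p.1.2)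
    (fun p t ht => (differentiableAt_e2_mul_EisJSummand hm x y
      ((half_pos hτ).trans ht.2) p.2).differentiableWithinAt) hUo
    (fun p t ht => hle t ht.1.le ht.2.le p)
  have := (hd.differentiableAt (hUo.mem_nhds hτU)).const_mul (1 / 2)
  exact this.congr_of_eventuallyEq (Eventually.of_forall fun t => eisTorsion_eq m x y t)

lemma EisJSummand_zero (m : ℕ) {τ : ℂ} (hτ : 0 < τ.im) (z : ℂ) {d : ℤ} (h : IsCoprime 0 d) :
    EisJSummand 4 m τ z 0 d = jacobiTheta₂ (2 * m * z) (2 * m * τ) := by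
  rcases Int.isUnit_iff.1 (isCoprime_zero_left.1 h) with rfl | rfl
  · rw [EisJSummand_eq_eisTerm m hτ z (show (1 : ℤ) * 1 - 0 * 0 = 1 by norm_num)]
    simp [eisTerm, e2_zero]
  · rw [EisJSummand_eq_eisTerm m hτ z (show (-1 : ℤ) * -1 - 0 * 0 = 1 by norm_num)]
    simp [eisTerm, e2_zero, div_neg, jacobiTheta₂_neg_left]
    norm_num

lemma tendsto_e2_mul_EisJSummand_zero {m : ℕ} (hm : 1 ≤ m) (x y : ℝ) {c d : ℤ}
    (h : IsCoprime c d) (hc : c ≠ 0) :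
    Tendsto (fun τ => e2 (m * x ^ 2 * τ) * EisJSummand 4 m τ (x * τ + y) c d)
      cuspFilter (𝓝 0) := by
  have hlim : Tendsto (fun τ : ℂ => (1 + latticeConst) * (τ.im)⁻¹) cuspFilter (𝓝 0) := by
    simpa using (tendsto_inv_atTop_zero.comp tendsto_im_cuspFilter).const_mul (1 + latticeConst)
  refine squeeze_zero_norm' ?_ hlim
  filter_upwards [eventually_im_cuspFilter 1] with τ hτ
  have hτ0 : 0 < τ.im := by linarith
  refine (norm_e2_mul_EisJSummand_le hm x y hτ0 h).trans ?_
  have hw : τ.im ≤ ‖(c : ℂ) * τ + d‖ := by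
    have h1 : |((c : ℂ) * τ + d).im| ≤ ‖(c : ℂ) * τ + d‖ := Complex.abs_im_le_norm _
    have h2 : ((c : ℂ) * τ + d).im = c * τ.im := by simp
    have h3 : (1 : ℝ) ≤ |(c : ℝ)| := by exact_mod_cast Int.one_le_abs hc
    rw [h2, abs_mul, abs_of_pos hτ0] at h1
    nlinarith
  have hw1 : 1 ≤ ‖(c : ℂ) * τ + d‖ := hτ.trans hw
  have hi : ‖(c : ℂ) * τ + d‖ ^ (-1 : ℝ) ≤ (τ.im)⁻¹ := by
    rw [Real.rpow_neg_one]
    exact inv_anti₀ hτ0 hw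
  have b1 : ‖(c : ℂ) * τ + d‖ ^ (-4 : ℝ) ≤ (τ.im)⁻¹ :=
    (Real.rpow_le_rpow_of_exponent_le hw1 (by norm_num)).trans hi
  have b2 : ‖(c : ℂ) * τ + d‖ ^ (-(5 / 2) : ℝ) ≤ (τ.im)⁻¹ :=
    (Real.rpow_le_rpow_of_exponent_le hw1 (by norm_num)).trans hi
  have b3 : τ.im ^ (-(3 / 4) : ℝ) ≤ 1 := Real.rpow_le_one_of_one_le_of_nonpos hτ (by norm_num)
  have hL := latticeConst_nonneg
  calc _ ≤ (τ.im)⁻¹ + latticeConst * (1 * (τ.im)⁻¹) := by gcongr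
    _ = _ := by ring

lemma tendsto_eisTorsion {m : ℕ} (hm : 1 ≤ m) (x y : ℝ) {L : ℂ}
    (h : Tendsto (fun τ => e2 (m * x ^ 2 * τ) * jacobiTheta₂ (2 * m * (x * τ + y)) (2 * m * τ))
      cuspFilter (𝓝 L)) : Tendsto (eisTorsion m x y) cuspFilter (𝓝 L) := by
  obtain ⟨u, hu, hle⟩ := exists_summable_bound hm x y 1 one_pos
  have hmain := tendsto_tsum_of_dominated_convergence (𝓕 := cuspFilter) hu
    (f := fun τ (p : CoprimePair) =>
      e2 (m * x ^ 2 * τ) * EisJSummand 4 m τ (x * τ + y) p.1.1 p.1.2)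
    (g := fun p : CoprimePair => if p.1.1 = 0 then L else 0) ?_ ?_
  · have hsum : ∑' p : CoprimePair, (if p.1.1 = 0 then L else 0) = 2 * L := by
      rw [tsum_eq_sum (s := {⟨(0, 1), isCoprime_one_right⟩, ⟨(0, -1), isCoprime_one_right.neg_right⟩})]
      · rw [Finset.sum_pair (by simp [Subtype.ext_iff, Prod.ext_iff])]
        simp
        ring
      · rintro ⟨⟨c, d⟩, hcd⟩ hp
        rw [if_neg]
        intro (h0 : c = 0)
        subst h0
        rcases Int.isUnit_iff.1 (isCoprime_zero_left.1 hcd) with rfl | rfl <;> simp at hp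
    rw [hsum] at hmain
    have := hmain.const_mul (1 / 2)
    rw [← mul_assoc, show (1 / 2 : ℂ) * 2 = 1 by norm_num, one_mul] at this
    exact this.congr fun τ => (eisTorsion_eq m x y τ).symm
  · rintro ⟨⟨c, d⟩, hcd⟩
    by_cases hc : c = 0
    · subst hc
      rw [if_pos rfl]
      refine h.congr' ?_
      filter_upwards [eventually_im_cuspFilter 1] with τ hτ
      rw [EisJSummand_zero m (by linarith) _ hcd]
    · rw [if_neg hc]
      exact tendsto_e2_mul_EisJSummand_zero hm x y hcd hc
  · filter_upwards [eventually_im_cuspFilter 1, eventually_re_cuspFilter] with τ h1 h2 p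
    exact hle τ h2 h1 p

lemma tendsto_jacobiTheta_im : Tendsto jacobiTheta (comap Complex.im atTop) (𝓝 1) := by
  have h := isBigO_at_im_infty_jacobiTheta_sub_one
  have h0 : Tendsto (fun τ : ℂ => Real.exp (-Real.pi * τ.im)) (comap Complex.im atTop) (𝓝 0) := by
    refine Real.tendsto_exp_atBot.comp ?_
    exact tendsto_comap.const_mul_atTop_of_neg (by simpa using Real.pi_pos)
  simpa using (h.trans_tendsto h0).add_const 1

lemma tendsto_jacobiTheta_mul {r : ℝ} (hr : 0 < r) :
    Tendsto (fun τ : ℂ => jacobiTheta (r * τ)) cuspFilter (𝓝 1) := by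
  refine tendsto_jacobiTheta_im.comp (tendsto_comap_iff.2 ?_)
  simpa [Function.comp_def] using tendsto_im_cuspFilter.const_mul_atTop hr

lemma tendsto_thA : Tendsto thA cuspFilter (𝓝 1) := by
  refine (tendsto_jacobiTheta_mul two_pos).congr fun τ => ?_
  rw [thA_eq, ofReal_ofNat]

lemma tendsto_thB_mul {r : ℝ} (hr : 0 < r) :
    Tendsto (fun τ : ℂ => thB (r * τ)) cuspFilter (𝓝 0) := by
  have h1 := tendsto_jacobiTheta_mul (half_pos hr)
  have h2 := tendsto_jacobiTheta_mul (mul_pos two_pos hr)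
  have h := h1.sub h2
  rw [sub_self] at h
  refine h.congr fun τ => ?_
  have := thA_add_thB (r * τ)
  rw [thA_eq] at this
  push_cast
  rw [show (r : ℂ) / 2 * τ = r * τ / 2 by ring, ← this, show (2 : ℂ) * r * τ = 2 * (r * τ) by ring]
  ring

lemma tendsto_thB : Tendsto thB cuspFilter (𝓝 0) := by
  simpa using tendsto_thB_mul one_pos

lemma jacobiTheta₂_nat (n : ℕ) (τ : ℂ) : jacobiTheta₂ n τ = jacobiTheta τ := by
  induction n with
  | zero => rw [Nat.cast_zero, jacobiTheta_eq_jacobiTheta₂]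
  | succ n ih => rw [Nat.cast_succ, jacobiTheta₂_add_left, ih]

lemma tendsto_eisTorsion_zero_zero {m : ℕ} (hm : 1 ≤ m) :
    Tendsto (eisTorsion m 0 0) cuspFilter (𝓝 1) := by
  refine tendsto_eisTorsion hm 0 0 ?_
  refine (tendsto_jacobiTheta_mul (r := 2 * m) (by positivity)).congr fun τ => ?_
  simp [e2_zero, jacobiTheta_eq_jacobiTheta₂]

lemma tendsto_eisTorsion_zero_half {m : ℕ} (hm : 1 ≤ m) :
    Tendsto (eisTorsion m 0 (1 / 2)) cuspFilter (𝓝 1) := by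
  refine tendsto_eisTorsion hm 0 (1 / 2) ?_
  refine (tendsto_jacobiTheta_mul (r := 2 * m) (by positivity)).congr fun τ => ?_
  rw [← jacobiTheta₂_nat m]
  simp [e2_zero]
  ring_nf

lemma tendsto_eisTorsion_half_zero :
    Tendsto (eisTorsion 2 (1 / 2) 0) cuspFilter (𝓝 0) := by
  refine tendsto_eisTorsion one_le_two (1 / 2) 0 ?_
  refine (tendsto_thB_mul two_pos).congr' ?_
  filter_upwards [eventually_im_cuspFilter 1] with τ hτ
  have h := e2_mul_thU_tau (τ := 2 * τ) (two_im_pos (by linarith))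
  rw [thU] at h
  push_cast
  rw [← h]
  ring_nf

end CuspLimits

section CuspForms

open Filter Topology

/-- The restriction of a function on `ℂ` to the upper half-plane. -/
def toHalfPlane (g : ℂ → ℂ) (τ : UpperHalfPlane) : ℂ := g τ

open UpperHalfPlane hiding I
open MatrixGroups ModularForm SlashInvariantForm

lemma periodic_add_int {g : ℂ → ℂ} (hT : ∀ τ : ℂ, 0 < τ.im → g (τ + 1) = g τ) (n : ℤ)
    {τ : ℂ} (hτ : 0 < τ.im) : g (τ + n) = g τ := by
  induction n with
  | zero => simp
  | succ n ih =>
    push_cast at ih ⊢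
    rw [← add_assoc, hT _ (by simpa using hτ), ih]
  | pred n ih =>
    push_cast at ih ⊢
    rw [← ih, ← hT (τ + (-n - 1)) (by simpa using hτ)]
    ring_nf

lemma tendsto_toHalfPlane {g : ℂ → ℂ} (hT : ∀ τ : ℂ, 0 < τ.im → g (τ + 1) = g τ)
    {L : ℂ} (h : Tendsto g cuspFilter (𝓝 L)) : Tendsto (toHalfPlane g) atImInfty (𝓝 L) := by
  intro s hs
  have h1 := h hs
  rw [mem_map, cuspFilter, mem_inf_principal, mem_comap] at h1
  obtain ⟨t, ht, h2⟩ := h1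
  obtain ⟨B, hB⟩ := mem_atTop_sets.1 ht
  rw [mem_map, atImInfty_mem]
  refine ⟨B, fun τ hτ => ?_⟩
  have h3 := h2 (a := (τ : ℂ) + ((-⌊τ.re⌋ : ℤ) : ℂ)) (hB _ (by simpa using hτ)) (by
    have h4 := Int.floor_le τ.re
    have h5 := Int.lt_floor_add_one τ.re
    show |_| ≤ (1 : ℝ)
    rw [add_re, intCast_re, coe_re, Int.cast_neg]
    rw [abs_le]
    constructor <;> linarith)
  have h6 : g _ ∈ s := h3
  rwa [periodic_add_int hT _ τ.2] at h6

lemma toHalfPlane_slash_T {g : ℂ → ℂ} (hT : ∀ τ : ℂ, 0 < τ.im → g (τ + 1) = g τ) (k : ℤ) :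
    (toHalfPlane g) ∣[k] ModularGroup.T = toHalfPlane g := by
  ext z
  rw [SL_slash_apply, modular_T_smul, ModularGroup.denom_apply]
  simp [toHalfPlane, ModularGroup.T, add_comm (1 : ℂ), hT z z.2]

lemma toHalfPlane_slash_S {g : ℂ → ℂ} {k : ℕ}
    (hS : ∀ τ : ℂ, 0 < τ.im → g (-1 / τ) = τ ^ k * g τ) :
    (toHalfPlane g) ∣[(k : ℤ)] ModularGroup.S = toHalfPlane g := by
  ext z
  suffices g (-(↑z)⁻¹) * ((z : ℂ) ^ k)⁻¹ = g z by
    rw [SL_slash_apply, UpperHalfPlane.modular_S_smul, ModularGroup.denom_apply]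
    simpa [ModularGroup.S, toHalfPlane]
  have h := hS z z.2
  rw [neg_div, one_div] at h
  rw [h]
  have := pow_ne_zero k z.ne_zero
  field_simp

/-- A level one cusp form of weight less than twelve vanishes. -/
theorem eq_zero_of_cusp {g : ℂ → ℂ} {k : ℕ} (hk : k < 12)
    (hd : ∀ τ : ℂ, 0 < τ.im → DifferentiableAt ℂ g τ)
    (hT : ∀ τ : ℂ, 0 < τ.im → g (τ + 1) = g τ)
    (hS : ∀ τ : ℂ, 0 < τ.im → g (-1 / τ) = τ ^ k * g τ)
    (h0 : Tendsto g cuspFilter (𝓝 0)) {τ : ℂ} (hτ : 0 < τ.im) : g τ = 0 := by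
  have hS' := toHalfPlane_slash_S hS
  have hT' := toHalfPlane_slash_T hT k
  have hz : IsZeroAtImInfty (toHalfPlane g) := tendsto_toHalfPlane hT h0
  let f : CuspForm 𝒮ℒ k :=
    { toFun := toHalfPlane g
      slash_action_eq' := by
        rintro A ⟨A, rfl⟩
        exact slash_action_generators_SL2Z hS' hT' A
      holo' := by
        rw [UpperHalfPlane.mdifferentiable_iff]
        refine .congr (fun z hz => (hd z hz).differentiableWithinAt) fun z hz => ?_
        simp [toHalfPlane, ofComplex_apply_of_im_pos hz]
      zero_at_cusps' := by
        intro c hc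
        rw [Subgroup.IsArithmetic.isCusp_iff_isCusp_SL2Z] at hc
        rw [OnePoint.isZeroAt_iff_forall_SL2Z hc]
        intro γ _
        rw [slash_action_generators_SL2Z hS' hT']
        exact hz }
  have hf : f = 0 := rank_zero_iff_forall_zero.1
    (CuspForm.rank_eq_zero_of_weight_lt_twelve (by exact_mod_cast hk)) f
  have := congrArg (fun F : CuspForm 𝒮ℒ k => F ⟨τ, hτ⟩) hf
  exact this

end CuspForms

/-- `φ` is a linear combination of the two theta functions of index one. -/
def InThetaSpanOne (τ : ℂ) (φ : ℂ → ℂ) : Prop :=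
  ∃ p q : ℂ, ∀ z, φ z = p * thU τ z + q * thV τ z

/-- `φ` is a quadratic form in the two theta functions of index one. -/
def InThetaSpanTwo (τ : ℂ) (φ : ℂ → ℂ) : Prop :=
  ∃ p q r : ℂ, ∀ z, φ z = p * thU τ z ^ 2 + q * (thU τ z * thV τ z) + r * thV τ z ^ 2

lemma e2_neg_mul_e2 (w : ℂ) : e2 (-w) * e2 w = 1 := by
  rw [← e2_add, neg_add_cancel, e2_zero]

lemma EisJSummand_one_mem {c d : ℤ} (hcd : IsCoprime c d) {τ : ℂ} (hτ : 0 < τ.im) :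
    InThetaSpanOne τ fun z => EisJSummand 4 1 τ z c d := by
  refine EisJSummand_mem 1 InThetaSpanOne ?_ ?_ ?_ hcd hτ
  · intro τ hτ φ
    constructor
    · rintro ⟨p, q, h⟩
      refine ⟨p, q * I, fun z => ?_⟩
      rw [h, thU_T, thV_T hτ]
      ring
    · rintro ⟨p, q, h⟩
      refine ⟨p, -q * I, fun z => ?_⟩
      rw [h, thU_T, thV_T hτ]
      linear_combination (q * thV τ z) * I_sq
  · rintro τ hτ φ ⟨p, q, h⟩
    refine ⟨(τ ^ 4)⁻¹ * thS τ * (p + q), (τ ^ 4)⁻¹ * thS τ * (p - q), fun z => ?_⟩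
    have he := e2_neg_mul_e2 (z ^ 2 / τ)
    beta_reduce
    rw [h, thU_S hτ, thV_S hτ, Nat.cast_one, one_mul]
    linear_combination ((τ ^ 4)⁻¹ * thS τ * (p * (thU τ z + thV τ z) + q * (thU τ z - thV τ z))) * he
  · intro τ _
    exact ⟨1, 0, fun z => by simp [thU]⟩

lemma EisJSummand_two_mem {c d : ℤ} (hcd : IsCoprime c d) {τ : ℂ} (hτ : 0 < τ.im) :
    InThetaSpanTwo τ fun z => EisJSummand 4 2 τ z c d := by
  refine EisJSummand_mem 2 InThetaSpanTwo ?_ ?_ ?_ hcd hτ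
  · intro τ hτ φ
    constructor
    · rintro ⟨p, q, r, h⟩
      refine ⟨p, q * I, -r, fun z => ?_⟩
      rw [h, thU_T, thV_T hτ]
      linear_combination (r * thV τ z ^ 2) * I_sq
    · rintro ⟨p, q, r, h⟩
      refine ⟨p, -q * I, -r, fun z => ?_⟩
      rw [h, thU_T, thV_T hτ]
      linear_combination (q * (thU τ z * thV τ z) + r * thV τ z ^ 2) * I_sq
  · rintro τ hτ φ ⟨p, q, r, h⟩
    refine ⟨(τ ^ 4)⁻¹ * thS τ ^ 2 * (p + q + r), (τ ^ 4)⁻¹ * thS τ ^ 2 * (2 * p - 2 * r),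
      (τ ^ 4)⁻¹ * thS τ ^ 2 * (p - q + r), fun z => ?_⟩
    have he := e2_neg_mul_e2 (z ^ 2 / τ)
    beta_reduce
    rw [h, thU_S hτ, thV_S hτ, Nat.cast_ofNat,
      show -(2 * (z ^ 2 / τ)) = -(z ^ 2 / τ) + -(z ^ 2 / τ) by ring, e2_add]
    linear_combination ((τ ^ 4)⁻¹ * thS τ ^ 2 * (p * (thU τ z + thV τ z) ^ 2
      + q * ((thU τ z + thV τ z) * (thU τ z - thV τ z)) + r * (thU τ z - thV τ z) ^ 2)
      * (e2 (-(z ^ 2 / τ)) * e2 (z ^ 2 / τ) + 1)) * he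
  · intro τ hτ
    refine ⟨((jacobiTheta τ)⁻¹ + (jacobiTheta (τ + 1))⁻¹) / 2, 0,
      ((jacobiTheta τ)⁻¹ - (jacobiTheta (τ + 1))⁻¹) / 2, fun z => ?_⟩
    beta_reduce
    rw [Nat.cast_ofNat, show (2 : ℂ) * 2 = 4 by norm_num, jacobiTheta₂_four_mul hτ]
    ring

/-- A linear relation between values of the summands passes to the Jacobi-Eisenstein series. -/
lemma EisJ_linear {m : ℕ} (hm : 1 ≤ m) {τ : ℂ} (hτ : 0 < τ.im) (z z₀ z₁ z₂ c₀ c₁ c₂ : ℂ)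
    (h : ∀ c d : ℤ, IsCoprime c d → EisJSummand 4 m τ z c d
      = c₀ * EisJSummand 4 m τ z₀ c d + c₁ * EisJSummand 4 m τ z₁ c d
        + c₂ * EisJSummand 4 m τ z₂ c d) :
    EisJ 4 m τ z = c₀ * EisJ 4 m τ z₀ + c₁ * EisJ 4 m τ z₁ + c₂ * EisJ 4 m τ z₂ := by
  have hs (w : ℂ) := summable_EisJSummand hm hτ w
  have hsum : ∑' p : CoprimePair, EisJSummand 4 m τ z p.1.1 p.1.2
      = c₀ * ∑' p : CoprimePair, EisJSummand 4 m τ z₀ p.1.1 p.1.2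
        + c₁ * ∑' p : CoprimePair, EisJSummand 4 m τ z₁ p.1.1 p.1.2
        + c₂ * ∑' p : CoprimePair, EisJSummand 4 m τ z₂ p.1.1 p.1.2 := by
    rw [← tsum_mul_left, ← tsum_mul_left, ← tsum_mul_left,
      ← ((hs z₀).mul_left c₀).tsum_add ((hs z₁).mul_left c₁),
      ← (((hs z₀).mul_left c₀).add ((hs z₁).mul_left c₁)).tsum_add ((hs z₂).mul_left c₂)]
    exact tsum_congr fun p => h _ _ p.2
  simp only [EisJ]
  rw [hsum]
  ring

lemma InThetaSpanOne.eq {τ : ℂ} (hτ : 0 < τ.im) {φ : ℂ → ℂ} (h : InThetaSpanOne τ φ) (z : ℂ) :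
    φ z = (φ 0 + φ (1 / 2)) / (2 * thA τ) * thU τ z
      + (φ 0 - φ (1 / 2)) / (2 * thB τ) * thV τ z := by
  obtain ⟨p, q, h⟩ := h
  have hA := thA_ne_zero hτ
  have hB := thB_ne_zero hτ
  have h0 : φ 0 = p * thA τ + q * thB τ := h 0
  rw [h0, h, h, thU_half, thV_half hτ]
  field_simp
  ring

lemma InThetaSpanTwo.eq {τ : ℂ} (hτ : 0 < τ.im) {φ : ℂ → ℂ} (h : InThetaSpanTwo τ φ) (z : ℂ) :
    φ z = (φ (1 / 2) + e2 (τ / 2) * φ (τ / 2)) / 2 *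
          ((thU τ z ^ 2 + thV τ z ^ 2) / (thA τ ^ 2 + thB τ ^ 2))
      + (φ 0 - e2 (τ / 2) * φ (τ / 2)) / 2 *
          ((thU τ z ^ 2 - thV τ z ^ 2) / (thA τ ^ 2 - thB τ ^ 2))
      + (φ 0 - φ (1 / 2)) / 2 * (thU τ z * thV τ z / (thA τ * thB τ)) := by
  obtain ⟨p, q, r, h⟩ := h
  have hA := thA_ne_zero hτ
  have hB := thB_ne_zero hτ
  have h1 := thA_sq_add_thB_sq_ne_zero hτ
  have h2 := thA_sq_sub_thB_sq_ne_zero hτ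
  have h0 : φ 0 = p * thA τ ^ 2 + q * (thA τ * thB τ) + r * thB τ ^ 2 := h 0
  have h3 : e2 (τ / 2) * φ (τ / 2) = p * thB τ ^ 2 + q * (thB τ * thA τ) + r * thA τ ^ 2 := by
    rw [h, ← e2_mul_thU_tau hτ, ← e2_mul_thV_tau hτ, show τ / 2 = τ / 4 + τ / 4 by ring, e2_add]
    ring
  rw [h0, h3, h, h, thU_half, thV_half hτ]
  field_simp
  ring

lemma EisJ_one_eq {τ : ℂ} (hτ : 0 < τ.im) (z : ℂ) :
    EisJ 4 1 τ z = (EisJ 4 1 τ 0 + EisJ 4 1 τ (1 / 2)) / (2 * thA τ) * thU τ z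
      + (EisJ 4 1 τ 0 - EisJ 4 1 τ (1 / 2)) / (2 * thB τ) * thV τ z := by
  rw [EisJ_linear le_rfl hτ z 0 (1 / 2) 0 (thU τ z / (2 * thA τ) + thV τ z / (2 * thB τ))
    (thU τ z / (2 * thA τ) - thV τ z / (2 * thB τ)) 0]
  · ring
  · intro c d hcd
    rw [(EisJSummand_one_mem hcd hτ).eq hτ z]
    ring

lemma EisJ_two_eq {τ : ℂ} (hτ : 0 < τ.im) (z : ℂ) :
    EisJ 4 2 τ z = (EisJ 4 2 τ (1 / 2) + e2 (τ / 2) * EisJ 4 2 τ (τ / 2)) / 2 *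
          ((thU τ z ^ 2 + thV τ z ^ 2) / (thA τ ^ 2 + thB τ ^ 2))
      + (EisJ 4 2 τ 0 - e2 (τ / 2) * EisJ 4 2 τ (τ / 2)) / 2 *
          ((thU τ z ^ 2 - thV τ z ^ 2) / (thA τ ^ 2 - thB τ ^ 2))
      + (EisJ 4 2 τ 0 - EisJ 4 2 τ (1 / 2)) / 2 * (thU τ z * thV τ z / (thA τ * thB τ)) := by
  set α := (thU τ z ^ 2 + thV τ z ^ 2) / (thA τ ^ 2 + thB τ ^ 2)
  set β := (thU τ z ^ 2 - thV τ z ^ 2) / (thA τ ^ 2 - thB τ ^ 2)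
  set γ := thU τ z * thV τ z / (thA τ * thB τ)
  rw [EisJ_linear one_le_two hτ z 0 (1 / 2) (τ / 2) ((β + γ) / 2) ((α - γ) / 2)
    (e2 (τ / 2) * (α - β) / 2)]
  · ring
  · intro c d hcd
    rw [(EisJSummand_two_mem hcd hτ).eq hτ z]
    ring

section WeightFour

open Filter Topology

/-- The polynomial in the theta constants expressing the Eisenstein series of weight four. -/
def thE (τ : ℂ) : ℂ := thA τ ^ 8 + 14 * (thA τ ^ 4 * thB τ ^ 4) + thB τ ^ 8

lemma differentiableAt_thA {τ : ℂ} (hτ : 0 < τ.im) : DifferentiableAt ℂ thA τ := by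
  have h : thA = fun t => jacobiTheta (2 * t) := funext thA_eq
  rw [h]
  exact (differentiableAt_jacobiTheta (two_im_pos hτ)).comp τ (by fun_prop)

lemma differentiableAt_thB {τ : ℂ} (hτ : 0 < τ.im) : DifferentiableAt ℂ thB τ := by
  have h : thB = fun t => jacobiTheta (t / 2) - thA t :=
    funext fun t => by rw [← thA_add_thB]; ring
  rw [h]
  exact (DifferentiableAt.comp (g := jacobiTheta) (f := fun t : ℂ => t / 2) τ
    (differentiableAt_jacobiTheta (half_im_pos hτ)) (by fun_prop)).sub (differentiableAt_thA hτ)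

lemma I_pow_eight : I ^ 8 = 1 := by
  rw [show 8 = 4 * 2 from rfl, pow_mul, I_pow_four, one_pow]

lemma thS_pow_four (τ : ℂ) : thS τ ^ 4 = -(τ ^ 2 / 4) := by
  rw [show 4 = 2 * 2 from rfl, pow_mul, thS_sq]
  linear_combination (τ ^ 2 / 4) * I_sq

lemma thS_pow_eight (τ : ℂ) : thS τ ^ 8 = τ ^ 4 / 16 := by
  rw [show 8 = 4 * 2 from rfl, pow_mul, thS_pow_four]
  ring

lemma thE_T {τ : ℂ} (hτ : 0 < τ.im) : thE (τ + 1) = thE τ := by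
  rw [thE, thA_T, thB_T hτ, mul_pow, mul_pow, I_pow_four, I_pow_eight, thE]
  ring

lemma thE_S {τ : ℂ} (hτ : 0 < τ.im) : thE (-1 / τ) = τ ^ 4 * thE τ := by
  have h4 := thS_pow_eight τ
  rw [thE, thA_S hτ, thB_S hτ, thE]
  linear_combination (16 * (thA τ ^ 8 + 14 * (thA τ ^ 4 * thB τ ^ 4) + thB τ ^ 8)) * h4

lemma tendsto_thE : Tendsto thE cuspFilter (𝓝 1) := by
  have h : Tendsto thE cuspFilter (𝓝 _) := ((tendsto_thA.pow 8).add
    (((tendsto_thA.pow 4).mul (tendsto_thB.pow 4)).const_mul 14)).add (tendsto_thB.pow 8)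
  simpa using h

lemma differentiableAt_thE {τ : ℂ} (hτ : 0 < τ.im) : DifferentiableAt ℂ thE τ := by
  have h1 := differentiableAt_thA hτ
  have h2 := differentiableAt_thB hτ
  unfold thE
  fun_prop

lemma eisTorsion_zero_zero (m : ℕ) : eisTorsion m 0 0 = fun τ => EisJ 4 m τ 0 := by
  funext τ
  simp [eisTorsion, e2_zero]

lemma eisTorsion_zero_half (m : ℕ) : eisTorsion m 0 (1 / 2) = fun τ => EisJ 4 m τ (1 / 2) := by
  funext τ
  simp [eisTorsion, e2_zero]

lemma eisTorsion_half_zero :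
    eisTorsion 2 (1 / 2) 0 = fun τ => e2 (τ / 2) * EisJ 4 2 τ (τ / 2) := by
  funext τ
  simp only [eisTorsion]
  push_cast
  rw [show (2 : ℂ) * (1 / 2) ^ 2 * τ = τ / 2 by ring, show (1 / 2 : ℂ) * τ + 0 = τ / 2 by ring]

lemma EisJ_S_zero (m : ℕ) {τ : ℂ} (hτ : 0 < τ.im) :
    EisJ 4 m (-1 / τ) 0 = τ ^ 4 * EisJ 4 m τ 0 := by
  have h := EisJ_S m hτ 0
  simpa [e2_zero] using h

lemma EisJ_zero {m : ℕ} (hm : 1 ≤ m) {τ : ℂ} (hτ : 0 < τ.im) : EisJ 4 m τ 0 = thE τ := by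
  refine sub_eq_zero.1 (eq_zero_of_cusp (g := fun τ => EisJ 4 m τ 0 - thE τ) (k := 4)
    (by norm_num) ?_ ?_ ?_ ?_ hτ)
  · intro τ hτ
    have h := differentiableAt_eisTorsion hm 0 0 hτ
    rw [eisTorsion_zero_zero] at h
    exact h.sub (differentiableAt_thE hτ)
  · intro τ hτ
    simp only [EisJ_T m hτ, thE_T hτ]
  · intro τ hτ
    simp only [EisJ_S_zero m hτ, thE_S hτ]
    ring
  · have h := tendsto_eisTorsion_zero_zero hm
    rw [eisTorsion_zero_zero] at h
    simpa using h.sub tendsto_thE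

lemma EisJ_one_half {τ : ℂ} (hτ : 0 < τ.im) :
    EisJ 4 1 τ (1 / 2) = thA τ ^ 8 - thB τ ^ 8 := by
  have hS : ∀ τ : ℂ, 0 < τ.im → EisJ 4 1 (-1 / τ) (1 / 2)
      = τ ^ 4 * ((thE τ + EisJ 4 1 τ (1 / 2)) / (2 * thA τ) * thB τ
        + (thE τ - EisJ 4 1 τ (1 / 2)) / (2 * thB τ) * thA τ) := by
    intro τ hτ
    have h0 := ne_zero_of_im_pos hτ
    have h := EisJ_S 1 hτ (τ / 2)
    rw [show τ / 2 / τ = 1 / 2 by field_simp, EisJ_one_eq hτ, EisJ_zero le_rfl hτ, Nat.cast_one,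
      show 1 * ((τ / 2) ^ 2 / τ) = τ / 4 by field_simp; ring] at h
    rw [h, ← e2_mul_thU_tau hτ, ← e2_mul_thV_tau hτ]
    ring
  have key : (thA τ ^ 4 - thB τ ^ 4) * (EisJ 4 1 τ (1 / 2) - (thA τ ^ 8 - thB τ ^ 8)) = 0 := by
    refine eq_zero_of_cusp (k := 6)
      (g := fun τ => (thA τ ^ 4 - thB τ ^ 4) * (EisJ 4 1 τ (1 / 2) - (thA τ ^ 8 - thB τ ^ 8)))
      (by norm_num) ?_ ?_ ?_ ?_ hτ
    · intro τ hτ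
      have h := differentiableAt_eisTorsion le_rfl 0 (1 / 2) hτ (m := 1)
      rw [eisTorsion_zero_half] at h
      have h1 := differentiableAt_thA hτ
      have h2 := differentiableAt_thB hτ
      fun_prop
    · intro τ hτ
      simp only [EisJ_T 1 hτ, thA_T, thB_T hτ, mul_pow, I_pow_four, I_pow_eight, one_mul]
    · intro τ hτ
      have hA := thA_ne_zero hτ
      have hB := thB_ne_zero hτ
      have e1 : thA (-1 / τ) ^ 4 - thB (-1 / τ) ^ 4
          = -(2 * τ ^ 2 * (thA τ * thB τ * (thA τ ^ 2 + thB τ ^ 2))) := by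
        rw [thA_S hτ, thB_S hτ, mul_pow, mul_pow, thS_pow_four]
        ring
      have e2 : thA (-1 / τ) ^ 8 - thB (-1 / τ) ^ 8
          = τ ^ 4 * (thA τ * thB τ * (thA τ ^ 6 + 7 * thA τ ^ 4 * thB τ ^ 2
            + 7 * thA τ ^ 2 * thB τ ^ 4 + thB τ ^ 6)) := by
        rw [thA_S hτ, thB_S hτ, mul_pow, mul_pow, thS_pow_eight]
        ring
      simp only [e1, e2, hS τ hτ, thE]
      field_simp
      ring
    · have h := tendsto_eisTorsion_zero_half le_rfl (m := 1)
      rw [eisTorsion_zero_half] at h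
      have h2 := ((tendsto_thA.pow 4).sub (tendsto_thB.pow 4)).mul
        (h.sub ((tendsto_thA.pow 8).sub (tendsto_thB.pow 8)))
      simpa using h2
  refine sub_eq_zero.1 ((mul_eq_zero.1 key).resolve_left ?_)
  rw [show thA τ ^ 4 - thB τ ^ 4 = (thA τ ^ 2 + thB τ ^ 2) * (thA τ ^ 2 - thB τ ^ 2) by ring]
  exact mul_ne_zero (thA_sq_add_thB_sq_ne_zero hτ) (thA_sq_sub_thB_sq_ne_zero hτ)

theorem EisJ_one_formula {τ : ℂ} (hτ : 0 < τ.im) (z : ℂ) :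
    EisJ 4 1 τ z = (thA τ ^ 7 + 7 * thA τ ^ 3 * thB τ ^ 4) * thU τ z
      + (7 * thA τ ^ 4 * thB τ ^ 3 + thB τ ^ 7) * thV τ z := by
  have hA := thA_ne_zero hτ
  have hB := thB_ne_zero hτ
  rw [EisJ_one_eq hτ, EisJ_zero le_rfl hτ, EisJ_one_half hτ, thE]
  field_simp
  ring

end WeightFour

section IndexTwo

open Filter Topology

/-- The first of three conjugate modular forms of weight two. -/
def wtP (τ : ℂ) : ℂ := thA τ ^ 4 - 6 * (thA τ ^ 2 * thB τ ^ 2) + thB τ ^ 4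

/-- The second of three conjugate modular forms of weight two. -/
def wtQ (τ : ℂ) : ℂ := thA τ ^ 4 + 6 * (thA τ ^ 2 * thB τ ^ 2) + thB τ ^ 4

/-- The third of three conjugate modular forms of weight two. -/
def wtR (τ : ℂ) : ℂ := -(2 * (thA τ ^ 4 + thB τ ^ 4))

lemma wtP_T {τ : ℂ} (hτ : 0 < τ.im) : wtP (τ + 1) = wtQ τ := by
  rw [wtP, thA_T, thB_T hτ, mul_pow, mul_pow, I_pow_four, I_sq, wtQ]
  ring

lemma wtQ_T {τ : ℂ} (hτ : 0 < τ.im) : wtQ (τ + 1) = wtP τ := by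
  rw [wtQ, thA_T, thB_T hτ, mul_pow, mul_pow, I_pow_four, I_sq, wtP]
  ring

lemma wtR_T {τ : ℂ} (hτ : 0 < τ.im) : wtR (τ + 1) = wtR τ := by
  rw [wtR, thA_T, thB_T hτ, mul_pow, I_pow_four, wtR]
  ring

lemma wtP_S {τ : ℂ} (hτ : 0 < τ.im) : wtP (-1 / τ) = τ ^ 2 * wtP τ := by
  have h := thS_pow_four τ
  rw [wtP, thA_S hτ, thB_S hτ, wtP]
  linear_combination ((thA τ + thB τ) ^ 4 - 6 * ((thA τ + thB τ) ^ 2 * (thA τ - thB τ) ^ 2)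
    + (thA τ - thB τ) ^ 4) * h

lemma wtQ_S {τ : ℂ} (hτ : 0 < τ.im) : wtQ (-1 / τ) = τ ^ 2 * wtR τ := by
  have h := thS_pow_four τ
  rw [wtQ, thA_S hτ, thB_S hτ, wtR]
  linear_combination ((thA τ + thB τ) ^ 4 + 6 * ((thA τ + thB τ) ^ 2 * (thA τ - thB τ) ^ 2)
    + (thA τ - thB τ) ^ 4) * h

lemma wtR_S {τ : ℂ} (hτ : 0 < τ.im) : wtR (-1 / τ) = τ ^ 2 * wtQ τ := by
  have h := thS_pow_four τ
  rw [wtR, thA_S hτ, thB_S hτ, wtQ]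
  linear_combination (-(2 * ((thA τ + thB τ) ^ 4 + (thA τ - thB τ) ^ 4))) * h

/-- A triple of conjugate modular forms of weight four, permuted by the generators of the modular
group in the same way as the three forms of weight two above and vanishing at the cusp, is zero. -/
theorem eq_zero_of_conjugate {p q r : ℂ → ℂ}
    (hp : ∀ τ : ℂ, 0 < τ.im → DifferentiableAt ℂ p τ)
    (hq : ∀ τ : ℂ, 0 < τ.im → DifferentiableAt ℂ q τ)
    (hr : ∀ τ : ℂ, 0 < τ.im → DifferentiableAt ℂ r τ)
    (pT : ∀ τ : ℂ, 0 < τ.im → p (τ + 1) = q τ) (qT : ∀ τ : ℂ, 0 < τ.im → q (τ + 1) = p τ)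
    (rT : ∀ τ : ℂ, 0 < τ.im → r (τ + 1) = r τ)
    (pS : ∀ τ : ℂ, 0 < τ.im → p (-1 / τ) = τ ^ 4 * p τ)
    (qS : ∀ τ : ℂ, 0 < τ.im → q (-1 / τ) = τ ^ 4 * r τ)
    (rS : ∀ τ : ℂ, 0 < τ.im → r (-1 / τ) = τ ^ 4 * q τ)
    (p0 : Tendsto p cuspFilter (𝓝 0)) (q0 : Tendsto q cuspFilter (𝓝 0))
    (r0 : Tendsto r cuspFilter (𝓝 0)) {τ : ℂ} (hτ : 0 < τ.im) :
    p τ = 0 ∧ q τ = 0 ∧ r τ = 0 := by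
  have key : ∀ n : ℕ, n ≤ 2 → ∀ τ : ℂ, 0 < τ.im →
      p τ * wtP τ ^ n + q τ * wtQ τ ^ n + r τ * wtR τ ^ n = 0 := by
    intro n hn τ hτ
    refine eq_zero_of_cusp (k := 4 + 2 * n)
      (g := fun τ => p τ * wtP τ ^ n + q τ * wtQ τ ^ n + r τ * wtR τ ^ n) (by lia) ?_ ?_ ?_ ?_ hτ
    · intro τ hτ
      have h1 := differentiableAt_thA hτ
      have h2 := differentiableAt_thB hτ
      have h3 := hp τ hτ
      have h4 := hq τ hτ
      have h5 := hr τ hτ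
      unfold wtP wtQ wtR
      fun_prop
    · intro τ hτ
      simp only [pT τ hτ, qT τ hτ, rT τ hτ, wtP_T hτ, wtQ_T hτ, wtR_T hτ]
      ring
    · intro τ hτ
      simp only [pS τ hτ, qS τ hτ, rS τ hτ, wtP_S hτ, wtQ_S hτ, wtR_S hτ, mul_pow]
      ring
    · have h1 : Tendsto wtP cuspFilter (𝓝 _) := ((tendsto_thA.pow 4).sub
        (((tendsto_thA.pow 2).mul (tendsto_thB.pow 2)).const_mul 6)).add (tendsto_thB.pow 4)
      have h2 : Tendsto wtQ cuspFilter (𝓝 _) := ((tendsto_thA.pow 4).add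
        (((tendsto_thA.pow 2).mul (tendsto_thB.pow 2)).const_mul 6)).add (tendsto_thB.pow 4)
      have h3 : Tendsto wtR cuspFilter (𝓝 _) :=
        (((tendsto_thA.pow 4).add (tendsto_thB.pow 4)).const_mul 2).neg
      have h := ((p0.mul (h1.pow n)).add (q0.mul (h2.pow n))).add (r0.mul (h3.pow n))
      simpa using h
  have hA := thA_ne_zero hτ
  have hB := thB_ne_zero hτ
  have hs := thA_sq_add_thB_sq_ne_zero hτ
  have hd := thA_sq_sub_thB_sq_ne_zero hτ
  have k0 := key 0 (by norm_num) τ hτ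
  have k1 := key 1 (by norm_num) τ hτ
  have k2 := key 2 (by norm_num) τ hτ
  have d1 : wtQ τ - wtP τ ≠ 0 := by
    rw [show wtQ τ - wtP τ = 12 * (thA τ ^ 2 * thB τ ^ 2) by rw [wtP, wtQ]; ring]
    simp [hA, hB]
  have d2 : wtP τ - wtR τ ≠ 0 := by
    rw [show wtP τ - wtR τ = 3 * (thA τ ^ 2 - thB τ ^ 2) ^ 2 by rw [wtP, wtR]; ring]
    exact mul_ne_zero (by norm_num) (pow_ne_zero 2 hd)
  have d3 : wtQ τ - wtR τ ≠ 0 := by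
    rw [show wtQ τ - wtR τ = 3 * (thA τ ^ 2 + thB τ ^ 2) ^ 2 by rw [wtQ, wtR]; ring]
    exact mul_ne_zero (by norm_num) (pow_ne_zero 2 hs)
  simp only [pow_zero, pow_one, mul_one] at k0 k1
  have hp0 : p τ = 0 := by
    have : (wtQ τ - wtP τ) * (wtP τ - wtR τ) * p τ = 0 := by
      linear_combination -k2 + (wtQ τ + wtR τ) * k1 - wtQ τ * wtR τ * k0
    simpa [d1, d2] using this
  have hq0 : q τ = 0 := by
    have : (wtQ τ - wtP τ) * (wtQ τ - wtR τ) * q τ = 0 := by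
      linear_combination k2 - (wtP τ + wtR τ) * k1 + wtP τ * wtR τ * k0
    simpa [d1, d3] using this
  refine ⟨hp0, hq0, ?_⟩
  rw [hp0, hq0] at k0
  simpa using k0

/-- The values of `EisJ 4 2` at the three even two-torsion points. -/
theorem EisJ_two_torsion {τ : ℂ} (hτ : 0 < τ.im) :
    EisJ 4 2 τ (1 / 2) = (thA τ ^ 4 - thB τ ^ 4) ^ 2 ∧
      e2 (τ / 2) * EisJ 4 2 τ (τ / 2)
        = 4 * (thA τ ^ 2 * thB τ ^ 2) * (thA τ ^ 2 + thB τ ^ 2) ^ 2 := by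
  set F : ℂ → ℂ := fun τ => EisJ 4 2 τ (1 / 2) - (thA τ ^ 4 - thB τ ^ 4) ^ 2 with hF
  set G : ℂ → ℂ := fun τ => e2 (τ / 2) * EisJ 4 2 τ (τ / 2)
    - 4 * (thA τ ^ 2 * thB τ ^ 2) * (thA τ ^ 2 + thB τ ^ 2) ^ 2 with hG
  have FT : ∀ τ : ℂ, 0 < τ.im → F (τ + 1) = F τ := by
    intro τ hτ
    simp only [hF, EisJ_T 2 hτ, thA_T, thB_T hτ, mul_pow, I_pow_four, one_mul]
  have GT : ∀ τ : ℂ, 0 < τ.im → G (τ + 1) = -(F τ + G τ) := by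
    intro τ hτ
    have hA := thA_ne_zero hτ
    have hB := thB_ne_zero hτ
    have hs := thA_sq_add_thB_sq_ne_zero hτ
    have hd := thA_sq_sub_thB_sq_ne_zero hτ
    have h := EisJ_two_eq hτ (τ / 2 + 1 / 2)
    rw [thU_add_half, thV_add_half hτ, EisJ_zero one_le_two hτ] at h
    have hU := e2_mul_thU_tau hτ
    have hV := e2_mul_thV_tau hτ
    have h4 : e2 (τ / 2) = e2 (τ / 4) ^ 2 := by
      rw [sq, ← e2_add]
      ring_nf
    have h3 : e2 (τ / 2) * EisJ 4 2 τ (τ / 2 + 1 / 2) = EisJ 4 2 τ (1 / 2)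
        + e2 (τ / 2) * EisJ 4 2 τ (τ / 2) - thE τ := by
      rw [h, show ∀ a b c x y z w : ℂ, w * (a * ((x ^ 2 + (-y) ^ 2) / z) + b + c)
        = a * (w * (x ^ 2 + y ^ 2) / z) + w * b + w * c by intros; ring]
      have e1 : e2 (τ / 2) * (thU τ (τ / 2) ^ 2 + thV τ (τ / 2) ^ 2) = thA τ ^ 2 + thB τ ^ 2 := by
        rw [← hU, ← hV, h4]
        ring
      have e2' : e2 (τ / 2) * (thU τ (τ / 2) ^ 2 - (-thV τ (τ / 2)) ^ 2)
          = -(thA τ ^ 2 - thB τ ^ 2) := by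
        rw [← hU, ← hV, h4]
        ring
      have e3 : e2 (τ / 2) * (thU τ (τ / 2) * -thV τ (τ / 2)) = -(thA τ * thB τ) := by
        rw [← hU, ← hV, h4]
        ring
      rw [show ∀ w a x y : ℂ, w * (a * (x / y)) = a * (w * x / y) by intros; ring,
        show ∀ w a x y : ℂ, w * (a * (x / y)) = a * (w * x / y) by intros; ring, e1, e2', e3,
        div_self hs, neg_div, div_self hd, neg_div, div_self (mul_ne_zero hA hB)]
      ring
    simp only [hF, hG, EisJ_T 2 hτ, thA_T, thB_T hτ, mul_pow, I_sq]
    rw [show (τ + 1) / 2 = τ / 2 + 1 / 2 by ring, e2_add, e2_half]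
    rw [thE] at h3
    linear_combination -h3
  have FS : ∀ τ : ℂ, 0 < τ.im → F (-1 / τ) = τ ^ 4 * G τ := by
    intro τ hτ
    have h0 := ne_zero_of_im_pos hτ
    have h := EisJ_S 2 hτ (τ / 2)
    rw [show τ / 2 / τ = 1 / 2 by field_simp, Nat.cast_ofNat,
      show 2 * ((τ / 2) ^ 2 / τ) = τ / 2 by field_simp] at h
    have e1 : (thA (-1 / τ) ^ 4 - thB (-1 / τ) ^ 4) ^ 2
        = τ ^ 4 * (4 * (thA τ ^ 2 * thB τ ^ 2) * (thA τ ^ 2 + thB τ ^ 2) ^ 2) := by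
      rw [thA_S hτ, thB_S hτ, mul_pow, mul_pow, thS_pow_four]
      ring
    simp only [hF, hG]
    rw [e1, h]
    ring
  have GS : ∀ τ : ℂ, 0 < τ.im → G (-1 / τ) = τ ^ 4 * F τ := by
    intro τ hτ
    have h0 := ne_zero_of_im_pos hτ
    have h := FS (-1 / τ) (im_inv_pos hτ)
    rw [neg_one_div_neg_one_div] at h
    rw [h]
    field_simp
  have hd : ∀ τ : ℂ, 0 < τ.im → DifferentiableAt ℂ F τ ∧ DifferentiableAt ℂ G τ := by
    intro τ hτ
    have h1 := differentiableAt_thA hτ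
    have h2 := differentiableAt_thB hτ
    have h3 := differentiableAt_eisTorsion one_le_two 0 (1 / 2) hτ
    have h4 := differentiableAt_eisTorsion one_le_two (1 / 2) 0 hτ
    rw [eisTorsion_zero_half] at h3
    rw [eisTorsion_half_zero] at h4
    exact ⟨h3.sub (by fun_prop), h4.sub (by fun_prop)⟩
  have F0 : Tendsto F cuspFilter (𝓝 0) := by
    have h := tendsto_eisTorsion_zero_half one_le_two
    rw [eisTorsion_zero_half] at h
    simpa [hF] using h.sub (((tendsto_thA.pow 4).sub (tendsto_thB.pow 4)).pow 2)
  have G0 : Tendsto G cuspFilter (𝓝 0) := by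
    have h := tendsto_eisTorsion_half_zero
    rw [eisTorsion_half_zero] at h
    simpa using h.sub ((((tendsto_thA.pow 2).mul (tendsto_thB.pow 2)).const_mul 4).mul
      (((tendsto_thA.pow 2).add (tendsto_thB.pow 2)).pow 2))
  obtain ⟨-, h1, h2⟩ := eq_zero_of_conjugate (p := fun τ => F τ + G τ) (q := fun τ => -G τ)
    (r := fun τ => -F τ) (fun τ hτ => (hd τ hτ).1.add (hd τ hτ).2) (fun τ hτ => (hd τ hτ).2.neg)
    (fun τ hτ => (hd τ hτ).1.neg) (fun τ hτ => by simp only [FT τ hτ, GT τ hτ]; ring)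
    (fun τ hτ => by simp only [GT τ hτ]; ring) (fun τ hτ => by simp only [FT τ hτ])
    (fun τ hτ => by simp only [FS τ hτ, GS τ hτ]; ring)
    (fun τ hτ => by simp only [GS τ hτ]; ring) (fun τ hτ => by simp only [FS τ hτ]; ring)
    (by simpa using F0.add G0) (by simpa using G0.neg) (by simpa using F0.neg) hτ
  exact ⟨sub_eq_zero.1 (neg_eq_zero.1 h2), sub_eq_zero.1 (neg_eq_zero.1 h1)⟩

theorem EisJ_two_formula {τ : ℂ} (hτ : 0 < τ.im) (z : ℂ) :
    EisJ 4 2 τ z = (thA τ ^ 6 + 3 * thA τ ^ 2 * thB τ ^ 4) * thU τ z ^ 2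
      + 8 * thA τ ^ 3 * thB τ ^ 3 * (thU τ z * thV τ z)
      + (3 * thA τ ^ 4 * thB τ ^ 2 + thB τ ^ 6) * thV τ z ^ 2 := by
  have hA := thA_ne_zero hτ
  have hB := thB_ne_zero hτ
  have hs := thA_sq_add_thB_sq_ne_zero hτ
  have hd := thA_sq_sub_thB_sq_ne_zero hτ
  obtain ⟨h1, h2⟩ := EisJ_two_torsion hτ
  rw [EisJ_two_eq hτ, EisJ_zero one_le_two hτ, h1, h2, thE]
  field_simp
  ring

/-- The basic relation between `EisJ 4 2` and the square of `EisJ 4 1`. -/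
theorem thE_mul_EisJ_two {τ : ℂ} (hτ : 0 < τ.im) (z : ℂ) :
    EisJ 4 1 τ z ^ 2 = thE τ * EisJ 4 2 τ z - 3 * (thA τ ^ 2 * thB τ ^ 2)
      * (thA τ ^ 4 - thB τ ^ 4) ^ 2 * (thB τ * thU τ z - thA τ * thV τ z) ^ 2 := by
  rw [EisJ_one_formula hτ, EisJ_two_formula hτ, thE]
  ring

end IndexTwo

section EisensteinFour
open Filter Topology EisensteinSeries ModularForm
open UpperHalfPlane hiding I
open MatrixGroups SlashInvariantForm ArithmeticFunction.sigma

lemma thE_slash (A : SL(2, ℤ)) : (toHalfPlane thE) ∣[(4 : ℤ)] A = toHalfPlane thE :=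
  slash_action_generators_SL2Z (toHalfPlane_slash_S (k := 4) fun _ h => thE_S h)
    (toHalfPlane_slash_T (fun _ h => thE_T h) 4) A

/-- `thE` as a modular form of weight four. -/
def thEForm : ModularForm 𝒮ℒ 4 where
  toFun := toHalfPlane thE
  slash_action_eq' := by
    rintro A ⟨A, rfl⟩
    exact thE_slash A
  holo' := by
    rw [UpperHalfPlane.mdifferentiable_iff]
    refine .congr (fun z hz => (differentiableAt_thE hz).differentiableWithinAt) fun z hz => ?_
    simp [toHalfPlane, ofComplex_apply_of_im_pos hz]
  bdd_at_cusps' := by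
    intro c hc
    rw [Subgroup.IsArithmetic.isCusp_iff_isCusp_SL2Z] at hc
    rw [OnePoint.isBoundedAt_iff_forall_SL2Z hc]
    intro γ _
    rw [thE_slash]
    exact (tendsto_toHalfPlane (fun _ h => thE_T h) tendsto_thE).isBigO_one ℝ

lemma thEForm_qExpansion_coeff_zero : (qExpansion 1 thEForm).coeff 0 = 1 := by
  rw [qExpansion_coeff_zero one_pos
    (ModularFormClass.analyticAt_cuspFunction_zero _ one_pos one_mem_strictPeriods_SL)
    (SlashInvariantFormClass.periodic_comp_ofComplex _ one_mem_strictPeriods_SL)]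
  exact (tendsto_toHalfPlane (fun _ h => thE_T h) tendsto_thE).limUnder_eq

lemma thEForm_eq : thEForm = E₄ := by
  obtain ⟨c, hc⟩ : ∃ c, c • E₄ = thEForm :=
    (finrank_eq_one_iff_of_nonzero' E₄ (E_ne_zero _ ⟨2, rfl⟩)).mp
      (Module.rank_eq_one_iff_finrank_eq_one.mp levelOne_weight_four_rank_one) _
  have h : c • qExpansion 1 (E₄ : UpperHalfPlane → ℂ) = qExpansion 1 thEForm := by
    rw [← ModularForm.qExpansion_smul one_pos one_mem_strictPeriods_SL c E₄,
      show (c • E₄ : UpperHalfPlane → ℂ) = thEForm from congrArg DFunLike.coe hc]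
  have h1 := congrArg (PowerSeries.coeff 0) h
  rw [PowerSeries.coeff_smul, E_qExpansion_coeff_zero _ ⟨2, rfl⟩, thEForm_qExpansion_coeff_zero,
    smul_eq_mul, mul_one] at h1
  rw [← hc, h1, one_smul]

/-- The `q`-expansion of the Eisenstein series of weight four. -/
theorem hasSum_thE {τ : ℂ} (hτ : 0 < τ.im) :
    HasSum (fun n : ℕ => (σ 3 n : ℂ) * e2 (n * τ)) ((thE τ - 1) / 240) := by
  have h0 : thE τ = E₄ ⟨τ, hτ⟩ := congrArg (fun F : ModularForm 𝒮ℒ 4 => F ⟨τ, hτ⟩) thEForm_eq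
  have h1 := q_expansion_bernoulli (k := 4) (by norm_num) ⟨2, rfl⟩ ⟨τ, hτ⟩
  have hs := summable_sigma_mul_cexp_pow (k := 4) (by norm_num) ⟨τ, hτ⟩
  simp_rw [zpow_natCast] at h1
  rw [tsum_pnat_eq_tsum_succ (f := fun n => (σ (4 - 1) n : ℂ) * cexp (2 * Real.pi * I * τ) ^ n),
    show bernoulli 4 = -1 / 30 by decide +kernel] at h1
  have h2 := hs.tsum_eq_zero_add
  simp only [ArithmeticFunction.map_zero, Nat.cast_zero, zero_mul, zero_add] at h2
  have h3 : (thE τ - 1) / 240 = ∑' n : ℕ, (σ (4 - 1) n : ℂ) * cexp (2 * Real.pi * I * τ) ^ n := by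
    rw [h0, h1]
    erw [h2]
    push_cast
    ring
  rw [h3]
  convert! hs.hasSum using 3 with n
  rw [e2, ← Complex.exp_nat_mul]
  congr 1
  show _ = (n : ℂ) * (2 * Real.pi * I * τ)
  ring

end EisensteinFour

section IntegralExpansions

/-- Collecting terms in an absolutely convergent Fourier series with integer coefficients. -/
lemma hasIntegralFourierExpansion_of_hasSum {ι : Type*} {φ : ℂ → ℂ → ℂ} (g : ι → ℕ × ℤ)
    (c : ι → ℤ) (h : ∀ τ z : ℂ, 0 < τ.im →
      HasSum (fun i => (c i : ℂ) * e2 (((g i).1 : ℂ) * τ + ((g i).2 : ℂ) * z)) (φ τ z)) :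
    HasIntegralFourierExpansion φ := by
  have hfib (p : ℕ × ℤ) : Summable fun i : {i // g i = p} => c i := by
    have h1 := (h I 0 (by simp)).summable.comp_injective
      (Subtype.val_injective (p := fun i => g i = p))
    have h2 : Summable fun i : {i // g i = p} => (c i : ℂ) * e2 ((p.1 : ℂ) * I + (p.2 : ℂ) * 0) :=
      h1.congr fun i => by simp only [Function.comp_apply, i.2]
    rw [summable_mul_right_iff (e2_ne_zero _)] at h2
    have h3 := h2.tendsto_cofinite_zero.eventually (Metric.ball_mem_nhds 0 one_pos)
    refine summable_of_hasFiniteSupport (Set.Finite.subset h3 fun i hi hi' => hi ?_)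
    have h4 : ‖(c i : ℂ)‖ < 1 := by simpa using! hi'
    rw [norm_intCast] at h4
    exact Int.abs_lt_one_iff.1 (by exact_mod_cast h4)
  refine ⟨fun n l => ∑' i : {i // g i = (n, l)}, c i, fun τ z hτ => ?_⟩
  refine ((Equiv.sigmaFiberEquiv g).hasSum_iff.2 (h τ z hτ)).sigma fun p => ?_
  have h4 : HasSum (fun i : {i // g i = p} => (c i : ℂ))
      ((∑' i : {i // g i = p}, c i : ℤ) : ℂ) :=
    (hfib p).hasSum.map (Int.castAddHom ℂ) continuous_of_discreteTopology
  refine (h4.mul_right (e2 ((p.1 : ℂ) * τ + (p.2 : ℂ) * z))).congr_fun ?_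
  rintro ⟨i, rfl⟩
  rfl

namespace HasIntegralFourierExpansion

variable {φ ψ : ℂ → ℂ → ℂ}

lemma congr (h : HasIntegralFourierExpansion φ) (e : ∀ τ z : ℂ, 0 < τ.im → ψ τ z = φ τ z) :
    HasIntegralFourierExpansion ψ := by
  obtain ⟨f, hf⟩ := h
  exact ⟨f, fun τ z hτ => e τ z hτ ▸ hf τ z hτ⟩

lemma add (h₁ : HasIntegralFourierExpansion φ) (h₂ : HasIntegralFourierExpansion ψ) :
    HasIntegralFourierExpansion fun τ z => φ τ z + ψ τ z := by
  obtain ⟨f, hf⟩ := h₁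
  obtain ⟨g, hg⟩ := h₂
  refine ⟨fun n l => f n l + g n l, fun τ z hτ => ?_⟩
  simpa [add_mul] using (hf τ z hτ).add (hg τ z hτ)

lemma sub (h₁ : HasIntegralFourierExpansion φ) (h₂ : HasIntegralFourierExpansion ψ) :
    HasIntegralFourierExpansion fun τ z => φ τ z - ψ τ z := by
  obtain ⟨f, hf⟩ := h₁
  obtain ⟨g, hg⟩ := h₂
  refine ⟨fun n l => f n l - g n l, fun τ z hτ => ?_⟩
  simpa [sub_mul] using (hf τ z hτ).sub (hg τ z hτ)

lemma mul (h₁ : HasIntegralFourierExpansion φ) (h₂ : HasIntegralFourierExpansion ψ) :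
    HasIntegralFourierExpansion fun τ z => φ τ z * ψ τ z := by
  obtain ⟨f, hf⟩ := h₁
  obtain ⟨g, hg⟩ := h₂
  refine hasIntegralFourierExpansion_of_hasSum (ι := (ℕ × ℤ) × (ℕ × ℤ))
    (fun i => (i.1.1 + i.2.1, i.1.2 + i.2.2)) (fun i => f i.1.1 i.1.2 * g i.2.1 i.2.2)
    fun τ z hτ => ?_
  have hs := summable_mul_of_summable_norm (hf τ z hτ).summable.norm (hg τ z hτ).summable.norm
  have h := (hf τ z hτ).mul (hg τ z hτ) hs
  convert! h using 2 with i
  have e : ((i.1.1 + i.2.1 : ℕ) : ℂ) * τ + ((i.1.2 + i.2.2 : ℤ) : ℂ) * z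
      = (i.1.1 * τ + i.1.2 * z) + (i.2.1 * τ + i.2.2 * z) := by
    push_cast
    ring
  rw [e, e2_add, Int.cast_mul]
  exact mul_mul_mul_comm _ _ _ _

lemma intCast (m : ℤ) : HasIntegralFourierExpansion fun _ _ => (m : ℂ) := by
  refine hasIntegralFourierExpansion_of_hasSum (ι := Unit) (fun _ => 0) (fun _ => m)
    fun τ z _ => ?_
  simp [e2_zero]

lemma natCast (m : ℕ) : HasIntegralFourierExpansion fun _ _ => (m : ℂ) := by
  simpa using intCast m

lemma ofNat (m : ℕ) [m.AtLeastTwo] :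
    HasIntegralFourierExpansion fun _ _ => (OfNat.ofNat m : ℂ) :=
  natCast m

lemma pow (h : HasIntegralFourierExpansion φ) (k : ℕ) :
    HasIntegralFourierExpansion fun τ z => φ τ z ^ k := by
  induction k with
  | zero => simpa using natCast 1
  | succ k ih => simpa only [pow_succ] using ih.mul h

end HasIntegralFourierExpansion

open HasIntegralFourierExpansion

lemma hasIntegralFourierExpansion_q : HasIntegralFourierExpansion fun τ _ => e2 τ := by
  refine hasIntegralFourierExpansion_of_hasSum (ι := Unit) (fun _ => (1, 0)) (fun _ => 1)
    fun τ z _ => ?_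
  simp

lemma hasIntegralFourierExpansion_thU : HasIntegralFourierExpansion thU := by
  refine hasIntegralFourierExpansion_of_hasSum (fun l : ℤ => ((l ^ 2).toNat, 2 * l)) (fun _ => 1)
    fun τ z hτ => (hasSum_thU hτ z).congr_fun fun l => ?_
  have h : (((l ^ 2).toNat : ℤ) : ℂ) = ((l ^ 2 : ℤ) : ℂ) := by
    rw [Int.toNat_of_nonneg (sq_nonneg l)]
  simp only [Int.cast_natCast] at h
  simp only [h]
  push_cast
  ring_nf

lemma hasIntegralFourierExpansion_thA : HasIntegralFourierExpansion fun τ _ => thA τ := by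
  refine hasIntegralFourierExpansion_of_hasSum (fun l : ℤ => ((l ^ 2).toNat, 0)) (fun _ => 1)
    fun τ z hτ => (hasSum_thU hτ 0).congr_fun fun l => ?_
  have h : (((l ^ 2).toNat : ℤ) : ℂ) = ((l ^ 2 : ℤ) : ℂ) := by
    rw [Int.toNat_of_nonneg (sq_nonneg l)]
  simp only [Int.cast_natCast] at h
  simp only [h]
  push_cast
  ring_nf

/-- The function `thV` with its leading power of `q` removed. -/
def thV' (τ z : ℂ) : ℂ := e2 (-(τ / 4)) * thV τ z

/-- Half the function `thB` with its leading power of `q` removed. -/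
def thB' (τ : ℂ) : ℂ := e2 (-(τ / 4)) * thB τ / 2

lemma hasSum_thV' {τ : ℂ} (hτ : 0 < τ.im) (z : ℂ) :
    HasSum (fun l : ℤ => e2 (((l : ℂ) ^ 2 + l) * τ + (2 * l + 1) * z)) (thV' τ z) := by
  refine ((hasSum_thV hτ z).mul_left (e2 (-(τ / 4)))).congr_fun fun l => ?_
  rw [← e2_add]
  ring_nf

lemma hasIntegralFourierExpansion_thV' : HasIntegralFourierExpansion thV' := by
  refine hasIntegralFourierExpansion_of_hasSum (fun l : ℤ => ((l ^ 2 + l).toNat, 2 * l + 1))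
    (fun _ => 1) fun τ z hτ => (hasSum_thV' hτ z).congr_fun fun l => ?_
  have h : (((l ^ 2 + l).toNat : ℤ) : ℂ) = ((l ^ 2 + l : ℤ) : ℂ) := by
    rw [Int.toNat_of_nonneg]
    rcases le_or_gt 0 l with h | h <;> nlinarith
  simp only [Int.cast_natCast] at h
  simp only [h]
  push_cast
  ring_nf

lemma hasIntegralFourierExpansion_thB' : HasIntegralFourierExpansion fun τ _ => thB' τ := by
  refine hasIntegralFourierExpansion_of_hasSum (fun l : ℕ => (l ^ 2 + l, 0))
    (fun _ => 1) fun τ z hτ => ?_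
  refine ((hasSum_thV' hτ 0).nat_add_neg_add_one.div_const 2).congr_fun fun l => ?_
  push_cast
  ring_nf

lemma hasIntegralFourierExpansion_thE :
    HasIntegralFourierExpansion fun τ _ => (thE τ - 1) / 240 := by
  refine hasIntegralFourierExpansion_of_hasSum (fun n : ℕ => (n, 0))
    (fun n => (ArithmeticFunction.sigma 3 n : ℤ)) fun τ z hτ => ?_
  simpa using hasSum_thE hτ

lemma exists_thB_thV (τ : ℂ) : ∃ r : ℂ, r ^ 4 = e2 τ ∧ thB τ = 2 * r * thB' τ ∧
    ∀ z, thV τ z = r * thV' τ z := by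
  have h : e2 (τ / 4) * e2 (-(τ / 4)) = 1 := by rw [← e2_add, add_neg_cancel, e2_zero]
  refine ⟨e2 (τ / 4), ?_, ?_, fun z => ?_⟩
  · rw [← e2_nsmul]
    ring_nf
  · rw [thB']
    linear_combination (-thB τ) * h
  · rw [thV']
    linear_combination (-thV τ z) * h

theorem hasIntegralFourierExpansion_EisJ_two : HasIntegralFourierExpansion (EisJ 4 2) := by
  have hA := hasIntegralFourierExpansion_thA
  have hB := hasIntegralFourierExpansion_thB'
  have hU := hasIntegralFourierExpansion_thU
  have hV := hasIntegralFourierExpansion_thV'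
  have hq := hasIntegralFourierExpansion_q
  refine (((((hA.pow 6).add ((ofNat 48).mul (((hA.pow 2).mul (hB.pow 4)).mul hq))).mul
    (hU.pow 2)).add (((ofNat 64).mul (((hA.pow 3).mul (hB.pow 3)).mul hq)).mul (hU.mul hV))).add
    ((((ofNat 12).mul (((hA.pow 4).mul (hB.pow 2)).mul hq)).add
      ((ofNat 64).mul ((hB.pow 6).mul (hq.pow 2)))).mul (hV.pow 2))).congr fun τ z hτ => ?_
  obtain ⟨r, hr, h1, h2⟩ := exists_thB_thV τ
  rw [EisJ_two_formula hτ, h1, h2, ← hr]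
  ring

/-- The difference `EisJ 4 1 ^ 2 - EisJ 4 2` is twelve times an integral Fourier series. -/
theorem hasIntegralFourierExpansion_sub_div_twelve :
    HasIntegralFourierExpansion fun τ z => (EisJ 4 1 τ z ^ 2 - EisJ 4 2 τ z) / 12 := by
  have hA := hasIntegralFourierExpansion_thA
  have hB := hasIntegralFourierExpansion_thB'
  have hU := hasIntegralFourierExpansion_thU
  have hV := hasIntegralFourierExpansion_thV'
  have hq := hasIntegralFourierExpansion_q
  refine (((ofNat 20).mul (hasIntegralFourierExpansion_thE.mul
    hasIntegralFourierExpansion_EisJ_two)).sub ((((hA.pow 2).mul ((hB.pow 2).mul hq)).mul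
    (((hA.pow 4).sub ((ofNat 16).mul ((hB.pow 4).mul hq))).pow 2)).mul
    ((((ofNat 2).mul (hB.mul hU)).sub (hA.mul hV)).pow 2))).congr fun τ z hτ => ?_
  obtain ⟨r, hr, h1, h2⟩ := exists_thB_thV τ
  rw [thE_mul_EisJ_two hτ, h1, h2, ← hr]
  ring

end IntegralExpansions

/-- the Fourier coefficients of `E_{4,2}` and of `E_{4,1}²` are integers and
are congruent modulo `12`. -/
theorem E42_E41sq_congruent_mod_12 :
    ∃ a b : ℕ → ℤ → ℤ,
      (∀ τ z : ℂ, 0 < τ.im →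
        HasSum (fun p : ℕ × ℤ => (a p.1 p.2 : ℂ) * e2 ((p.1 : ℂ) * τ + (p.2 : ℂ) * z))
          (EisJ 4 2 τ z)) ∧
      (∀ τ z : ℂ, 0 < τ.im →
        HasSum (fun p : ℕ × ℤ => (b p.1 p.2 : ℂ) * e2 ((p.1 : ℂ) * τ + (p.2 : ℂ) * z))
          (EisJ 4 1 τ z ^ 2)) ∧
      (∀ n : ℕ, ∀ l : ℤ, a n l ≡ b n l [ZMOD 12]) := by
  obtain ⟨a, ha⟩ := hasIntegralFourierExpansion_EisJ_two
  obtain ⟨d, hd⟩ := hasIntegralFourierExpansion_sub_div_twelve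
  refine ⟨a, fun n l => a n l + 12 * d n l, ha, fun τ z hτ => ?_, fun n l => ?_⟩
  · convert! (ha τ z hτ).add ((hd τ z hτ).mul_left 12) using 1
    · ext p
      push_cast
      ring
    · ring
  · exact Int.modEq_iff_dvd.2 ⟨d n l, by ring⟩

end JacobiPaper
end
end

section
/- As holomorphic functions on ℍ×ℂ, 24·φ_{0,2}(τ,z) = φ_{0,1}(τ,z)² − E₄(τ)φ_{−2,1}(τ,z)². -/
noncomputable section

open Complex

namespace JacobiPaper

section TripleProduct

open Filter Topology

/-- The sequence `m ↦ 1 / ∏_{k < m} (1 - q^(k+1))`, extended by zero to negative `m`. -/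
def invQFactorial (q : ℂ) (m : ℤ) : ℂ :=
  if 0 ≤ m then (∏ k ∈ Finset.range m.toNat, (1 - q ^ (k + 1)))⁻¹ else 0

lemma one_sub_pow_succ_ne_zero {q : ℂ} (hq : ‖q‖ < 1) (n : ℕ) : 1 - q ^ (n + 1) ≠ 0 := by
  intro h
  have h1 : ‖q ^ (n + 1)‖ < 1 := by
    rw [norm_pow]
    exact pow_lt_one₀ (norm_nonneg _) hq n.succ_ne_zero
  rw [← sub_eq_zero.mp h, norm_one] at h1
  exact lt_irrefl _ h1

lemma one_sub_zpow_mul_invQFactorial {q : ℂ} (hq : ‖q‖ < 1) (m : ℤ) :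
    (1 - q ^ m) * invQFactorial q m = invQFactorial q (m - 1) := by
  rcases lt_trichotomy m 0 with h | rfl | h
  · simp [invQFactorial, show ¬ 0 ≤ m by lia, show ¬ 1 ≤ m by lia]
  · simp [invQFactorial]
  · obtain ⟨n, rfl⟩ : ∃ n : ℕ, m = (n + 1 : ℕ) := ⟨m.toNat - 1, by lia⟩
    have h0 := one_sub_pow_succ_ne_zero hq n
    have h1 : ((n + 1 : ℕ) : ℤ) - 1 = n := by push_cast; ring
    rw [h1]
    simp only [invQFactorial, Int.natCast_nonneg, if_true, Int.toNat_natCast, zpow_natCast,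
      Finset.prod_range_succ, mul_inv]
    field_simp

lemma qBinomial_recurrence {p : ℂ} (hp0 : p ≠ 0) (hp : ‖p‖ < 1) (n : ℕ) (j : ℤ) :
    (1 - p ^ (4 * n + 2)) * (1 - p ^ (4 * n + 4)) *
        (invQFactorial (p ^ 2) (n + 1 - j) * invQFactorial (p ^ 2) (n + 1 + j)) * p ^ (j ^ 2) =
      (1 + p ^ (4 * n + 2)) *
        (invQFactorial (p ^ 2) (n - j) * invQFactorial (p ^ 2) (n + j) * p ^ (j ^ 2)) +
      p ^ (2 * n + 1) * (invQFactorial (p ^ 2) (n - (j - 1)) * invQFactorial (p ^ 2) (n + (j - 1)) *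
        p ^ ((j - 1) ^ 2)) +
      p ^ (2 * n + 1) * (invQFactorial (p ^ 2) (n - (j + 1)) * invQFactorial (p ^ 2) (n + (j + 1)) *
        p ^ ((j + 1) ^ 2)) := by
  have hq : ‖p ^ 2‖ < 1 := by
    rw [norm_pow]; exact pow_lt_one₀ (norm_nonneg _) hp two_ne_zero
  have e1 := one_sub_zpow_mul_invQFactorial hq (n + 1 - j)
  have e2 := one_sub_zpow_mul_invQFactorial hq (n + 1 + j)
  have e3 := one_sub_zpow_mul_invQFactorial hq (n - j)
  have e4 := one_sub_zpow_mul_invQFactorial hq (n + j)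
  rw [show (n : ℤ) + 1 - j - 1 = n - j by ring] at e1
  rw [show (n : ℤ) + 1 + j - 1 = n + j by ring] at e2
  rw [show (n : ℤ) - (j - 1) = n + 1 - j by ring, show (n : ℤ) + (j - 1) = n + j - 1 by ring,
    show (n : ℤ) - (j + 1) = n - j - 1 by ring, show (n : ℤ) + (j + 1) = n + 1 + j by ring,
    ← e3, ← e4, ← e1, ← e2]
  set u := invQFactorial (p ^ 2) (n + 1 - j)
  set v := invQFactorial (p ^ 2) (n + 1 + j)
  have hz : ∀ m : ℤ, (p ^ 2) ^ m = p ^ (2 * m) := fun m => by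
    rw [zpow_mul]; rfl
  have f1 : p ^ ((j - 1) ^ 2) = p ^ (j ^ 2) * p / (p ^ j) ^ 2 := by
    rw [← zpow_natCast (p ^ j), ← zpow_mul, ← zpow_add_one₀ hp0, ← zpow_sub₀ hp0]
    congr 1; push_cast; ring
  have f2 : p ^ ((j + 1) ^ 2) = p ^ (j ^ 2) * p * (p ^ j) ^ 2 := by
    rw [← zpow_natCast (p ^ j), ← zpow_mul, ← zpow_add_one₀ hp0, ← zpow_add₀ hp0]
    congr 1; push_cast; ring
  have g1 : (p ^ 2) ^ ((n : ℤ) + 1 - j) = (p ^ n) ^ 2 * p ^ 2 / (p ^ j) ^ 2 := by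
    rw [zpow_sub₀ (pow_ne_zero 2 hp0), zpow_add_one₀ (pow_ne_zero 2 hp0), zpow_natCast, hz j,
      mul_comm 2 j, zpow_mul]
    norm_cast; ring
  have g2 : (p ^ 2) ^ ((n : ℤ) + 1 + j) = (p ^ n) ^ 2 * p ^ 2 * (p ^ j) ^ 2 := by
    rw [zpow_add₀ (pow_ne_zero 2 hp0), zpow_add_one₀ (pow_ne_zero 2 hp0), zpow_natCast, hz j,
      mul_comm 2 j, zpow_mul]
    norm_cast; ring
  have g3 : (p ^ 2) ^ ((n : ℤ) - j) = (p ^ n) ^ 2 / (p ^ j) ^ 2 := by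
    rw [zpow_sub₀ (pow_ne_zero 2 hp0), zpow_natCast, hz j, mul_comm 2 j, zpow_mul]
    norm_cast; ring
  have g4 : (p ^ 2) ^ ((n : ℤ) + j) = (p ^ n) ^ 2 * (p ^ j) ^ 2 := by
    rw [zpow_add₀ (pow_ne_zero 2 hp0), zpow_natCast, hz j, mul_comm 2 j, zpow_mul]
    norm_cast; ring
  have k1 : p ^ (4 * n + 2) = (p ^ n) ^ 4 * p ^ 2 := by ring
  have k2 : p ^ (4 * n + 4) = (p ^ n) ^ 4 * p ^ 4 := by ring
  have k3 : p ^ (2 * n + 1) = (p ^ n) ^ 2 * p := by ring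
  rw [f1, f2, g1, g2, g3, g4, k1, k2, k3]
  have hj : p ^ j ≠ 0 := zpow_ne_zero _ hp0
  generalize p ^ (j ^ 2) = s
  generalize p ^ j = t at hj
  generalize p ^ n = w
  field_simp
  ring

/-- The finite form of the Jacobi triple product. -/
lemma hasSum_finite_triple_product {p x : ℂ} (hp0 : p ≠ 0) (hp : ‖p‖ < 1) (hx : x ≠ 0) (n : ℕ) :
    HasSum (fun j : ℤ => (∏ k ∈ Finset.range (2 * n), (1 - (p ^ 2) ^ (k + 1))) *
        (invQFactorial (p ^ 2) (n - j) * invQFactorial (p ^ 2) (n + j)) * (p ^ (j ^ 2) * x ^ j))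
      (∏ k ∈ Finset.range n, ((1 + x * p ^ (2 * k + 1)) * (1 + x⁻¹ * p ^ (2 * k + 1)))) := by
  induction n with
  | zero =>
    convert! hasSum_ite_eq (0 : ℤ) (1 : ℂ) using 2 with j
    rcases lt_trichotomy j 0 with h | rfl | h
    · simp [invQFactorial, h.ne, show ¬ 0 ≤ j by lia]
    · simp [invQFactorial]
    · simp [invQFactorial, h.ne', show ¬ j ≤ 0 by lia]
  | succ n ih =>
    have h0 := ih.mul_left (1 + p ^ (4 * n + 2))
    have h1 := (((Equiv.subRight (1 : ℤ)).hasSum_iff).mpr ih).mul_left (x * p ^ (2 * n + 1))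
    have h2 := (((Equiv.addRight (1 : ℤ)).hasSum_iff).mpr ih).mul_left (x⁻¹ * p ^ (2 * n + 1))
    convert! (h0.add h1).add h2 using 1
    · funext j
      have hr := qBinomial_recurrence hp0 hp n j
      simp only [Function.comp_apply, Equiv.subRight_apply, Equiv.coe_addRight]
      rw [zpow_sub_one₀ hx, zpow_add_one₀ hx, show 2 * (n + 1) = 2 * n + 1 + 1 by ring,
        Finset.prod_range_succ, Finset.prod_range_succ]
      push_cast
      have k1 : (p ^ 2) ^ (2 * n + 1) = p ^ (4 * n + 2) := by ring
      have k2 : (p ^ 2) ^ (2 * n + 1 + 1) = p ^ (4 * n + 4) := by ring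
      rw [k1, k2]
      have hx1 : x * x⁻¹ = 1 := mul_inv_cancel₀ hx
      linear_combination (exp := 1) (∏ k ∈ Finset.range (2 * n), (1 - (p ^ 2) ^ (k + 1))) *
        x ^ j * hr - (∏ k ∈ Finset.range (2 * n), (1 - (p ^ 2) ^ (k + 1))) * x ^ j *
        p ^ (2 * n + 1) * (invQFactorial (p ^ 2) (n - (j - 1)) *
          invQFactorial (p ^ 2) (n + (j - 1)) * p ^ ((j - 1) ^ 2) +
          invQFactorial (p ^ 2) (n - (j + 1)) * invQFactorial (p ^ 2) (n + (j + 1)) *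
            p ^ ((j + 1) ^ 2)) * hx1
    · rw [Finset.prod_range_succ]
      have hx1 : x * x⁻¹ = 1 := mul_inv_cancel₀ hx
      have k1 : p ^ (4 * n + 2) = (p ^ (2 * n + 1)) ^ 2 := by ring
      rw [k1]
      linear_combination (∏ k ∈ Finset.range n, ((1 + x * p ^ (2 * k + 1)) *
        (1 + x⁻¹ * p ^ (2 * k + 1)))) * (p ^ (2 * n + 1)) ^ 2 * hx1

lemma multipliable_one_add_mul_pow {q : ℂ} (hq : ‖q‖ < 1) (a : ℂ) :
    Multipliable fun n : ℕ => 1 + a * q ^ n := by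
  apply multipliable_one_add_of_summable
  simpa using (summable_geometric_of_lt_one (norm_nonneg _) hq).mul_left ‖a‖

lemma tprod_one_sub_pow_ne_zero {q : ℂ} (hq : ‖q‖ < 1) : ∏' n : ℕ, (1 - q ^ (n + 1)) ≠ 0 := by
  simp_rw [sub_eq_add_neg]
  refine tprod_one_add_ne_zero_of_summable (f := fun n : ℕ => -q ^ (n + 1)) ?_ ?_
  · exact fun i => by simpa [← sub_eq_add_neg] using one_sub_pow_succ_ne_zero hq i
  · simpa using (summable_nat_add_iff 1).mpr (summable_geometric_of_lt_one (norm_nonneg _) hq)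

lemma tendsto_invQFactorial {q : ℂ} (hq : ‖q‖ < 1) :
    Tendsto (invQFactorial q) atTop (𝓝 (∏' n : ℕ, (1 - q ^ (n + 1)))⁻¹) := by
  have h1 := (ModularForm.multipliable_one_sub_pow hq).hasProd.tendsto_prod_nat
  have h2 : Tendsto (fun m : ℤ => m.toNat) atTop atTop :=
    tendsto_atTop_atTop.mpr fun b => ⟨b, fun a ha => by lia⟩
  refine Tendsto.congr' ?_ ((h1.comp h2).inv₀ (tprod_one_sub_pow_ne_zero hq))
  filter_upwards [eventually_ge_atTop 0] with m hm
  simp [invQFactorial, hm]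

lemma exists_norm_invQFactorial_le {q : ℂ} (hq : ‖q‖ < 1) :
    ∃ C : ℝ, ∀ m : ℤ, ‖invQFactorial q m‖ ≤ C := by
  have h1 := ((tendsto_invQFactorial hq).comp tendsto_natCast_atTop_atTop).norm
  obtain ⟨C, hC⟩ := h1.bddAbove_range
  refine ⟨C, fun m => ?_⟩
  have hC' : ∀ n : ℕ, ‖invQFactorial q n‖ ≤ C := fun n => hC ⟨n, rfl⟩
  by_cases hm : 0 ≤ m
  · lift m to ℕ using hm
    exact hC' m
  · simpa [invQFactorial, hm] using (norm_nonneg _).trans (hC' 0)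

/-- The **Jacobi triple product** identity. -/
theorem jacobi_triple_product {p x : ℂ} (hp0 : p ≠ 0) (hp : ‖p‖ < 1) (hx : x ≠ 0)
    (hs : Summable fun j : ℤ => p ^ (j ^ 2) * x ^ j) :
    ∑' j : ℤ, p ^ (j ^ 2) * x ^ j =
      (∏' n : ℕ, (1 + -p ^ 2 * (p ^ 2) ^ n)) * (∏' n : ℕ, (1 + x * p * (p ^ 2) ^ n)) *
        ∏' n : ℕ, (1 + x⁻¹ * p * (p ^ 2) ^ n) := by
  have hq : ‖p ^ 2‖ < 1 := by
    rw [norm_pow]; exact pow_lt_one₀ (norm_nonneg _) hp two_ne_zero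
  have hP := (ModularForm.multipliable_one_sub_pow hq).hasProd.tendsto_prod_nat
  have hP0 := tprod_one_sub_pow_ne_zero hq
  set P := ∏' n : ℕ, (1 - (p ^ 2) ^ (n + 1)) with hPdef
  have hP2 : Tendsto (fun n : ℕ => ∏ k ∈ Finset.range (2 * n), (1 - (p ^ 2) ^ (k + 1))) atTop
      (𝓝 P) := hP.comp (tendsto_id.const_mul_atTop' two_pos)
  obtain ⟨C, hC⟩ := exists_norm_invQFactorial_le hq
  obtain ⟨B, hB⟩ := hP2.norm.bddAbove_range
  have hB' : ∀ n : ℕ, ‖∏ k ∈ Finset.range (2 * n), (1 - (p ^ 2) ^ (k + 1))‖ ≤ B :=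
    fun n => hB ⟨n, rfl⟩
  have hB0 : 0 ≤ B := (norm_nonneg _).trans (hB' 0)
  have hC0 : 0 ≤ C := (norm_nonneg _).trans (hC 0)
  have hlim : Tendsto (fun n : ℕ => ∑' j : ℤ,
      (∏ k ∈ Finset.range (2 * n), (1 - (p ^ 2) ^ (k + 1))) *
        (invQFactorial (p ^ 2) (n - j) * invQFactorial (p ^ 2) (n + j)) * (p ^ (j ^ 2) * x ^ j))
      atTop (𝓝 (∑' j : ℤ, P * (P⁻¹ * P⁻¹) * (p ^ (j ^ 2) * x ^ j))) := by
    refine tendsto_tsum_of_dominated_convergence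
      (bound := fun j : ℤ => B * (C * C) * ‖p ^ (j ^ 2) * x ^ j‖) (hs.norm.mul_left _)
      (fun j => ?_) (Eventually.of_forall fun n j => ?_)
    · refine Tendsto.mul_const _ (hP2.mul (Tendsto.mul ?_ ?_))
      · exact (tendsto_invQFactorial hq).comp
          (tendsto_atTop_add_const_right _ (-j) tendsto_natCast_atTop_atTop)
      · exact (tendsto_invQFactorial hq).comp
          (tendsto_atTop_add_const_right _ j tendsto_natCast_atTop_atTop)
    · rw [norm_mul, norm_mul, norm_mul (invQFactorial _ _)]
      gcongr
      · exact hB' n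
      · exact hC _
      · exact hC _
  simp_rw [fun n => (hasSum_finite_triple_product hp0 hp hx n).tsum_eq] at hlim
  have hm1 := multipliable_one_add_mul_pow hq (x * p)
  have hm2 := multipliable_one_add_mul_pow hq (x⁻¹ * p)
  have hlim2 := (hm1.mul hm2).hasProd.tendsto_prod_nat
  have heq : ∀ n : ℕ, (∏ k ∈ Finset.range n, ((1 + x * p * (p ^ 2) ^ k) *
      (1 + x⁻¹ * p * (p ^ 2) ^ k))) =
      ∏ k ∈ Finset.range n, ((1 + x * p ^ (2 * k + 1)) * (1 + x⁻¹ * p ^ (2 * k + 1))) := by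
    intro n
    refine Finset.prod_congr rfl fun k _ => ?_
    ring
  simp_rw [heq] at hlim2
  have h := tendsto_nhds_unique hlim hlim2
  rw [hm1.tprod_mul hm2, tsum_mul_left] at h
  have hP' : ∏' n : ℕ, (1 + -p ^ 2 * (p ^ 2) ^ n) = P := by
    rw [hPdef]
    exact tprod_congr fun n => by ring
  rw [hP', mul_assoc, ← h]
  field_simp

end TripleProduct

section ThetaProducts

/-- The infinite product `∏_{n ≥ 0} (1 + a qⁿ)`. -/
def qProd (q a : ℂ) : ℂ := ∏' n : ℕ, (1 + a * q ^ n)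

lemma qProd_eq_mul {q : ℂ} (hq : ‖q‖ < 1) (a : ℂ) : qProd q a = (1 + a) * qProd q (a * q) := by
  have h := (multipliable_one_add_mul_pow hq a)
  have h2 := multipliable_one_add_mul_pow hq (a * q)
  unfold qProd
  rw [tprod_eq_zero_mul']
  · simp only [pow_zero, mul_one, pow_succ']
    congr 1
    exact tprod_congr fun n => by ring
  · refine h2.congr fun n => by ring

lemma qProd_neg_self (q : ℂ) : qProd q (-q) = ∏' n : ℕ, (1 - q ^ (n + 1)) :=
  tprod_congr fun n => by ring

/-- The nome `e^{π i τ}`. -/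
def nome (τ : ℂ) : ℂ := cexp (Real.pi * I * τ)

lemma nome_ne_zero (τ : ℂ) : nome τ ≠ 0 := Complex.exp_ne_zero _

lemma norm_nome_lt_one {τ : ℂ} (hτ : 0 < τ.im) : ‖nome τ‖ < 1 := by
  rw [nome, Complex.norm_exp, Real.exp_lt_one_iff]
  have : (Real.pi * I * τ : ℂ).re = -(Real.pi * τ.im) := by simp
  rw [this]
  have := mul_pos Real.pi_pos hτ
  linarith

lemma norm_nome_sq_lt_one {τ : ℂ} (hτ : 0 < τ.im) : ‖nome τ ^ 2‖ < 1 := by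
  rw [norm_pow]
  exact pow_lt_one₀ (norm_nonneg _) (norm_nome_lt_one hτ) two_ne_zero

lemma qC_eq (τ : ℂ) : qC τ = nome τ ^ 2 := by
  rw [qC, e2, nome, ← Complex.exp_nat_mul]
  congr 1; push_cast; ring

lemma zetaC_ne_zero (z : ℂ) : zetaC z ≠ 0 := Complex.exp_ne_zero _

lemma jacobiTheta₂_term_eq (j : ℤ) (z τ : ℂ) :
    jacobiTheta₂_term j z τ = nome τ ^ (j ^ 2) * zetaC z ^ j := by
  rw [jacobiTheta₂_term, nome, zetaC, e2, ← Complex.exp_int_mul, ← Complex.exp_int_mul,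
    ← Complex.exp_add]
  congr 1; push_cast; ring

lemma jacobiTheta₂_eq_qProd {τ : ℂ} (hτ : 0 < τ.im) (z : ℂ) :
    jacobiTheta₂ z τ = qProd (nome τ ^ 2) (-nome τ ^ 2) *
      qProd (nome τ ^ 2) (zetaC z * nome τ) * qProd (nome τ ^ 2) ((zetaC z)⁻¹ * nome τ) := by
  have hs := (summable_jacobiTheta₂_term_iff z τ).mpr hτ
  simp_rw [jacobiTheta₂_term_eq] at hs
  rw [jacobiTheta₂]
  simp_rw [jacobiTheta₂_term_eq]
  exact jacobi_triple_product (nome_ne_zero τ) (norm_nome_lt_one hτ) (zetaC_ne_zero z) hs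

lemma theta00_eq (τ z : ℂ) : theta00 τ z = jacobiTheta₂ z τ :=
  tsum_congr fun n => by rw [jacobiTheta₂_term]; congr 1; ring

lemma theta01_eq (τ z : ℂ) : theta01 τ z = jacobiTheta₂ (z + 1 / 2) τ := by
  refine tsum_congr fun n => ?_
  rw [jacobiTheta₂_term, ← Complex.exp_pi_mul_I, ← Complex.exp_int_mul, ← Complex.exp_add]
  congr 1; ring

/-- The factor `q^{1/8} ζ^{1/2}`. -/
def thetaFactor (τ z : ℂ) : ℂ := cexp (Real.pi * I * τ / 4 + Real.pi * I * z)

lemma theta10_eq (τ z : ℂ) :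
    theta10 τ z = thetaFactor τ z * jacobiTheta₂ (z + τ / 2) τ := by
  rw [theta10, thetaFactor, ← Complex.exp_add]
  congr 1
  refine tsum_congr fun n => ?_
  rw [jacobiTheta₂_term]; congr 1; ring

lemma zetaC_add (z w : ℂ) : zetaC (z + w) = zetaC z * zetaC w := by
  simp only [zetaC, e2, mul_add, Complex.exp_add]

lemma zetaC_half : zetaC (1 / 2) = -1 := by
  rw [zetaC, e2, ← Complex.exp_pi_mul_I]; congr 1; ring

lemma zetaC_half_tau (τ : ℂ) : zetaC (τ / 2) = nome τ := by
  rw [zetaC, e2, nome]; congr 1; ring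

lemma zetaC_zero : zetaC 0 = 1 := by simp [zetaC, e2]

/-- The odd theta function as a theta series with characteristic. -/
lemma theta_eq {τ : ℂ} (hτ : 0 < τ.im) (z : ℂ) :
    theta τ z = thetaFactor τ z * jacobiTheta₂ (z + τ / 2 + 1 / 2) τ := by
  have hq := norm_nome_sq_lt_one hτ
  have hn := nome_ne_zero τ
  have hz := zetaC_ne_zero z
  rw [jacobiTheta₂_eq_qProd hτ, zetaC_add, zetaC_add, zetaC_half, zetaC_half_tau]
  have h1 : zetaC z * nome τ * -1 * nome τ = -zetaC z * nome τ ^ 2 := by ring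
  have h2 : (zetaC z * nome τ * -1)⁻¹ * nome τ = -(zetaC z)⁻¹ := by field_simp
  rw [h1, h2, qProd_eq_mul hq (-(zetaC z)⁻¹)]
  have h3 := multipliable_one_add_mul_pow hq (-zetaC z * nome τ ^ 2)
  have h4 := multipliable_one_add_mul_pow hq (-(zetaC z)⁻¹ * nome τ ^ 2)
  have h5 := multipliable_one_add_mul_pow hq (-nome τ ^ 2)
  have h6 : ∏' n : ℕ, ((1 - qC τ ^ (n + 1) * zetaC z) * (1 - qC τ ^ (n + 1) * (zetaC z)⁻¹) *
      (1 - qC τ ^ (n + 1))) = qProd (nome τ ^ 2) (-zetaC z * nome τ ^ 2) *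
        qProd (nome τ ^ 2) (-(zetaC z)⁻¹ * nome τ ^ 2) * qProd (nome τ ^ 2) (-nome τ ^ 2) := by
    rw [qProd, qProd, qProd, ← h3.tprod_mul h4, ← (h3.mul h4).tprod_mul h5]
    refine tprod_congr fun n => ?_
    rw [qC_eq]; ring
  have h7 : cexp (Real.pi * I * z) - cexp (-(Real.pi * I * z)) =
      cexp (Real.pi * I * z) * (1 + -(zetaC z)⁻¹) := by
    rw [zetaC, e2, ← Complex.exp_neg, mul_add, mul_one, mul_neg, ← Complex.exp_add,
      ← sub_eq_add_neg]
    congr 3; ring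
  rw [theta, h6, h7, thetaFactor, Complex.exp_add]
  ring

lemma qProd_neg_self_ne_zero {q : ℂ} (hq : ‖q‖ < 1) : qProd q (-q) ≠ 0 := by
  rw [qProd_neg_self]; exact tprod_one_sub_pow_ne_zero hq

/-- Euler's identity `∏ (1 - p^(4n+2)) ∏ (1 + p^(2n+2)) = 1`. -/
lemma qProd_mul_qProd_mul_qProd {p : ℂ} (hp : ‖p ^ 2‖ < 1) :
    qProd (p ^ 2) p * qProd (p ^ 2) (-p) * qProd (p ^ 2) (p ^ 2) = 1 := by
  have hp4 : ‖p ^ 4‖ < 1 := by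
    rw [show p ^ 4 = (p ^ 2) ^ 2 by ring, norm_pow]
    exact pow_lt_one₀ (norm_nonneg _) hp two_ne_zero
  have e1 : qProd (p ^ 2) p * qProd (p ^ 2) (-p) = qProd (p ^ 4) (-p ^ 2) := by
    rw [qProd, qProd, ← (multipliable_one_add_mul_pow hp p).tprod_mul
      (multipliable_one_add_mul_pow hp (-p))]
    exact tprod_congr fun n => by ring
  have e2 : qProd (p ^ 2) (p ^ 2) * qProd (p ^ 2) (-p ^ 2) = qProd (p ^ 4) (-p ^ 4) := by
    rw [qProd, qProd, ← (multipliable_one_add_mul_pow hp (p ^ 2)).tprod_mul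
      (multipliable_one_add_mul_pow hp (-p ^ 2))]
    exact tprod_congr fun n => by ring
  have e3 : qProd (p ^ 4) (-p ^ 2) * qProd (p ^ 4) (-p ^ 4) = qProd (p ^ 2) (-p ^ 2) := by
    have h := tprod_even_mul_odd (f := fun n : ℕ => 1 + -p ^ 2 * (p ^ 2) ^ n)
      ((multipliable_one_add_mul_pow hp4 (-p ^ 2)).congr fun n => by ring)
      ((multipliable_one_add_mul_pow hp4 (-p ^ 4)).congr fun n => by ring)
    rw [qProd, qProd, qProd, ← h]
    congr 1 <;> exact tprod_congr fun n => by ring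
  have h0 := qProd_neg_self_ne_zero hp
  apply mul_right_cancel₀ h0
  rw [e1, mul_assoc, e2, e3, one_mul]

lemma theta00_mul_theta01_mul_theta10 {τ : ℂ} (hτ : 0 < τ.im) :
    theta00 τ 0 * theta01 τ 0 * theta10 τ 0 = 2 * eta τ ^ 3 := by
  have hq := norm_nome_sq_lt_one hτ
  have hn := nome_ne_zero τ
  rw [theta00_eq, theta01_eq, theta10_eq, jacobiTheta₂_eq_qProd hτ, jacobiTheta₂_eq_qProd hτ,
    jacobiTheta₂_eq_qProd hτ, zero_add, zero_add, zetaC_half, zetaC_half_tau, zetaC_zero,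
    inv_mul_cancel₀ hn, qProd_eq_mul hq 1]
  have h1 : thetaFactor τ 0 = cexp (Real.pi * I * τ / 12) ^ 3 := by
    rw [thetaFactor, ← Complex.exp_nat_mul]; congr 1; push_cast; ring
  have h2 : eta τ = cexp (Real.pi * I * τ / 12) * qProd (nome τ ^ 2) (-nome τ ^ 2) := by
    rw [eta, qProd_neg_self, qC_eq]
  rw [h1, h2]
  have h3 := qProd_mul_qProd_mul_qProd hq
  have h4 : (-1 : ℂ)⁻¹ = -1 := by norm_num
  rw [h4, inv_one, neg_one_mul, one_mul, one_mul, ← sq (nome τ)]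
  set a := qProd (nome τ ^ 2) (nome τ)
  set b := qProd (nome τ ^ 2) (-nome τ)
  set c := qProd (nome τ ^ 2) (nome τ ^ 2)
  linear_combination 2 * cexp (Real.pi * I * τ / 12) ^ 3 *
    qProd (nome τ ^ 2) (-nome τ ^ 2) ^ 3 * (a * b * c + 1) * h3

lemma eta_ne_zero {τ : ℂ} (hτ : 0 < τ.im) : eta τ ≠ 0 := by
  rw [eta, qC_eq]
  exact mul_ne_zero (Complex.exp_ne_zero _) (tprod_one_sub_pow_ne_zero (norm_nome_sq_lt_one hτ))

end ThetaProducts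

section Addition

/-- Product formula expressing a product of two theta series at `τ` by theta series at `2τ`. -/
lemma jacobiTheta₂_mul_jacobiTheta₂_s15 {τ : ℂ} (hτ : 0 < τ.im) (u v : ℂ) :
    jacobiTheta₂ u τ * jacobiTheta₂ v τ =
      jacobiTheta₂ (u + v) (2 * τ) * jacobiTheta₂ (u - v) (2 * τ) +
      cexp (2 * Real.pi * I * u + Real.pi * I * τ) *
        (jacobiTheta₂ (u + v + τ) (2 * τ) * jacobiTheta₂ (u - v + τ) (2 * τ)) := by
  have hτ2 : 0 < (2 * τ).im := by simpa using hτ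
  have hs (w : ℂ) : Summable fun n : ℤ => ‖jacobiTheta₂_term n w τ‖ :=
    ((summable_jacobiTheta₂_term_iff w τ).mpr hτ).norm
  have hs2 (w : ℂ) : Summable fun n : ℤ => ‖jacobiTheta₂_term n w (2 * τ)‖ :=
    ((summable_jacobiTheta₂_term_iff w (2 * τ)).mpr hτ2).norm
  have key (u v σ : ℂ) (h : ∀ w, Summable fun n : ℤ => ‖jacobiTheta₂_term n w σ‖) :
      HasSum (fun x : ℤ × ℤ => jacobiTheta₂_term x.1 u σ * jacobiTheta₂_term x.2 v σ)
        (jacobiTheta₂ u σ * jacobiTheta₂ v σ) := by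
    rw [jacobiTheta₂, jacobiTheta₂, tsum_mul_tsum_of_summable_norm (h u) (h v)]
    exact (summable_mul_of_summable_norm (h u) (h v)).hasSum
  have hL := key u v τ hs
  have hA := key (u + v) (u - v) (2 * τ) hs2
  have hB := (key (u + v + τ) (u - v + τ) (2 * τ) hs2).mul_left
    (cexp (2 * Real.pi * I * u + Real.pi * I * τ))
  let g : ℤ × ℤ → ℤ × ℤ := fun x => (x.1 + x.2, x.1 - x.2)
  let h : ℤ × ℤ → ℤ × ℤ := fun x => (x.1 + x.2 + 1, x.1 - x.2)
  have hg : Function.Injective g := by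
    rintro ⟨a, b⟩ ⟨c, d⟩ h
    simp only [g, Prod.mk.injEq] at h ⊢
    lia
  have hh : Function.Injective h := by
    rintro ⟨a, b⟩ ⟨c, d⟩ h'
    simp only [h, Prod.mk.injEq] at h' ⊢
    lia
  have hc : IsCompl (Set.range g) (Set.range h) := by
    rw [isCompl_iff, Set.disjoint_left, codisjoint_iff_le_sup]
    constructor
    · rintro _ ⟨⟨a, b⟩, rfl⟩ ⟨⟨c, d⟩, h'⟩
      simp only [g, h, Prod.mk.injEq] at h'
      lia
    · rintro ⟨m, n⟩ -
      rcases Int.even_or_odd' (m + n) with ⟨r, hr | hr⟩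
      · exact Or.inl ⟨(r, m - r), by simp only [g, Prod.mk.injEq]; lia⟩
      · exact Or.inr ⟨(r, m - 1 - r), by simp only [h, Prod.mk.injEq]; lia⟩
  set F : ℤ × ℤ → ℂ := fun x => jacobiTheta₂_term x.1 u τ * jacobiTheta₂_term x.2 v τ with hF
  have hA' : HasSum (F ∘ g)
      (jacobiTheta₂ (u + v) (2 * τ) * jacobiTheta₂ (u - v) (2 * τ)) := by
    convert! hA using 1
    funext x
    simp only [F, g, Function.comp_apply, jacobiTheta₂_term, ← Complex.exp_add]
    congr 1; push_cast; ring
  have hB' : HasSum (F ∘ h) (cexp (2 * Real.pi * I * u + Real.pi * I * τ) *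
        (jacobiTheta₂ (u + v + τ) (2 * τ) * jacobiTheta₂ (u - v + τ) (2 * τ))) := by
    convert! hB using 1
    funext x
    simp only [F, h, Function.comp_apply, jacobiTheta₂_term, ← Complex.exp_add]
    congr 1; push_cast; ring
  exact hL.unique ((hg.hasSum_range_iff.mpr hA').add_isCompl hc (hh.hasSum_range_iff.mpr hB'))

/-- The theta series `ϑ₀₀(2τ, 2z)`. -/
def thetaA (τ z : ℂ) : ℂ := jacobiTheta₂ (2 * z) (2 * τ)

/-- The theta series `ϑ₁₀(2τ, 2z)`. -/
def thetaB (τ z : ℂ) : ℂ :=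
  cexp (Real.pi * I * τ / 2 + 2 * Real.pi * I * z) * jacobiTheta₂ (2 * z + τ) (2 * τ)

variable {τ : ℂ}

lemma theta00_mul (hτ : 0 < τ.im) (x y : ℂ) :
    theta00 τ (x + y) * theta00 τ (x - y) =
      thetaA τ x * thetaA τ y + thetaB τ x * thetaB τ y := by
  rw [theta00_eq, theta00_eq, jacobiTheta₂_mul_jacobiTheta₂_s15 hτ, thetaA, thetaA, thetaB, thetaB,
    show x + y + (x - y) = 2 * x by ring, show x + y - (x - y) = 2 * y by ring,
    show 2 * Real.pi * I * (x + y) + Real.pi * I * τ =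
      (Real.pi * I * τ / 2 + 2 * Real.pi * I * x) +
        (Real.pi * I * τ / 2 + 2 * Real.pi * I * y) by ring, Complex.exp_add]
  ring

lemma exp_pi_mul_I_add (w : ℂ) : cexp (w + Real.pi * I) = -cexp w := by
  rw [Complex.exp_add, Complex.exp_pi_mul_I, mul_neg_one]

lemma theta01_mul (hτ : 0 < τ.im) (x y : ℂ) :
    theta01 τ (x + y) * theta01 τ (x - y) =
      thetaA τ x * thetaA τ y - thetaB τ x * thetaB τ y := by
  rw [theta01_eq, theta01_eq, jacobiTheta₂_mul_jacobiTheta₂_s15 hτ, thetaA, thetaA, thetaB, thetaB,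
    show x + y + 1 / 2 + (x - y + 1 / 2) = 2 * x + 1 by ring,
    show x + y + 1 / 2 - (x - y + 1 / 2) = 2 * y by ring,
    show 2 * x + 1 + τ = 2 * x + τ + 1 by ring, jacobiTheta₂_add_left, jacobiTheta₂_add_left,
    show 2 * Real.pi * I * (x + y + 1 / 2) + Real.pi * I * τ =
      (Real.pi * I * τ / 2 + 2 * Real.pi * I * x) +
        (Real.pi * I * τ / 2 + 2 * Real.pi * I * y) + Real.pi * I by ring,
    exp_pi_mul_I_add, Complex.exp_add]
  ring

lemma thetaFactor_mul (x y : ℂ) : thetaFactor τ (x + y) * thetaFactor τ (x - y) =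
    cexp (Real.pi * I * τ / 2 + 2 * Real.pi * I * x) := by
  rw [thetaFactor, thetaFactor, ← Complex.exp_add]; congr 1; ring

lemma jacobiTheta₂_two_mul_add (x : ℂ) : jacobiTheta₂ (2 * x + τ + τ) (2 * τ) =
    cexp (-(2 * Real.pi * I * τ + 4 * Real.pi * I * x)) * jacobiTheta₂ (2 * x) (2 * τ) := by
  rw [show 2 * x + τ + τ = 2 * x + 2 * τ by ring, jacobiTheta₂_add_left']
  congr 2; ring

lemma theta10_mul (hτ : 0 < τ.im) (x y : ℂ) :
    theta10 τ (x + y) * theta10 τ (x - y) =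
      thetaB τ x * thetaA τ y + thetaA τ x * thetaB τ y := by
  rw [theta10_eq, theta10_eq, mul_mul_mul_comm, thetaFactor_mul,
    jacobiTheta₂_mul_jacobiTheta₂_s15 hτ, thetaA, thetaA, thetaB, thetaB,
    show x + y + τ / 2 + (x - y + τ / 2) = 2 * x + τ by ring,
    show x + y + τ / 2 - (x - y + τ / 2) = 2 * y by ring, jacobiTheta₂_two_mul_add]
  have h : cexp (Real.pi * I * τ / 2 + 2 * Real.pi * I * x) *
      (cexp (2 * Real.pi * I * (x + y + τ / 2) + Real.pi * I * τ) *
        cexp (-(2 * Real.pi * I * τ + 4 * Real.pi * I * x))) =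
      cexp (Real.pi * I * τ / 2 + 2 * Real.pi * I * y) := by
    simp only [← Complex.exp_add]; congr 1; ring
  rw [← h]
  ring

lemma theta_mul (hτ : 0 < τ.im) (x y : ℂ) :
    theta τ (x + y) * theta τ (x - y) =
      thetaB τ x * thetaA τ y - thetaA τ x * thetaB τ y := by
  rw [theta_eq hτ, theta_eq hτ, mul_mul_mul_comm, thetaFactor_mul,
    jacobiTheta₂_mul_jacobiTheta₂_s15 hτ, thetaA, thetaA, thetaB, thetaB,
    show x + y + τ / 2 + 1 / 2 + (x - y + τ / 2 + 1 / 2) = 2 * x + τ + 1 by ring,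
    show x + y + τ / 2 + 1 / 2 - (x - y + τ / 2 + 1 / 2) = 2 * y by ring,
    show 2 * x + τ + 1 + τ = 2 * x + τ + τ + 1 by ring, jacobiTheta₂_add_left,
    jacobiTheta₂_add_left, jacobiTheta₂_two_mul_add]
  have h : cexp (Real.pi * I * τ / 2 + 2 * Real.pi * I * x) *
      (cexp (2 * Real.pi * I * (x + y + τ / 2 + 1 / 2) + Real.pi * I * τ) *
        cexp (-(2 * Real.pi * I * τ + 4 * Real.pi * I * x))) =
      -cexp (Real.pi * I * τ / 2 + 2 * Real.pi * I * y) := by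
    rw [← exp_pi_mul_I_add]
    simp only [← Complex.exp_add]; congr 1; ring
  rw [← neg_eq_iff_eq_neg] at h
  rw [← h]
  ring

end Addition

section WeightFour

open UpperHalfPlane hiding I
open ModularForm ModularGroup MatrixGroups EisensteinSeries
open scoped Manifold Topology

lemma theta00_zero_eq (τ : ℂ) : theta00 τ 0 = jacobiTheta τ := by
  rw [theta00_eq, jacobiTheta_eq_jacobiTheta₂]

lemma theta01_zero_eq (τ : ℂ) : theta01 τ 0 = jacobiTheta (τ + 1) := by
  refine tsum_congr fun n ↦ ?_
  have h : cexp (Real.pi * I * (n : ℂ) ^ 2) = (-1) ^ n := by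
    rw [show (Real.pi * I * (n : ℂ) ^ 2 : ℂ) = (n ^ 2 : ℤ) * (Real.pi * I) by push_cast; ring,
      Complex.exp_int_mul, Complex.exp_pi_mul_I]
    rcases Int.even_or_odd n with h | h
    · rw [h.neg_one_zpow, (h.pow_of_ne_zero two_ne_zero).neg_one_zpow]
    · rw [h.neg_one_zpow, h.pow.neg_one_zpow]
  rw [mul_add, Complex.exp_add _ (Real.pi * I * (n : ℂ) ^ 2 * 1), mul_one, h, mul_zero, add_zero,
    mul_comm]

lemma theta10_zero_pow_four {τ : ℂ} (hτ : 0 < τ.im) :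
    theta10 τ 0 ^ 4 = theta00 τ 0 ^ 4 - theta01 τ 0 ^ 4 := by
  have h00 := theta00_mul hτ 0 0
  have h01 := theta01_mul hτ 0 0
  have h10 := theta10_mul hτ 0 0
  simp only [add_zero, sub_zero] at h00 h01 h10
  calc theta10 τ 0 ^ 4 = (theta10 τ 0 * theta10 τ 0) ^ 2 := by ring
    _ = (theta00 τ 0 * theta00 τ 0) ^ 2 - (theta01 τ 0 * theta01 τ 0) ^ 2 := by
      rw [h00, h01, h10]; ring
    _ = _ := by ring

/-- The symmetric combination `ϑ₀₀⁸ + ϑ₀₁⁸ - ϑ₀₀⁴ϑ₀₁⁴` of theta constants, which is modular of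
weight four. -/
def thetaWeightFour (τ : ℂ) : ℂ :=
  theta00 τ 0 ^ 8 + theta01 τ 0 ^ 8 - theta00 τ 0 ^ 4 * theta01 τ 0 ^ 4

lemma thetaWeightFour_add_one (τ : ℂ) : thetaWeightFour (τ + 1) = thetaWeightFour τ := by
  have h : jacobiTheta (τ + 1 + 1) = jacobiTheta τ := by
    rw [← jacobiTheta_two_add τ]
    ring_nf
  simp only [thetaWeightFour, theta00_zero_eq, theta01_zero_eq, h]
  ring

lemma thetaWeightFour_neg_one_div {τ : ℂ} (hτ : 0 < τ.im) :
    thetaWeightFour (-1 / τ) = τ ^ 4 * thetaWeightFour τ := by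
  have hτ0 : τ ≠ 0 := by
    rintro rfl
    simp at hτ
  set s : ℂ := (-I * τ) ^ (1 / 2 : ℂ) with hs_def
  have hIτ : -I * τ ≠ 0 := mul_ne_zero (neg_ne_zero.mpr I_ne_zero) hτ0
  have hs : s ≠ 0 := by
    rw [hs_def, Ne, cpow_eq_zero_iff, not_and_or]
    exact Or.inl hIτ
  have hs8 : s ^ 8 = τ ^ 4 := by
    have h2 : s ^ 2 = -I * τ := by
      rw [hs_def, ← cpow_nat_mul]
      norm_num
    calc s ^ 8 = (s ^ 2) ^ 4 := by ring
      _ = I ^ 4 * τ ^ 4 := by rw [h2]; ring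
      _ = τ ^ 4 := by rw [I_pow_four, one_mul]
  have h00 : theta00 (-1 / τ) 0 = s * theta00 τ 0 := by
    have h := jacobiTheta₂_functional_equation 0 τ
    simp only [zero_div, ne_eq, OfNat.ofNat_ne_zero, not_false_eq_true, zero_pow, mul_zero,
      Complex.exp_zero, mul_one] at h
    rw [theta00_eq, theta00_eq, h, ← mul_assoc, ← hs_def, mul_one_div_cancel hs, one_mul]
  have h01 : theta01 (-1 / τ) 0 = s * theta10 τ 0 := by
    have h := jacobiTheta₂_functional_equation (τ / 2) τ
    have hdiv : τ / 2 / τ = 0 + 1 / 2 := by field_simp; simp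
    rw [theta01_eq, theta10_eq, zero_add (τ / 2), h, hdiv, thetaFactor, ← hs_def]
    have hexp : cexp (Real.pi * I * τ / 4 + Real.pi * I * 0) *
        cexp (-Real.pi * I * (τ / 2) ^ 2 / τ) = 1 := by
      rw [← Complex.exp_add, ← Complex.exp_zero]
      congr 1
      field_simp
      ring
    linear_combination (-jacobiTheta₂ (0 + 1 / 2) (-1 / τ)) * hexp -
      cexp (Real.pi * I * τ / 4 + Real.pi * I * 0) * cexp (-Real.pi * I * (τ / 2) ^ 2 / τ) *
        jacobiTheta₂ (0 + 1 / 2) (-1 / τ) * mul_one_div_cancel hs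
  have h10 := theta10_zero_pow_four hτ
  rw [thetaWeightFour, thetaWeightFour, h00, h01]
  calc (s * theta00 τ 0) ^ 8 + (s * theta10 τ 0) ^ 8 - (s * theta00 τ 0) ^ 4 * (s * theta10 τ 0) ^ 4
      = s ^ 8 * (theta00 τ 0 ^ 8 + (theta10 τ 0 ^ 4) ^ 2 - theta00 τ 0 ^ 4 * theta10 τ 0 ^ 4) := by
        ring
    _ = _ := by
      rw [hs8, h10]
      ring

lemma differentiableAt_thetaWeightFour {τ : ℂ} (hτ : 0 < τ.im) :
    DifferentiableAt ℂ thetaWeightFour τ := by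
  have h0 := differentiableAt_jacobiTheta hτ
  have h1 : DifferentiableAt ℂ (fun w ↦ jacobiTheta (w + 1)) τ := by
    have : DifferentiableAt ℂ jacobiTheta (τ + 1) :=
      differentiableAt_jacobiTheta (by simpa using hτ)
    exact this.comp τ (f := fun w : ℂ ↦ w + 1) (by fun_prop)
  have : thetaWeightFour = fun w ↦ jacobiTheta w ^ 8 + jacobiTheta (w + 1) ^ 8
      - jacobiTheta w ^ 4 * jacobiTheta (w + 1) ^ 4 := by
    ext w
    rw [thetaWeightFour, theta00_zero_eq, theta01_zero_eq]
  rw [this]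
  fun_prop

lemma tendsto_jacobiTheta_comap_im :
    Filter.Tendsto jacobiTheta (Filter.comap im Filter.atTop) (𝓝 1) := by
  have h : Filter.Tendsto (fun τ : ℂ ↦ Real.exp (-Real.pi * τ.im)) (Filter.comap im Filter.atTop)
      (𝓝 0) :=
    Real.tendsto_exp_atBot.comp
      ((Filter.tendsto_comap).const_mul_atTop_of_neg (neg_lt_zero.mpr Real.pi_pos))
  simpa using (isBigO_at_im_infty_jacobiTheta_sub_one.trans_tendsto h).add_const 1

lemma tendsto_thetaWeightFour :
    Filter.Tendsto (fun z : ℍ ↦ thetaWeightFour z) atImInfty (𝓝 1) := by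
  have hcoe : Filter.Tendsto (fun z : ℍ ↦ (z : ℂ)) atImInfty (Filter.comap im Filter.atTop) :=
    Filter.tendsto_comap_iff.mpr Filter.tendsto_comap
  have hadd : Filter.Tendsto (fun z : ℍ ↦ (z : ℂ) + 1) atImInfty
      (Filter.comap im Filter.atTop) := by
    refine Filter.tendsto_comap_iff.mpr ?_
    have : Complex.im ∘ (fun z : ℍ ↦ (z : ℂ) + 1) = UpperHalfPlane.im := by
      ext z
      simp
    rw [this]
    exact Filter.tendsto_comap
  have h0 := tendsto_jacobiTheta_comap_im.comp hcoe
  have h1 := tendsto_jacobiTheta_comap_im.comp hadd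
  have := ((h0.pow 8).add (h1.pow 8)).sub ((h0.pow 4).mul (h1.pow 4))
  simpa [thetaWeightFour, theta00_zero_eq, theta01_zero_eq] using this

lemma thetaWeightFour_slash (γ : SL(2, ℤ)) :
    (fun z : ℍ ↦ thetaWeightFour z) ∣[(4 : ℤ)] γ = fun z : ℍ ↦ thetaWeightFour z := by
  refine SlashInvariantForm.slash_action_generators_SL2Z ?_ ?_ γ
  · ext z
    rw [SL_slash_apply, denom_S, modular_S_smul]
    have h := thetaWeightFour_neg_one_div z.im_pos
    have hz := z.ne_zero
    rw [show (-1 / (z : ℂ)) = (-(z : ℂ))⁻¹ by field_simp] at h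
    change thetaWeightFour (-(z : ℂ))⁻¹ * _ = _
    rw [h, zpow_neg]
    norm_cast
    field_simp
  · ext z
    rw [SL_slash_apply, modular_T_smul]
    have h : thetaWeightFour ((1 : ℝ) +ᵥ z : ℍ) = thetaWeightFour z := by
      rw [coe_vadd, add_comm, ofReal_one, thetaWeightFour_add_one]
    rw [h]
    rw [denom_apply]
    simp [ModularGroup.T]

/-- The function `thetaWeightFour` as a modular form of level one. -/
def thetaModularForm : ModularForm 𝒮ℒ 4 where
  toFun z := thetaWeightFour z
  slash_action_eq' := fun _ ⟨γ, hγ⟩ ↦ hγ ▸ thetaWeightFour_slash γ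
  holo' := by
    rw [UpperHalfPlane.mdifferentiable_iff]
    intro z hz
    have := (differentiableAt_thetaWeightFour hz).differentiableWithinAt (s := {z | 0 < z.im})
    refine DifferentiableWithinAt.congr this (fun w hw ↦ ?_) ?_
    · simp [ofComplex_apply_of_im_pos hw]
    · simp [ofComplex_apply_of_im_pos hz]
  bdd_at_cusps' {c} hc := by
    rw [Subgroup.IsArithmetic.isCusp_iff_isCusp_SL2Z] at hc
    rw [OnePoint.isBoundedAt_iff_forall_SL2Z hc]
    intro γ _
    rw [thetaWeightFour_slash γ, IsBoundedAtImInfty, Filter.BoundedAtFilter]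
    exact tendsto_thetaWeightFour.isBigO_one ℝ

lemma E₄_eq_thetaModularForm : E₄ = thetaModularForm := by
  obtain ⟨c, hc⟩ : ∃ c : ℂ, c • E₄ = thetaModularForm :=
    (finrank_eq_one_iff_of_nonzero' E₄ (E_ne_zero _ ⟨2, rfl⟩)).mp
      (Module.rank_eq_one_iff_finrank_eq_one.mp levelOne_weight_four_rank_one) _
  have h : (qExpansion 1 (c • E₄ : ℍ → ℂ)).coeff 0 = (qExpansion 1 thetaModularForm).coeff 0 := by
    rw [show (c • E₄ : ℍ → ℂ) = thetaModularForm from congrArg DFunLike.coe hc]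
  rw [ModularForm.qExpansion_smul one_pos one_mem_strictPeriods_SL c E₄,
    qExpansion_coeff_zero one_pos
      (ModularFormClass.analyticAt_cuspFunction_zero _ one_pos one_mem_strictPeriods_SL)
      (SlashInvariantFormClass.periodic_comp_ofComplex _ one_mem_strictPeriods_SL),
    PowerSeries.coeff_smul, E_qExpansion_coeff_zero _ ⟨2, rfl⟩] at h
  have h1 : valueAtInfty thetaModularForm = 1 := tendsto_thetaWeightFour.limUnder_eq
  rw [h1, smul_eq_mul, mul_one] at h
  rw [← hc, h, one_smul]

lemma Eis_four_eq {τ : ℂ} (hτ : 0 < τ.im) : Eis 4 τ = thetaWeightFour τ := by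
  have h : E₄ ⟨τ, hτ⟩ = thetaWeightFour τ := by
    rw [E₄_eq_thetaModularForm]
    rfl
  rw [← h, q_expansion_bernoulli (by norm_num) ⟨2, rfl⟩, Eis]
  simp_rw [zpow_natCast]
  rw [tsum_pnat_eq_tsum_succ
    (f := fun n ↦ (ArithmeticFunction.sigma (4 - 1) n : ℂ) * cexp (2 * Real.pi * I * τ) ^ n)]
  simp [sigma', ArithmeticFunction.sigma_apply, qC, e2]

end WeightFour

/-- `24 φ_{0,2} = φ_{0,1}² - E₄ φ_{-2,1}²` on `ℍ × ℂ`. -/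
theorem twentyfour_phi02 (τ z : ℂ) (hτ : 0 < τ.im) :
    24 * phi02 τ z = phi01 τ z ^ 2 - Eis 4 τ * phiM21 τ z ^ 2 := by
  have hη := theta00_mul_theta01_mul_theta10 hτ
  have hη0 := eta_ne_zero hτ
  have hη12 : eta τ ^ 12 = (theta00 τ 0 * theta01 τ 0 * theta10 τ 0) ^ 4 / 16 := by
    rw [hη]
    ring
  have hprod : theta00 τ 0 * theta01 τ 0 * theta10 τ 0 ≠ 0 := by
    rw [hη]
    exact mul_ne_zero two_ne_zero (pow_ne_zero 3 hη0)
  have ha : theta00 τ 0 ≠ 0 := fun h ↦ hprod (by simp [h])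
  have hb : theta01 τ 0 ≠ 0 := fun h ↦ hprod (by simp [h])
  have hc : theta10 τ 0 ≠ 0 := fun h ↦ hprod (by simp [h])
  have a2 := theta00_mul hτ 0 0
  have b2 := theta01_mul hτ 0 0
  have c2 := theta10_mul hτ 0 0
  have a2z := theta00_mul hτ z z
  have b2z := theta01_mul hτ z z
  have c2z := theta10_mul hτ z z
  have az := theta00_mul hτ z 0
  have bz := theta01_mul hτ z 0
  have cz := theta10_mul hτ z 0
  have dz := theta_mul hτ z 0
  simp only [add_zero, sub_zero, sub_self, ← two_mul z] at a2 b2 c2 a2z b2z c2z az bz cz dz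
  set A := thetaA τ z
  set B := thetaB τ z
  set α := thetaA τ 0
  set β := thetaB τ 0
  have ha2 : α * α + β * β ≠ 0 := a2 ▸ mul_ne_zero ha ha
  have hb2 : α * α - β * β ≠ 0 := b2 ▸ mul_ne_zero hb hb
  have hc2 : β * α + α * β ≠ 0 := c2 ▸ mul_ne_zero hc hc
  have hα : α ≠ 0 := fun h ↦ hc2 (by simp [h])
  have hβ : β ≠ 0 := fun h ↦ hc2 (by simp [h])
  have x00 : xi00 τ z ^ 2 = (A * α + B * β) / (α * α + β * β) := by
    rw [xi00, div_pow, sq, sq, az, a2]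
  have x01 : xi01 τ z ^ 2 = (A * α - B * β) / (α * α - β * β) := by
    rw [xi01, div_pow, sq, sq, bz, b2]
  have x10 : xi10 τ z ^ 2 = (B * α + A * β) / (2 * α * β) := by
    rw [xi10, div_pow, sq, sq, cz, c2]
    ring
  have y00 : xi00 τ (2 * z) = (A * A + B * B) / (α * α + β * β) := by
    rw [xi00, ← a2, ← a2z, mul_div_mul_right _ _ ha]
  have y01 : xi01 τ (2 * z) = (A * A - B * B) / (α * α - β * β) := by
    rw [xi01, ← b2, ← b2z, mul_div_mul_right _ _ hb]
  have y10 : xi10 τ (2 * z) = A * B / (α * β) := by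
    have : xi10 τ (2 * z) = (B * A + A * B) / (β * α + α * β) := by
      rw [xi10, ← c2, ← c2z, mul_div_mul_right _ _ hc]
    rw [this]
    field_simp
  have hE : Eis 4 τ = α ^ 8 + 14 * α ^ 4 * β ^ 4 + β ^ 8 := by
    rw [Eis_four_eq hτ, thetaWeightFour]
    calc _ = (theta00 τ 0 * theta00 τ 0) ^ 4 + (theta01 τ 0 * theta01 τ 0) ^ 4
        - (theta00 τ 0 * theta00 τ 0) ^ 2 * (theta01 τ 0 * theta01 τ 0) ^ 2 := by ring
      _ = _ := by
        rw [a2, b2]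
        ring
  have hM : phiM21 τ z ^ 2 = 4 * (B * α - A * β) ^ 2 /
      ((α * α + β * β) * (α * α - β * β) * (α * β)) ^ 2 := by
    have h : eta τ ^ 12 = ((α * α + β * β) * (α * α - β * β) * (α * β)) ^ 2 / 4 := by
      rw [hη12, ← a2, ← b2]
      linear_combination (theta00 τ 0 * theta01 τ 0) ^ 4 / 16 *
        (theta10 τ 0 * theta10 τ 0 + 2 * α * β) * c2
    rw [phiM21, div_pow, ← pow_mul (eta τ), h, sq (theta τ z), dz]
    field_simp
  have ha2' : α ^ 2 + β ^ 2 ≠ 0 := by simpa only [sq] using ha2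
  have hb2' : α ^ 2 - β ^ 2 ≠ 0 := by simpa only [sq] using hb2
  rw [phi02, phi01, x00, x01, x10, y00, y01, y10, hE, hM]
  simp only [← sq]
  field_simp
  ring

end JacobiPaper
end
end
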